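/- Let (X, ℝ, α) be a nontrivial one-parameter C*-dynamical system. Then the analytic subalgebra X^α([0,∞)) is a maximal norm-closed subalgebra of X if and only if Condition 4.3 holds. -/

import Mathlib

open MeasureTheory Set Filter Topology Pointwise

noncomputable section

namespace PeligradMax

variable {X : Type*} [NonUnitalNormedRing X] [StarRing X] [CStarRing X]
  [NormedSpace ℂ X] [IsScalarTower ℂ X X] [SMulCommClass ℂ X X] [StarModule ℂ X]
  [CompleteSpace X] [PartialOrder X] [StarOrderedRing X]

/-- A one-parameter C*-dynamical system: a group of *-automorphisms of `X`
with norm-continuous orbit maps. -/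
structure IsCStarDynSys (α : ℝ → X → X) : Prop where
  map_zero_time : ∀ x, α 0 x = x
  map_add_time : ∀ s t x, α (s + t) x = α s (α t x)
  map_add : ∀ t x y, α t (x + y) = α t x + α t y
  map_smulc : ∀ (t : ℝ) (c : ℂ) (x : X), α t (c • x) = c • α t x
  map_mul : ∀ t x y, α t (x * y) = α t x * α t y
  map_star : ∀ t x, α t (star x) = star (α t x)
  continuous_orbit : ∀ x, Continuous fun t => α t x

/-- Closed linear span. -/
def ClosedSpan (S : Set X) : Set X := closure ((Submodule.span ℂ S : Submodule ℂ X) : Set X)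

def MulSet2 (S T : Set X) : Set X := {z | ∃ s ∈ S, ∃ t ∈ T, z = s * t}

def MulSet3 (S T R : Set X) : Set X := {z | ∃ s ∈ S, ∃ t ∈ T, ∃ r ∈ R, z = s * t * r}

/-- Fourier transform of an integrable function. -/
def fourierT (f : ℝ → ℂ) (γ : ℝ) : ℂ := ∫ t : ℝ, f t * Complex.exp (-(Complex.I * γ * t))

/-- `α_f(x) = ∫ f(t) α_t(x) dt`. -/
def smear (α : ℝ → X → X) (f : ℝ → ℂ) (x : X) : X := ∫ t : ℝ, f t • α t x

/-- Arveson spectrum of an element. -/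
def elemSpec (α : ℝ → X → X) (x : X) : Set ℝ :=
  {γ | ∀ f : ℝ → ℂ, Integrable f → smear α f x = 0 → fourierT f γ = 0}

/-- Spectral subspace associated with a closed set `F ⊆ ℝ`. -/
def specC (α : ℝ → X → X) (F : Set ℝ) : Set X := {x | elemSpec α x ⊆ F}

/-- Spectral subspace of the subset `S` associated with an open set `U ⊆ ℝ`. -/
def specO (α : ℝ → X → X) (S : Set X) (U : Set ℝ) : Set X :=
  ClosedSpan {y | ∃ x ∈ S, ∃ f : ℝ → ℂ, Integrable f ∧
    IsCompact (tsupport (fourierT f)) ∧ tsupport (fourierT f) ⊆ U ∧ y = smear α f x}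

/-- The fixed point algebra `X^α`. -/
def fixedPts (α : ℝ → X → X) : Set X := {x | ∀ t, α t x = x}

/-- The Arveson spectrum of the action restricted to `S`. -/
def actSpec (α : ℝ → X → X) (S : Set X) : Set ℝ :=
  {γ : ℝ | ∀ ε > (0 : ℝ), S ∩ specC α (Icc (γ - ε) (γ + ε)) ≠ ({0} : Set X)}

def Invariant (α : ℝ → X → X) (S : Set X) : Prop := ∀ t : ℝ, ∀ x ∈ S, α t x ∈ S

def IsSubalgebra (B : Set X) : Prop :=
  (0 : X) ∈ B ∧ (∀ x ∈ B, ∀ y ∈ B, x + y ∈ B) ∧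
  (∀ c : ℂ, ∀ x ∈ B, c • x ∈ B) ∧ ∀ x ∈ B, ∀ y ∈ B, x * y ∈ B

def IsStarSubalgebra (B : Set X) : Prop := IsSubalgebra B ∧ ∀ x ∈ B, star x ∈ B

/-- `B` is a hereditary C*-subalgebra of the subset `S`. -/
def IsHereditaryIn (S B : Set X) : Prop :=
  B ⊆ S ∧ IsClosed B ∧ IsStarSubalgebra B ∧
  ∀ x ∈ S, ∀ b ∈ B, 0 ≤ x → x ≤ b → x ∈ B

/-- `K` is a norm-closed two-sided ideal of the subset `S`. -/
def IsClosedTwoSidedIdealIn (S K : Set X) : Prop :=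
  K ⊆ S ∧ IsClosed K ∧ (0 : X) ∈ K ∧ (∀ x ∈ K, ∀ y ∈ K, x + y ∈ K) ∧
  (∀ c : ℂ, ∀ x ∈ K, c • x ∈ K) ∧ ∀ s ∈ S, ∀ k ∈ K, s * k ∈ K ∧ k * s ∈ K

/-- `S` is `α`-simple: no nontrivial norm-closed `α`-invariant two-sided ideals. -/
def AlphaSimple (α : ℝ → X → X) (S : Set X) : Prop :=
  ∀ K : Set X, IsClosedTwoSidedIdealIn S K → Invariant α K → K = ({0} : Set X) ∨ K = S

/-- The strong Arveson spectrum of the action restricted to `B`. -/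
def strongSpec (α : ℝ → X → X) (B : Set X) : Set ℝ :=
  {γ : ℝ | ∀ ε > (0 : ℝ),
    ClosedSpan (MulSet3 (star '' (B ∩ specC α (Icc (γ - ε) (γ + ε)))) B
      (B ∩ specC α (Icc (γ - ε) (γ + ε)))) = B}

/-- The strong Connes spectrum of the action restricted to `S`. -/
def ConnesSpec (α : ℝ → X → X) (S : Set X) : Set ℝ :=
  ⋂ B ∈ {B : Set X | IsHereditaryIn S B ∧ B ≠ ({0} : Set X) ∧ Invariant α B},
    strongSpec α B

def IsMaximalClosedSubalgebra (B : Set X) : Prop :=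
  IsClosed B ∧ IsSubalgebra B ∧ B ≠ (univ : Set X) ∧
  ∀ W : Set X, IsClosed W → IsSubalgebra W → B ⊆ W → W = B ∨ W = univ

/-- The spectral Condition 4.3. -/
def Condition43 (α : ℝ → X → X) : Prop :=
  (∃ γ₀ : ℝ, 0 < γ₀ ∧ actSpec α (univ : Set X) = ({-γ₀, 0, γ₀} : Set ℝ) ∧
    IsClosedTwoSidedIdealIn (fixedPts α)
      (ClosedSpan (MulSet2 (specC α ({γ₀} : Set ℝ)) (star '' specC α ({γ₀} : Set ℝ)))) ∧
    ∀ K : Set X,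
      IsClosedTwoSidedIdealIn
        (ClosedSpan (MulSet2 (specC α ({γ₀} : Set ℝ)) (star '' specC α ({γ₀} : Set ℝ)))) K →
      K = ({0} : Set X) ∨
        K = ClosedSpan (MulSet2 (specC α ({γ₀} : Set ℝ)) (star '' specC α ({γ₀} : Set ℝ)))) ∨
  (∃ Y : Set X, IsClosedTwoSidedIdealIn (univ : Set X) Y ∧ Invariant α Y ∧ AlphaSimple α Y ∧
    specO α Y (Ioi (0 : ℝ)) = specO α (univ : Set X) (Ioi (0 : ℝ)) ∧
    actSpec α Y = ConnesSpec α Y ∧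
    closure (Y + specC α (Ici (0 : ℝ))) = (univ : Set X))

set_option linter.unusedSectionVars false

section

open scoped ContDiff FourierTransform SchwartzMap

/-- Smooth compactly supported functions, used as spectral multipliers. -/
structure Tst (φ : ℝ → ℂ) : Prop where
  smooth : ContDiff ℝ ∞ φ
  cpt : HasCompactSupport φ

/-- The inverse Fourier transform, normalised as an inverse of `fourierT`. -/
def ker (φ : ℝ → ℂ) (t : ℝ) : ℂ :=
  (2 * Real.pi : ℂ)⁻¹ * ∫ γ : ℝ, φ γ * Complex.exp (Complex.I * γ * t)

namespace Tst

variable {φ ψ : ℝ → ℂ}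

lemma mul (h : Tst φ) (h' : Tst ψ) : Tst (fun γ => φ γ * ψ γ) :=
  ⟨h.smooth.mul h'.smooth, h.cpt.mul_right⟩

lemma sub (h : Tst φ) (h' : Tst ψ) : Tst (fun γ => φ γ - ψ γ) :=
  ⟨h.smooth.sub h'.smooth, h.cpt.sub h'.cpt⟩

lemma continuous (h : Tst φ) : Continuous φ := h.smooth.continuous

lemma integrable (h : Tst φ) : Integrable φ := h.continuous.integrable_of_hasCompactSupport h.cpt

lemma comp_affine (h : Tst φ) {a : ℝ} (ha : a ≠ 0) (b : ℝ) : Tst (fun γ => φ (a * γ + b)) := by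
  refine ⟨h.smooth.comp (by fun_prop), ?_⟩
  have := h.cpt.comp_homeomorph ((Homeomorph.mulLeft₀ a ha).trans (Homeomorph.addRight b))
  simpa [Function.comp_def] using this

lemma conj_neg (h : Tst φ) : Tst (fun γ => (starRingEnd ℂ) (φ (-γ))) := by
  refine ⟨?_, ?_⟩
  · exact (Complex.conjCLE.contDiff (n := ∞)).comp (h.smooth.comp contDiff_neg)
  · have := h.cpt.comp_homeomorph (Homeomorph.neg ℝ)
    exact this.comp_left (g := (starRingEnd ℂ)) (map_zero _)

end Tst

/-- Plateau functions. -/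
lemma exists_plateau {a' a b b' : ℝ} (h1 : a' < a) (h2 : a ≤ b) (h3 : b < b') :
    ∃ φ : ℝ → ℂ, Tst φ ∧ (∀ γ ∈ Icc a b, φ γ = 1) ∧ tsupport φ ⊆ Icc a' b' := by
  set δ := min (a - a') (b' - b) with hδ
  have hδ0 : 0 < δ := lt_min (by linarith) (by linarith)
  let B : ContDiffBump ((a + b) / 2 : ℝ) := ⟨(b - a) / 2 + δ / 2, (b - a) / 2 + δ, by linarith, by linarith⟩
  have hl : δ ≤ a - a' := min_le_left _ _
  have hr : δ ≤ b' - b := min_le_right _ _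
  have hts : tsupport (fun γ => ((B γ : ℝ) : ℂ)) ⊆ Icc a' b' := by
    have : tsupport (fun γ => ((B γ : ℝ) : ℂ)) ⊆ tsupport B := by
      apply closure_mono
      intro x hx
      simpa using hx
    refine this.trans ?_
    rw [B.tsupport_eq, Real.closedBall_eq_Icc]
    apply Icc_subset_Icc <;> simp only [B] <;> linarith
  refine ⟨fun γ => ((B γ : ℝ) : ℂ), ⟨Complex.ofRealCLM.contDiff.comp B.contDiff, ?_⟩, ?_, hts⟩
  · exact isCompact_Icc.of_isClosed_subset (isClosed_tsupport _) hts
  · intro γ hγ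
    have : B γ = 1 := B.one_of_mem_closedBall (by
      rw [Real.closedBall_eq_Icc]
      constructor <;> simp only [B] <;> linarith [hγ.1, hγ.2])
    simp [this]

lemma ker_eq_fourierInv (φ : ℝ → ℂ) (t : ℝ) :
    ker φ t = (2 * Real.pi : ℂ)⁻¹ * 𝓕⁻ φ (t / (2 * Real.pi)) := by
  rw [ker, Real.fourierInv_eq']
  congr 1
  refine integral_congr_ae (ae_of_all _ fun γ => ?_)
  simp only [smul_eq_mul, mul_comm (φ γ)]
  congr 2
  push_cast
  simp
  field_simp

lemma Tst.exists_schwartz {φ : ℝ → ℂ} (h : Tst φ) :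
    ∃ f : 𝓢(ℝ, ℂ), ∀ t, ker φ t = (2 * Real.pi : ℂ)⁻¹ * f (t / (2 * Real.pi)) := by
  refine ⟨𝓕⁻ (h.cpt.toSchwartzMap h.smooth), fun t => ?_⟩
  rw [ker_eq_fourierInv, SchwartzMap.fourierInv_coe]
  rfl

lemma Tst.ker_continuous {φ : ℝ → ℂ} (h : Tst φ) : Continuous (ker φ) := by
  obtain ⟨f, hf⟩ := h.exists_schwartz
  rw [show ker φ = _ from funext hf]
  have := f.continuous
  fun_prop

lemma Tst.ker_integrable {φ : ℝ → ℂ} (h : Tst φ) : Integrable (ker φ) := by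
  obtain ⟨f, hf⟩ := h.exists_schwartz
  rw [show ker φ = _ from funext hf]
  exact (f.integrable.comp_div (by positivity)).const_mul _

lemma Tst.ker_decay {φ : ℝ → ℂ} (h : Tst φ) :
    ∃ C : ℝ, 0 ≤ C ∧ ∀ t, ‖ker φ t‖ ≤ C * (1 + t ^ 2)⁻¹ := by
  obtain ⟨f, hf⟩ := h.exists_schwartz
  obtain ⟨C0, hC0⟩ := f.decay' 0 0
  obtain ⟨C2, hC2⟩ := f.decay' 2 0
  have hC0' : 0 ≤ C0 := le_trans (by positivity) (hC0 0)
  have hC2' : 0 ≤ C2 := le_trans (by positivity) (hC2 0)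
  refine ⟨(2 * Real.pi)⁻¹ * (C0 + (2 * Real.pi) ^ 2 * C2), by positivity, fun t => ?_⟩
  rw [← div_eq_mul_inv, le_div_iff₀ (by positivity), hf]
  have h0 := hC0 (t / (2 * Real.pi))
  have h2 := hC2 (t / (2 * Real.pi))
  simp only [norm_iteratedFDeriv_zero, pow_zero, one_mul, Real.norm_eq_abs, sq_abs] at h0 h2
  have hn : ‖((2 * Real.pi : ℂ)⁻¹)‖ = (2 * Real.pi)⁻¹ := by
    rw [norm_inv, norm_mul]; simp [abs_of_pos Real.pi_pos]
  rw [norm_mul, hn, mul_assoc]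
  gcongr
  rw [mul_add, mul_one]
  have e : (t / (2 * Real.pi)) ^ 2 * (2 * Real.pi) ^ 2 = t ^ 2 := by
    rw [← mul_pow, div_mul_cancel₀ _ (by positivity)]
  change _ * ‖f (t / (2 * Real.pi))‖ ≤ _ at h2
  change ‖f (t / (2 * Real.pi))‖ ≤ _ at h0
  calc _ = ‖f (t / (2 * Real.pi))‖ + (2 * Real.pi) ^ 2 * ((t / (2 * Real.pi)) ^ 2 * ‖f (t / (2 * Real.pi))‖) := by
        rw [← e]; ring
    _ ≤ _ := by gcongr

lemma Tst.fourierT_ker {φ : ℝ → ℂ} (h : Tst φ) (γ : ℝ) : fourierT (ker φ) γ = φ γ := by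
  have hinv : 𝓕 (𝓕⁻ φ) = φ := by
    have := FourierTransform.fourier_fourierInv_eq (F := 𝓢(ℝ, ℂ)) (h.cpt.toSchwartzMap h.smooth)
    have h2 := congrArg (fun f : 𝓢(ℝ, ℂ) => (f : ℝ → ℂ)) this
    simp only [SchwartzMap.fourier_coe, SchwartzMap.fourierInv_coe] at h2
    exact h2
  conv_rhs => rw [← hinv, Real.fourier_eq']
  rw [fourierT]
  simp_rw [ker_eq_fourierInv]
  have := Measure.integral_comp_div (fun u : ℝ => Complex.exp (↑(-2 * Real.pi * inner ℝ u γ) * Complex.I) • 𝓕⁻ φ u) (2 * Real.pi)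
  rw [eq_comm, ← eq_inv_smul_iff₀ (by positivity)] at this
  rw [this, ← integral_smul]
  refine integral_congr_ae (ae_of_all _ fun t => ?_)
  simp only [smul_eq_mul, Complex.real_smul]
  rw [mul_assoc, mul_comm (𝓕⁻ φ _), abs_of_pos (by positivity)]
  push_cast
  congr 3
  simp
  field_simp

lemma ker_mul_exp_dilate (φ : ℝ → ℂ) {δ : ℝ} (hδ : 0 < δ) (γ₀ t : ℝ) :
    ker (fun γ => φ (δ⁻¹ * γ + -(δ⁻¹ * γ₀))) t = δ * Complex.exp (Complex.I * γ₀ * t) * ker φ (δ * t) := by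
  rw [ker, ker]
  have h1 := integral_sub_right_eq_self (μ := volume) (fun γ : ℝ => φ (δ⁻¹ * γ) * Complex.exp (Complex.I * (γ + γ₀ : ℝ) * t)) γ₀
  have h2 := Measure.integral_comp_mul_left (fun γ : ℝ => φ γ * Complex.exp (Complex.I * (δ * γ + γ₀ : ℝ) * t)) δ⁻¹
  have e1 : (∫ γ : ℝ, φ (δ⁻¹ * γ + -(δ⁻¹ * γ₀)) * Complex.exp (Complex.I * γ * t)) =
      ∫ γ : ℝ, φ (δ⁻¹ * (γ - γ₀)) * Complex.exp (Complex.I * ((γ - γ₀) + γ₀ : ℝ) * t) := by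
    congr 1; ext γ; congr 2 <;> [ring_nf; (congr 2; simp)]
  have e2 : (∫ γ : ℝ, φ (δ⁻¹ * γ) * Complex.exp (Complex.I * (γ + γ₀ : ℝ) * t)) =
      ∫ γ : ℝ, φ (δ⁻¹ * γ) * Complex.exp (Complex.I * (δ * (δ⁻¹ * γ) + γ₀ : ℝ) * t) := by
    congr 1; ext γ; rw [← mul_assoc, mul_inv_cancel₀ hδ.ne', one_mul]
  rw [e1, h1, e2, h2, inv_inv, abs_of_pos hδ]
  have e3 : (∫ γ : ℝ, φ γ * Complex.exp (Complex.I * (δ * γ + γ₀ : ℝ) * t)) =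
     Complex.exp (Complex.I * γ₀ * t) * ∫ γ : ℝ, φ γ * Complex.exp (Complex.I * γ * (δ * t : ℝ)) := by
    rw [← integral_const_mul]
    congr 1; ext γ
    rw [mul_left_comm, ← Complex.exp_add]
    congr 2; push_cast; ring
  rw [e3, Complex.real_smul]
  ring

/-- `L¹`-modulus of continuity of the kernel. -/
def kmod (φ : ℝ → ℂ) (u : ℝ) : ℝ := ∫ t, ‖ker φ (t - u) - ker φ t‖

lemma Tst.kmod_measurable {φ : ℝ → ℂ} (h : Tst φ) : StronglyMeasurable (kmod φ) := by
  have := h.ker_continuous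
  have hc : Continuous fun p : ℝ × ℝ => ‖ker φ (p.2 - p.1) - ker φ p.2‖ := by fun_prop
  exact hc.stronglyMeasurable.integral_prod_right'

lemma kmod_nonneg (φ : ℝ → ℂ) (u : ℝ) : 0 ≤ kmod φ u := integral_nonneg fun _ => norm_nonneg _

lemma Tst.kmod_le {φ : ℝ → ℂ} (h : Tst φ) (u : ℝ) : kmod φ u ≤ 2 * ∫ t, ‖ker φ t‖ := by
  have i1 : Integrable fun t => ‖ker φ (t - u)‖ := (h.ker_integrable.comp_sub_right u).norm
  have i2 : Integrable fun t => ‖ker φ t‖ := h.ker_integrable.norm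
  calc kmod φ u ≤ ∫ t, (‖ker φ (t - u)‖ + ‖ker φ t‖) := by
        apply integral_mono_of_nonneg (ae_of_all _ fun _ => norm_nonneg _) (i1.add i2)
        exact ae_of_all _ fun t => norm_sub_le _ _
    _ = _ := by
        rw [integral_add i1 i2, integral_sub_right_eq_self (fun t => ‖ker φ t‖) u]; ring

lemma Tst.kmod_tendsto {φ : ℝ → ℂ} (h : Tst φ) : Tendsto (kmod φ) (𝓝 0) (𝓝 0) := by
  obtain ⟨C, hC, hk⟩ := h.ker_decay
  have hc := h.ker_continuous
  have : Tendsto (kmod φ) (𝓝 0) (𝓝 (∫ t : ℝ, (0 : ℝ))) := by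
    refine tendsto_integral_filter_of_dominated_convergence (fun t => 4 * C * (1 + t ^ 2)⁻¹) ?_ ?_ ?_ ?_
    · refine Eventually.of_forall fun u => Continuous.aestronglyMeasurable ?_
      fun_prop
    · filter_upwards [Metric.ball_mem_nhds (0 : ℝ) one_pos] with u hu
      refine ae_of_all _ fun t => ?_
      have hu' : u ^ 2 ≤ 1 := by
        rw [Metric.mem_ball, dist_zero_right, Real.norm_eq_abs] at hu
        rw [sq_le_one_iff_abs_le_one]; exact hu.le
      rw [norm_norm]
      have h1 : (1 + (t - u) ^ 2)⁻¹ ≤ 3 * (1 + t ^ 2)⁻¹ := by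
        rw [← div_eq_mul_inv, inv_eq_one_div, div_le_div_iff₀ (by positivity) (by positivity)]
        nlinarith [sq_nonneg (t - 2 * u)]
      calc _ ≤ ‖ker φ (t - u)‖ + ‖ker φ t‖ := norm_sub_le _ _
        _ ≤ C * (3 * (1 + t ^ 2)⁻¹) + C * (1 + t ^ 2)⁻¹ := by
            gcongr
            · exact (hk _).trans (by gcongr)
            · exact hk _
        _ = _ := by ring
    · exact integrable_inv_one_add_sq.const_mul _
    · refine ae_of_all _ fun t => ?_
      have : Tendsto (fun u => ‖ker φ (t - u) - ker φ t‖) (𝓝 0) (𝓝 ‖ker φ (t - 0) - ker φ t‖) := by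
        apply Continuous.tendsto
        fun_prop
      simpa using this
  simpa using this

end

section

open scoped ContDiff

/-- The bundled non-unital C*-algebra structure. -/
abbrev cstarInst (X : Type*) [NonUnitalNormedRing X] [StarRing X] [CStarRing X]
    [NormedSpace ℂ X] [IsScalarTower ℂ X X] [SMulCommClass ℂ X X] [StarModule ℂ X]
    [CompleteSpace X] : NonUnitalCStarAlgebra X := {}

variable {α : ℝ → X → X} {f g φ ψ : ℝ → ℂ}

/-- The spectral multiplier operators. -/
def tm (α : ℝ → X → X) (φ : ℝ → ℂ) (x : X) : X := smear α (ker φ) x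

namespace IsCStarDynSys

/-- The automorphisms bundled. -/
def aut (hα : IsCStarDynSys α) (t : ℝ) : X →⋆ₙₐ[ℂ] X where
  toFun := α t
  map_smul' := hα.map_smulc t
  map_zero' := by simpa using hα.map_smulc t 0 0
  map_add' := hα.map_add t
  map_mul' := hα.map_mul t
  map_star' := hα.map_star t

lemma neg_apply (hα : IsCStarDynSys α) (t : ℝ) (x : X) : α (-t) (α t x) = x := by
  rw [← hα.map_add_time, neg_add_cancel, hα.map_zero_time]

lemma apply_neg (hα : IsCStarDynSys α) (t : ℝ) (x : X) : α t (α (-t) x) = x := by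
  rw [← hα.map_add_time, add_neg_cancel, hα.map_zero_time]

lemma norm_map (hα : IsCStarDynSys α) (t : ℝ) (x : X) : ‖α t x‖ = ‖x‖ := by
  let _ := cstarInst X
  have hi : Function.Injective (hα.aut t) := fun x y h => by
    rw [← hα.neg_apply t x, ← hα.neg_apply t y]
    exact congrArg (α (-t)) h
  exact NonUnitalStarAlgHom.norm_map (hα.aut t) hi x

/-- The automorphisms as continuous linear maps. -/
def autL (hα : IsCStarDynSys α) (t : ℝ) : X →L[ℂ] X :=
  LinearMap.mkContinuous
    { toFun := α t, map_add' := hα.map_add t, map_smul' := hα.map_smulc t } 1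
    fun x => by simp [hα.norm_map]

lemma autL_apply (hα : IsCStarDynSys α) (t : ℝ) (x : X) : hα.autL t x = α t x := rfl

lemma map_zero (hα : IsCStarDynSys α) (t : ℝ) : α t 0 = 0 := by
  rw [← hα.autL_apply, _root_.map_zero]

lemma integrable (hα : IsCStarDynSys α) (hf : Integrable f) (x : X) :
    Integrable fun t => f t • α t x := by
  refine (hf.norm.mul_const ‖x‖).mono' ?_ ?_
  · exact hf.1.smul (hα.continuous_orbit x).aestronglyMeasurable
  · exact ae_of_all _ fun t => by rw [norm_smul, hα.norm_map]

lemma smear_add (hα : IsCStarDynSys α) (hf : Integrable f) (x y : X) :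
    smear α f (x + y) = smear α f x + smear α f y := by
  simp only [smear, hα.map_add, smul_add]
  exact integral_add (hα.integrable hf x) (hα.integrable hf y)

lemma smear_smul (hα : IsCStarDynSys α) (f : ℝ → ℂ) (c : ℂ) (x : X) :
    smear α f (c • x) = c • smear α f x := by
  simp only [smear, hα.map_smulc, smul_comm _ c]
  exact integral_smul _ _

lemma norm_smear_le (hα : IsCStarDynSys α) (hf : Integrable f) (x : X) :
    ‖smear α f x‖ ≤ (∫ t, ‖f t‖) * ‖x‖ := by
  rw [← integral_mul_const]
  refine norm_integral_le_of_norm_le (hf.norm.mul_const _) (ae_of_all _ fun t => ?_)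
  rw [norm_smul, hα.norm_map]

/-- `smear` as a continuous linear map. -/
def smearL (hα : IsCStarDynSys α) (hf : Integrable f) : X →L[ℂ] X :=
  LinearMap.mkContinuous
    { toFun := smear α f, map_add' := hα.smear_add hf, map_smul' := hα.smear_smul f }
    (∫ t, ‖f t‖) (hα.norm_smear_le hf)

lemma smearL_apply (hα : IsCStarDynSys α) (hf : Integrable f) (x : X) :
    hα.smearL hf x = smear α f x := rfl

/-- `tm` as a continuous linear map. -/
def tmL (hα : IsCStarDynSys α) (hφ : Tst φ) : X →L[ℂ] X := hα.smearL hφ.ker_integrable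

lemma tmL_apply (hα : IsCStarDynSys α) (hφ : Tst φ) (x : X) : hα.tmL hφ x = tm α φ x := rfl

lemma map_smear (hα : IsCStarDynSys α) (hf : Integrable f) (t : ℝ) (x : X) :
    α t (smear α f x) = smear α f (α t x) := by
  rw [← hα.autL_apply, smear, ← ContinuousLinearMap.integral_comp_comm _ (hα.integrable hf x), smear]
  congr 1; ext s
  rw [ContinuousLinearMap.map_smul, hα.autL_apply, ← hα.map_add_time, ← hα.map_add_time, add_comm]

lemma map_smear' (hα : IsCStarDynSys α) (hf : Integrable f) (t : ℝ) (x : X) :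
    α t (smear α f x) = ∫ s, f (s - t) • α s x := by
  rw [hα.map_smear hf, smear, ← integral_sub_right_eq_self _ t]
  congr 1; ext s
  rw [← hα.map_add_time, sub_add_cancel]

lemma smear_comm (hα : IsCStarDynSys α) (hf : Integrable f) (hg : Integrable g) (x : X) :
    smear α f (smear α g x) = smear α g (smear α f x) := by
  conv_lhs => rw [smear]
  rw [← hα.smearL_apply hg (smear α f x), smear.eq_1 α f x,
    ← ContinuousLinearMap.integral_comp_comm _ (hα.integrable hf x)]
  congr 1; ext s
  rw [ContinuousLinearMap.map_smul, hα.smearL_apply, hα.map_smear hg]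

lemma star_smear (f : ℝ → ℂ) (hα : IsCStarDynSys α) (x : X) :
    star (smear α f x) = smear α (fun t => (starRingEnd ℂ) (f t)) (star x) := by
  have := (starL' ℝ : X ≃L[ℝ] X).integral_comp_comm (fun t => f t • α t x) (μ := volume)
  rw [smear, smear]
  refine Eq.trans this.symm ?_
  congr 1; ext s
  simp [hα.map_star]

lemma ker_conj_neg (φ : ℝ → ℂ) (t : ℝ) :
    ker (fun γ => (starRingEnd ℂ) (φ (-γ))) t = (starRingEnd ℂ) (ker φ t) := by
  rw [ker, ker, _root_.map_mul, ← integral_conj, ← integral_neg_eq_self]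
  congr 1
  · simp [Complex.conj_ofNat]
  · congr 1; ext γ
    rw [_root_.map_mul, ← Complex.exp_conj]
    simp

lemma star_tm (hα : IsCStarDynSys α) (φ : ℝ → ℂ) (x : X) :
    star (tm α φ x) = tm α (fun γ => (starRingEnd ℂ) (φ (-γ))) (star x) := by
  rw [tm, hα.star_smear, tm]
  congr 1; ext t; rw [ker_conj_neg]

end IsCStarDynSys

lemma Tst.exp_integrable (hφ : Tst φ) (t : ℝ) :
    Integrable fun γ : ℝ => φ γ * Complex.exp (Complex.I * γ * t) := by
  refine hφ.integrable.norm.mono' ?_ ?_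
  · have := hφ.continuous
    exact Continuous.aestronglyMeasurable (by fun_prop)
  · refine ae_of_all _ fun γ => ?_
    rw [norm_mul, show Complex.I * γ * t = (γ * t : ℝ) * Complex.I by push_cast; ring,
      Complex.norm_exp_ofReal_mul_I, mul_one]

lemma ker_sub (hφ : Tst φ) (hψ : Tst ψ) (t : ℝ) :
    ker (fun γ => φ γ - ψ γ) t = ker φ t - ker ψ t := by
  simp only [ker, sub_mul]
  rw [integral_sub (hφ.exp_integrable t) (hψ.exp_integrable t), mul_sub]

/-- Convolution of an integrable function with a kernel. -/
lemma integral_mul_ker_sub (hg : Integrable g) (hψ : Tst ψ) (t : ℝ) :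
    ∫ s, g s * ker ψ (t - s) = ker (fun γ => fourierT g γ * ψ γ) t := by
  simp only [ker]
  simp_rw [mul_left_comm (g _)]
  rw [integral_const_mul]
  congr 1
  have : Integrable (Function.uncurry fun s γ : ℝ => g s * (ψ γ * Complex.exp (Complex.I * γ * (t - s : ℝ)))) (volume.prod volume) := by
    have h1 := (hg.mul_prod hψ.integrable).norm
    refine h1.mono' ?_ ?_
    · have e : (Function.uncurry fun s γ : ℝ => g s * (ψ γ * Complex.exp (Complex.I * γ * (t - s : ℝ)))) =
        fun p : ℝ × ℝ => (g p.1 * ψ p.2) * Complex.exp (Complex.I * p.2 * (t - p.1 : ℝ)) := by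
        ext p; simp [Function.uncurry, mul_assoc]
      rw [e]
      exact (hg.mul_prod hψ.integrable).1.mul (Continuous.aestronglyMeasurable (by fun_prop))
    · refine ae_of_all _ fun p => ?_
      simp only [Function.uncurry, norm_mul]
      rw [show Complex.I * p.2 * (t - p.1 : ℝ) = (p.2 * (t - p.1) : ℝ) * Complex.I by push_cast; ring,
        Complex.norm_exp_ofReal_mul_I, mul_one]
  have e1 : ∀ s, g s * ∫ γ, ψ γ * Complex.exp (Complex.I * γ * (t - s : ℝ)) =
     ∫ γ, g s * (ψ γ * Complex.exp (Complex.I * γ * (t - s : ℝ))) := fun s => by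
    rw [integral_const_mul]
  simp_rw [e1]
  rw [integral_integral_swap this]
  congr 1; ext γ
  rw [fourierT, ← integral_mul_const, ← integral_mul_const]
  congr 1; ext s
  push_cast
  rw [show Complex.I * γ * (t - s) = -(Complex.I * γ * s) + Complex.I * γ * t by ring, Complex.exp_add]
  ring

namespace IsCStarDynSys

lemma smear_smear (hα : IsCStarDynSys α) (hf : Integrable f) (hg : Integrable g) (x : X) :
    smear α f (smear α g x) = smear α (fun t => ∫ s, f s * g (t - s)) x := by
  rw [smear]
  simp_rw [hα.map_smear' hg, ← integral_smul]
  have hm : Integrable (fun p : ℝ × ℝ => f p.2 * g (p.1 - p.2)) (volume.prod volume) := by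
    have := hf.convolution_integrand (ContinuousLinearMap.mul ℂ ℂ) hg
    simpa using this
  have : Integrable (Function.uncurry fun s t : ℝ => f s • g (t - s) • α t x) (volume.prod volume) := by
    have h2 := (hm.swap).norm.mul_const ‖x‖
    refine h2.mono' ?_ ?_
    · have h3 : AEStronglyMeasurable (fun p : ℝ × ℝ => α p.2 x) (volume.prod volume) :=
        ((hα.continuous_orbit x).comp continuous_snd).aestronglyMeasurable
      have := hm.swap.1.smul h3
      refine this.congr (ae_of_all _ fun p => ?_)
      simp [Function.uncurry, smul_smul]
    · refine ae_of_all _ fun p => ?_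
      simp [Function.uncurry, norm_smul, hα.norm_map, mul_assoc]
  rw [integral_integral_swap this, smear]
  congr 1; ext t
  rw [← integral_smul_const]
  simp_rw [smul_smul]

lemma smear_tm (hα : IsCStarDynSys α) (hg : Integrable g) (hψ : Tst ψ) (x : X) :
    smear α g (tm α ψ x) = tm α (fun γ => fourierT g γ * ψ γ) x := by
  rw [tm, hα.smear_smear hg hψ.ker_integrable, tm]
  congr 1; ext t
  exact integral_mul_ker_sub hg hψ t

lemma tm_tm (hα : IsCStarDynSys α) (hφ : Tst φ) (hψ : Tst ψ) (x : X) :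
    tm α φ (tm α ψ x) = tm α (fun γ => φ γ * ψ γ) x := by
  conv_lhs => rw [tm]
  rw [hα.smear_tm hφ.ker_integrable hψ]
  simp only [hφ.fourierT_ker]

lemma tm_sub (hα : IsCStarDynSys α) (hφ : Tst φ) (hψ : Tst ψ) (x : X) :
    tm α (fun γ => φ γ - ψ γ) x = tm α φ x - tm α ψ x := by
  rw [tm, tm, tm, smear, smear, smear, ← integral_sub (hα.integrable hφ.ker_integrable x) (hα.integrable hψ.ker_integrable x)]
  congr 1; ext t; rw [ker_sub hφ hψ, sub_smul]

lemma tm_zero (x : X) : tm α (fun _ => 0) x = 0 := by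
  simp [tm, smear, ker]

/-- Bernstein-type estimate for narrow spectral bands. -/
lemma bernstein (hα : IsCStarDynSys α) (hφ : Tst φ) {δ : ℝ} (hδ : 0 < δ) (γ₀ s : ℝ) (x : X) :
    ‖Complex.exp (-(Complex.I * γ₀ * s)) • tm α (fun γ => φ (δ⁻¹ * γ + -(δ⁻¹ * γ₀))) x -
      α s (tm α (fun γ => φ (δ⁻¹ * γ + -(δ⁻¹ * γ₀))) x)‖ ≤ kmod φ (δ * s) * ‖x‖ := by
  have hV : Tst (fun γ => φ (δ⁻¹ * γ + -(δ⁻¹ * γ₀))) := hφ.comp_affine (inv_ne_zero hδ.ne') _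
  rw [tm, hα.map_smear' hV.ker_integrable, smear, ← integral_smul, ← integral_sub]
  rotate_left
  · exact (hα.integrable hV.ker_integrable x).smul _
  · exact hα.integrable (hV.ker_integrable.comp_sub_right s) x
  have e : kmod φ (δ * s) = ∫ t, δ * ‖ker φ (δ * t - δ * s) - ker φ (δ * t)‖ := by
    rw [integral_const_mul, Measure.integral_comp_mul_left (fun t => ‖ker φ (t - δ * s) - ker φ t‖) δ,
      abs_of_pos (by positivity), smul_eq_mul, mul_inv_cancel_left₀ hδ.ne', kmod]
  rw [e, ← integral_mul_const]
  refine norm_integral_le_of_norm_le ?_ (ae_of_all _ fun t => ?_)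
  · have h1 : Integrable fun t => ker φ (t - δ * s) - ker φ t :=
      (hφ.ker_integrable.comp_sub_right _).sub hφ.ker_integrable
    exact ((h1.comp_mul_left' hδ.ne').norm.const_mul δ).mul_const _
  · rw [smul_smul, ← sub_smul, norm_smul, hα.norm_map, ker_mul_exp_dilate φ hδ, ker_mul_exp_dilate φ hδ]
    gcongr
    apply le_of_eq
    have h2 : Complex.exp (-(Complex.I * γ₀ * s)) * (δ * Complex.exp (Complex.I * γ₀ * t) * ker φ (δ * t)) -
        δ * Complex.exp (Complex.I * γ₀ * (t - s : ℝ)) * ker φ (δ * (t - s)) =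
        (δ : ℂ) * Complex.exp ((γ₀ * (t - s) : ℝ) * Complex.I) * (ker φ (δ * t) - ker φ (δ * t - δ * s)) := by
      rw [mul_sub δ t s]
      push_cast
      rw [show Complex.I * γ₀ * (t - s) = -(Complex.I * γ₀ * s) + Complex.I * γ₀ * t by ring,
        show ((γ₀ * (t - s)) * Complex.I : ℂ) = -(Complex.I * γ₀ * s) + Complex.I * γ₀ * t by ring,
        Complex.exp_add]
      ring
    rw [h2, norm_mul, norm_mul, Complex.norm_exp_ofReal_mul_I, mul_one, norm_sub_rev]
    simp [abs_of_pos hδ]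

/-- Approximate identity. -/
lemma tendsto_tm (hα : IsCStarDynSys α) (hφ : Tst φ) (h0 : φ 0 = 1) (x : X) :
    Tendsto (fun n : ℕ => tm α (fun γ => φ ((n + 1 : ℝ)⁻¹ * γ)) x) atTop (𝓝 x) := by
  have e : ∀ n : ℕ, tm α (fun γ => φ ((n + 1 : ℝ)⁻¹ * γ)) x = ∫ t, ker φ t • α ((n + 1 : ℝ)⁻¹ * t) x := by
    intro n
    have hn : (0 : ℝ) < n + 1 := by positivity
    have h1 := fun t => ker_mul_exp_dilate φ hn 0 t
    simp only [mul_zero, neg_zero, add_zero, Complex.ofReal_zero, zero_mul, Complex.exp_zero, mul_one] at h1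
    rw [tm, smear]
    have h2 := Measure.integral_comp_mul_left (fun t => ker φ t • α ((n + 1 : ℝ)⁻¹ * t) x) (n + 1 : ℝ)
    rw [abs_of_pos (by positivity), eq_comm, inv_smul_eq_iff₀ hn.ne'] at h2
    rw [h2, ← integral_smul]
    congr 1; ext t
    rw [h1, inv_mul_cancel_left₀ hn.ne', ← smul_smul]
    exact (Complex.coe_smul _ _)
  simp_rw [e]
  have hlim : ∫ t, ker φ t • x = x := by
    rw [integral_smul_const]
    have := hφ.fourierT_ker 0
    simp only [fourierT, Complex.ofReal_zero, mul_zero, zero_mul, neg_zero, Complex.exp_zero, mul_one] at this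
    rw [this, h0, one_smul]
  conv => rw [← hlim]
  have hx : ∀ t, Tendsto (fun n : ℕ => ker φ t • α ((n + 1 : ℝ)⁻¹ * t) x) atTop (𝓝 (ker φ t • x)) := by
    intro t
    refine Tendsto.const_smul ?_ _
    have h3 : Tendsto (fun n : ℕ => (n + 1 : ℝ)⁻¹ * t) atTop (𝓝 0) := by
      have := (tendsto_one_div_add_atTop_nhds_zero_nat (𝕜 := ℝ)).mul_const t
      simpa using this
    have := ((hα.continuous_orbit x).tendsto 0).comp h3
    rwa [hα.map_zero_time] at this
  rw [hlim]
  have := tendsto_integral_of_dominated_convergence (F := fun (n : ℕ) t => ker φ t • α ((n + 1 : ℝ)⁻¹ * t) x) (f := fun t => ker φ t • x) (fun t => ‖ker φ t‖ * ‖x‖) ?_ (hφ.ker_integrable.norm.mul_const _) ?_ (ae_of_all _ hx)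
  · rwa [hlim] at this
  · intro n
    refine hφ.ker_integrable.1.smul (Continuous.aestronglyMeasurable ?_)
    exact (hα.continuous_orbit x).comp (by fun_prop)
  · intro n
    exact ae_of_all _ fun t => by rw [norm_smul, hα.norm_map]

end IsCStarDynSys

end

section

variable {α : ℝ → X → X} {f g φ ψ χ : ℝ → ℂ} {F G : Set ℝ} {x y : X}

namespace IsCStarDynSys

lemma exists_tst_of_notMem_elemSpec (hα : IsCStarDynSys α) {γ₀ : ℝ} (h : γ₀ ∉ elemSpec α x) :
    ∃ φ : ℝ → ℂ, Tst φ ∧ (∃ r > 0, ∀ γ ∈ Metric.ball γ₀ r, φ γ = 1) ∧ tm α φ x = 0 := by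
  simp only [elemSpec, mem_ofPred_eq, not_forall] at h
  obtain ⟨f, hf, hfx, hne⟩ := h
  obtain ⟨v, hv, hv1, hvs⟩ := exists_plateau (a' := -2) (a := -1) (b := 1) (b' := 2)
    (by norm_num) (by norm_num) (by norm_num)
  set c := fourierT f γ₀ with hc
  have hlim : Tendsto (fun n : ℕ => ∫ s, ‖f s‖ * kmod v ((n + 1 : ℝ)⁻¹ * s)) atTop (𝓝 0) := by
    have : Tendsto (fun n : ℕ => ∫ s, ‖f s‖ * kmod v ((n + 1 : ℝ)⁻¹ * s)) atTop
        (𝓝 (∫ s : ℝ, (0 : ℝ))) := by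
      refine tendsto_integral_of_dominated_convergence
        (fun s => ‖f s‖ * (2 * ∫ t, ‖ker v t‖)) ?_ (hf.norm.mul_const _) ?_ ?_
      · intro n
        exact hf.norm.1.mul (hv.kmod_measurable.comp_measurable (by fun_prop)).aestronglyMeasurable
      · intro n
        refine ae_of_all _ fun s => ?_
        rw [norm_mul, norm_norm, Real.norm_of_nonneg (kmod_nonneg _ _)]
        gcongr
        exact hv.kmod_le _
      · refine ae_of_all _ fun s => ?_
        have h3 : Tendsto (fun n : ℕ => (n + 1 : ℝ)⁻¹ * s) atTop (𝓝 0) := by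
          have := (tendsto_one_div_add_atTop_nhds_zero_nat (𝕜 := ℝ)).mul_const s
          simpa using this
        simpa using (hv.kmod_tendsto.comp h3).const_mul ‖f s‖
    simpa using this
  obtain ⟨n, hn⟩ := (hlim.eventually (gt_mem_nhds (norm_pos_iff.2 hne))).exists
  set δ : ℝ := (n + 1 : ℝ)⁻¹ with hδ
  have hδ0 : 0 < δ := by positivity
  set V : ℝ → ℂ := fun γ => v (δ⁻¹ * γ + -(δ⁻¹ * γ₀)) with hV
  have hVt : Tst V := hv.comp_affine (inv_ne_zero hδ0.ne') _
  obtain ⟨φ, hφ, hφ1, hφs⟩ := exists_plateau (a' := γ₀ - δ) (a := γ₀ - δ / 2) (b := γ₀ + δ / 2)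
    (b' := γ₀ + δ) (by linarith) (by linarith) (by linarith)
  refine ⟨φ, hφ, ⟨δ / 2, by positivity, fun γ hγ => hφ1 γ ?_⟩, ?_⟩
  · rw [Real.ball_eq_Ioo] at hγ; exact ⟨hγ.1.le, hγ.2.le⟩
  set y := tm α φ x with hy
  have hVy : tm α V y = y := by
    rw [hy, hα.tm_tm hVt hφ]
    congr 1; ext γ
    by_cases hγ : φ γ = 0
    · simp [hγ]
    · have hm := hφs (subset_tsupport φ hγ)
      have : V γ = 1 := by
        apply hv1
        have e : δ⁻¹ * γ + -(δ⁻¹ * γ₀) = (γ - γ₀) / δ := by field_simp; ring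
        rw [e]
        constructor
        · rw [le_div_iff₀ hδ0]; linarith [hm.1]
        · rw [div_le_iff₀ hδ0]; linarith [hm.2]
      rw [this, one_mul]
  have hfy : smear α f y = 0 := by
    rw [hy, tm, hα.smear_comm hf hφ.ker_integrable, hfx]
    simpa using hα.smear_smul (ker φ) 0 0
  have hexp : Integrable fun s : ℝ => f s * Complex.exp (-(Complex.I * γ₀ * s)) := by
    refine hf.norm.mono' (hf.1.mul (Continuous.aestronglyMeasurable (by fun_prop))) ?_
    refine ae_of_all _ fun s => ?_
    rw [norm_mul, show -(Complex.I * γ₀ * s) = (-(γ₀ * s) : ℝ) * Complex.I by push_cast; ring,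
      Complex.norm_exp_ofReal_mul_I, mul_one]
  have hcy : c • y = ∫ s, f s • (Complex.exp (-(Complex.I * γ₀ * s)) • y - α s y) := by
    simp_rw [smul_sub, smul_smul]
    rw [integral_sub (hexp.smul_const y) (hα.integrable hf y), integral_smul_const]
    change _ = _ - smear α f y
    rw [hfy, sub_zero]; rfl
  have hbd : ‖c • y‖ ≤ (∫ s, ‖f s‖ * kmod v (δ * s)) * ‖y‖ := by
    rw [hcy, ← integral_mul_const]
    refine norm_integral_le_of_norm_le (Integrable.mul_const ?_ _) (ae_of_all _ fun s => ?_)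
    · refine (hf.norm.mul_const (2 * ∫ t, ‖ker v t‖)).mono'
        (hf.norm.1.mul (hv.kmod_measurable.comp_measurable (by fun_prop)).aestronglyMeasurable) ?_
      refine ae_of_all _ fun s => ?_
      rw [norm_mul, norm_norm, Real.norm_of_nonneg (kmod_nonneg _ _)]
      gcongr
      exact hv.kmod_le _
    · rw [norm_smul, mul_assoc ‖f s‖]
      refine mul_le_mul_of_nonneg_left ?_ (norm_nonneg (f s))
      have := hα.bernstein hv hδ0 γ₀ s y
      change ‖_ • tm α V y - α s (tm α V y)‖ ≤ _ at this
      rwa [hVy] at this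
  rw [norm_smul] at hbd
  by_contra hyne
  have : 0 < ‖y‖ := norm_pos_iff.2 hyne
  nlinarith

lemma tm_eq_zero_of_prod (hα : IsCStarDynSys α) {ι : Type*} (t : Finset ι) (V : ι → ℝ → ℂ)
    (hV : ∀ i, Tst (V i)) (hVx : ∀ i, tm α (V i) x = 0) :
    ∀ ψ : ℝ → ℂ, Tst ψ → (∀ γ, ψ γ * ∏ i ∈ t, (1 - V i γ) = 0) → tm α ψ x = 0 := by
  classical
  induction t using Finset.induction_on with
  | empty =>
    intro ψ _ h
    have : ψ = fun _ => 0 := by ext γ; simpa using h γ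
    rw [this, tm_zero]
  | insert a t ha ih =>
    intro ψ hψ h
    have h1 := ih (fun γ => ψ γ - ψ γ * V a γ) (hψ.sub (hψ.mul (hV a))) (fun γ => by
      rw [← h γ, Finset.prod_insert ha]; ring)
    rw [hα.tm_sub hψ (hψ.mul (hV a)), ← hα.tm_tm hψ (hV a), hVx, ← hα.tmL_apply hψ 0] at h1
    simpa using h1

lemma mem_specC_iff (hα : IsCStarDynSys α) (hF : IsClosed F) :
    x ∈ specC α F ↔ ∀ φ, Tst φ → Disjoint (tsupport φ) F → tm α φ x = 0 := by
  constructor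
  · intro hx φ hφ hd
    have h1 : ∀ γ : tsupport φ, ∃ V : ℝ → ℂ, Tst V ∧
        (∃ r > 0, ∀ γ' ∈ Metric.ball (γ : ℝ) r, V γ' = 1) ∧ tm α V x = 0 := fun γ =>
      hα.exists_tst_of_notMem_elemSpec fun h => disjoint_left.1 hd γ.2 (hx h)
    choose V hV hr hVx using h1
    choose r hr0 hr1 using hr
    obtain ⟨t, ht⟩ := hφ.cpt.isCompact.elim_finite_subcover (fun i : tsupport φ => Metric.ball (i : ℝ) (r i))
      (fun i => Metric.isOpen_ball)
      (fun γ hγ => mem_iUnion.2 ⟨⟨γ, hγ⟩, Metric.mem_ball_self (hr0 _)⟩)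
    refine hα.tm_eq_zero_of_prod t V hV hVx φ hφ fun γ => ?_
    by_cases hγ : φ γ = 0
    · simp [hγ]
    · have := ht (subset_tsupport φ hγ)
      simp only [mem_iUnion] at this
      obtain ⟨i, hi, hγi⟩ := this
      rw [Finset.prod_eq_zero hi (by rw [hr1 i γ hγi, sub_self]), mul_zero]
  · intro h γ hγ
    by_contra hγF
    obtain ⟨ε, hε, hb⟩ := Metric.isOpen_iff.1 hF.isOpen_compl γ hγF
    obtain ⟨φ, hφ, hφ1, hφs⟩ := exists_plateau (a' := γ - ε / 2) (a := γ) (b := γ) (b' := γ + ε / 2)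
      (by linarith) le_rfl (by linarith)
    have h2 := hγ (ker φ) hφ.ker_integrable (h φ hφ (disjoint_left.2 fun z hz hzF => by
      have := hφs hz
      refine hb ?_ hzF
      rw [Real.ball_eq_Ioo]
      exact ⟨by linarith [this.1], by linarith [this.2]⟩))
    rw [hφ.fourierT_ker, hφ1 γ ⟨le_rfl, le_rfl⟩] at h2
    exact one_ne_zero h2

/-- Spectral subspaces described by smooth multipliers. -/
def spec (hα : IsCStarDynSys α) (F : Set ℝ) : Submodule ℂ X where
  carrier := {x | ∀ φ, Tst φ → Disjoint (tsupport φ) F → tm α φ x = 0}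
  zero_mem' := fun φ hφ _ => by rw [← hα.tmL_apply hφ, _root_.map_zero]
  add_mem' := fun {x y} hx hy φ hφ hd => by
    rw [← hα.tmL_apply hφ, _root_.map_add, hα.tmL_apply, hα.tmL_apply, hx φ hφ hd, hy φ hφ hd, add_zero]
  smul_mem' := fun c x hx φ hφ hd => by
    rw [← hα.tmL_apply hφ, _root_.map_smul, hα.tmL_apply, hx φ hφ hd, smul_zero]

lemma specC_eq (hα : IsCStarDynSys α) (hF : IsClosed F) : specC α F = hα.spec F :=
  Set.ext fun _ => hα.mem_specC_iff hF

lemma isClosed_spec (hα : IsCStarDynSys α) (F : Set ℝ) : IsClosed (hα.spec F : Set X) := by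
  have : (hα.spec F : Set X) = ⋂ (φ) (hφ : Tst φ) (_ : Disjoint (tsupport φ) F), {x | hα.tmL hφ x = 0} := by
    ext x; simp only [mem_iInter]; rfl
  rw [this]
  refine isClosed_iInter fun φ => isClosed_iInter fun hφ => isClosed_iInter fun _ => ?_
  exact isClosed_eq (hα.tmL hφ).continuous continuous_const

lemma spec_mono (hα : IsCStarDynSys α) (h : F ⊆ G) : hα.spec F ≤ hα.spec G :=
  fun _ hx φ hφ hd => hx φ hφ (hd.mono_right h)

lemma smear_mem_spec_of_mem (hα : IsCStarDynSys α) (hf : Integrable f) (hx : x ∈ hα.spec F) :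
    smear α f x ∈ hα.spec F := fun φ hφ hd => by
  rw [tm, hα.smear_comm hφ.ker_integrable hf, ← tm, hx φ hφ hd, ← hα.smearL_apply hf,
    _root_.map_zero]

lemma tm_mem_spec_of_mem (hα : IsCStarDynSys α) (hφ : Tst φ) (hx : x ∈ hα.spec F) :
    tm α φ x ∈ hα.spec F := hα.smear_mem_spec_of_mem hφ.ker_integrable hx

lemma map_mem_spec (hα : IsCStarDynSys α) (t : ℝ) (hx : x ∈ hα.spec F) : α t x ∈ hα.spec F :=
  fun φ hφ hd => by
    rw [tm, ← hα.map_smear hφ.ker_integrable, ← tm, hx φ hφ hd, hα.map_zero]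

lemma tm_mem_spec (hα : IsCStarDynSys α) (hφ : Tst φ) (h : tsupport φ ⊆ F) (x : X) :
    tm α φ x ∈ hα.spec F := fun ψ hψ hd => by
  rw [hα.tm_tm hψ hφ]
  have : (fun γ => ψ γ * φ γ) = fun _ => 0 := by
    ext γ
    by_contra hne
    have h1 := subset_tsupport ψ (left_ne_zero_of_mul hne)
    have h2 := subset_tsupport φ (right_ne_zero_of_mul hne)
    exact disjoint_left.1 hd h1 (h h2)
  rw [this, tm_zero]

lemma star_mem_spec (hα : IsCStarDynSys α) (hx : x ∈ hα.spec F) : star x ∈ hα.spec (-F) :=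
  fun φ hφ hd => by
    rw [← star_eq_zero, hα.star_tm, star_star]
    refine hx _ hφ.conj_neg (disjoint_left.2 fun γ hγ hF => ?_)
    refine (disjoint_left.1 hd : ∀ ⦃a⦄, a ∈ tsupport φ → a ∉ -F) (?_ : -γ ∈ tsupport φ) (by simpa using hF)
    have h1 : tsupport (fun γ => (starRingEnd ℂ) (φ (-γ))) ⊆ (fun γ => -γ) ⁻¹' tsupport φ := by
      refine closure_minimal (fun z hz => subset_tsupport φ ?_) ((isClosed_tsupport φ).preimage continuous_neg)
      intro h0; exact hz (by simp [h0])
    exact h1 hγ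

/-- An approximate identity of spectral multipliers. -/
lemma exists_approx (x : X) (hα : IsCStarDynSys α) : ∃ (φ : ℕ → ℝ → ℂ), (∀ n, Tst (φ n)) ∧
    Tendsto (fun n => tm α (φ n) x) atTop (𝓝 x) := by
  obtain ⟨φ, hφ, hφ1, -⟩ := exists_plateau (a' := -1) (a := 0) (b := 0) (b' := 1)
    (by norm_num) le_rfl (by norm_num)
  refine ⟨fun n γ => φ ((n + 1 : ℝ)⁻¹ * γ), fun n => ?_, hα.tendsto_tm hφ (hφ1 0 ⟨le_rfl, le_rfl⟩) x⟩
  have := hφ.comp_affine (a := (n + 1 : ℝ)⁻¹) (by positivity) 0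
  simpa using this

lemma eq_zero_of_tm (hα : IsCStarDynSys α) (h : ∀ φ, Tst φ → tm α φ x = 0) : x = 0 := by
  obtain ⟨φ, hφ, hlim⟩ := exists_approx x hα
  have : (fun n => tm α (φ n) x) = fun _ => 0 := funext fun n => h _ (hφ n)
  rw [this] at hlim
  exact tendsto_nhds_unique hlim tendsto_const_nhds

lemma spec_empty (hα : IsCStarDynSys α) (hx : x ∈ hα.spec ∅) : x = 0 :=
  hα.eq_zero_of_tm fun φ hφ => hx φ hφ (disjoint_bot_right)

lemma mem_spec_inter (hα : IsCStarDynSys α) (hF : IsClosed F) (hG : IsClosed G)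
    (h1 : x ∈ hα.spec F) (h2 : x ∈ hα.spec G) : x ∈ hα.spec (F ∩ G) := by
  rw [← SetLike.mem_coe, ← hα.specC_eq hF] at h1
  rw [← SetLike.mem_coe, ← hα.specC_eq hG] at h2
  rw [← SetLike.mem_coe, ← hα.specC_eq (hF.inter hG)]
  exact subset_inter h1 h2

lemma eq_zero_of_disjoint (hα : IsCStarDynSys α) (hF : IsClosed F) (hG : IsClosed G)
    (hd : Disjoint F G) (h1 : x ∈ hα.spec F) (h2 : x ∈ hα.spec G) : x = 0 := by
  have := hα.mem_spec_inter hF hG h1 h2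
  rw [hd.inter_eq] at this
  exact hα.spec_empty this

lemma sub_tm_mem_spec (hα : IsCStarDynSys α) {U : Set ℝ} (hU : IsOpen U) (hφ : Tst φ)
    (h1 : ∀ γ ∈ U, φ γ = 1) (hx : x ∈ hα.spec F) : x - tm α φ x ∈ hα.spec (F \ U) := by
  intro ψ hψ hd
  rw [← hα.tmL_apply hψ, _root_.map_sub, hα.tmL_apply, hα.tmL_apply, hα.tm_tm hψ hφ,
    ← hα.tm_sub hψ (hψ.mul hφ)]
  refine hx _ (hψ.sub (hψ.mul hφ)) (disjoint_left.2 fun γ hγ hF => ?_)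
  by_cases hγU : γ ∈ U
  · have : tsupport (fun γ => ψ γ - ψ γ * φ γ) ⊆ Uᶜ :=
      closure_minimal (fun z hz hzU => hz (by simp [h1 z hzU])) hU.isClosed_compl
    exact this hγ hγU
  · refine disjoint_left.1 hd (?_ : γ ∈ tsupport ψ) ⟨hF, hγU⟩
    have hs : Function.support (fun γ => ψ γ - ψ γ * φ γ) ⊆ Function.support ψ :=
      fun z hz h0 => hz (by simp [h0])
    exact closure_mono hs hγ

lemma tm_eq_self (hα : IsCStarDynSys α) {U : Set ℝ} (hU : IsOpen U) (hφ : Tst φ)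
    (h1 : ∀ γ ∈ U, φ γ = 1) (hF : F ⊆ U) (hx : x ∈ hα.spec F) : tm α φ x = x := by
  have := hα.sub_tm_mem_spec hU hφ h1 hx
  rw [sdiff_eq_empty.2 hF] at this
  exact (sub_eq_zero.1 (hα.spec_empty this)).symm

lemma mem_spec_singleton_iff (hα : IsCStarDynSys α) {γ₀ : ℝ} :
    x ∈ hα.spec {γ₀} ↔ ∀ t : ℝ, α t x = Complex.exp (-(Complex.I * γ₀ * t)) • x := by
  constructor
  · intro hx s
    obtain ⟨v, hv, hv1, -⟩ := exists_plateau (a' := -2) (a := -1) (b := 1) (b' := 2)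
      (by norm_num) (by norm_num) (by norm_num)
    have key : ∀ n : ℕ, ‖Complex.exp (-(Complex.I * γ₀ * s)) • x - α s x‖ ≤
        kmod v ((n + 1 : ℝ)⁻¹ * s) * ‖x‖ := by
      intro n
      have hδ : (0 : ℝ) < (n + 1 : ℝ)⁻¹ := by positivity
      have := hα.bernstein hv hδ γ₀ s x
      rwa [hα.tm_eq_self (F := {γ₀}) (Metric.isOpen_ball (x := γ₀) (ε := (n + 1 : ℝ)⁻¹))
        (hv.comp_affine (inv_ne_zero hδ.ne') _) ?_ (by simpa using hδ) hx] at this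
      intro γ hγ
      apply hv1
      rw [Real.ball_eq_Ioo] at hγ
      rw [inv_inv] at *
      have h3 : (n + 1 : ℝ) * (n + 1 : ℝ)⁻¹ = 1 := mul_inv_cancel₀ (by positivity)
      have h4 : (0 : ℝ) < n + 1 := by positivity
      constructor
      · nlinarith [hγ.1]
      · nlinarith [hγ.2]
    have h3 : Tendsto (fun n : ℕ => (n + 1 : ℝ)⁻¹ * s) atTop (𝓝 0) := by
      have := (tendsto_one_div_add_atTop_nhds_zero_nat (𝕜 := ℝ)).mul_const s
      simpa using this
    have h4 := (hv.kmod_tendsto.comp h3).mul_const ‖x‖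
    rw [zero_mul] at h4
    have h5 := ge_of_tendsto' h4 key
    exact (sub_eq_zero.1 (norm_le_zero_iff.1 h5)).symm
  · intro h φ hφ hd
    have e : tm α φ x = fourierT (ker φ) γ₀ • x := by
      rw [tm, smear, fourierT, ← integral_smul_const]
      congr 1; ext t
      rw [h, smul_smul]
    rw [e, hφ.fourierT_ker]
    have : φ γ₀ = 0 := by
      by_contra hne
      exact disjoint_left.1 hd (subset_tsupport φ hne) rfl
    rw [this, zero_smul]

lemma mem_spec_zero_iff (hα : IsCStarDynSys α) : x ∈ hα.spec {0} ↔ ∀ t : ℝ, α t x = x := by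
  rw [hα.mem_spec_singleton_iff]; simp

/-! ### Products -/

lemma tm_mul_eq_zero (hα : IsCStarDynSys α) (hφ : Tst φ) (hψ : Tst ψ) (hχ : Tst χ)
    (h : ∀ a b, φ (a + b) * ψ a * χ b = 0) (x y : X) :
    tm α φ (tm α ψ x * tm α χ y) = 0 := by
  set w := tm α χ y with hw
  have e1 : tm α φ (tm α ψ x * w) =
      ∫ t, ∫ s, (ker φ t * ker ψ (s - t)) • (α s x * α t w) := by
    rw [tm, smear]
    congr 1; ext t
    rw [hα.map_mul, tm, hα.map_smear' hψ.ker_integrable, ← integral_mul_const_of_integrable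
      (hα.integrable (hψ.ker_integrable.comp_sub_right t) x), ← integral_smul]
    congr 1; ext s
    rw [smul_mul_assoc, smul_smul]
  rw [e1]
  have hm : Integrable (fun p : ℝ × ℝ => ker φ p.2 * ker ψ (p.1 - p.2)) (volume.prod volume) := by
    have := hφ.ker_integrable.convolution_integrand (ContinuousLinearMap.mul ℂ ℂ) hψ.ker_integrable
    simpa using this
  have h_swap : Integrable (Function.uncurry fun t s : ℝ => (ker φ t * ker ψ (s - t)) • (α s x * α t w))
      (volume.prod volume) := by
    refine (hm.swap.norm.mul_const (‖x‖ * ‖w‖)).mono' ?_ ?_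
    · refine hm.swap.1.smul (Continuous.aestronglyMeasurable ?_)
      exact ((hα.continuous_orbit x).comp continuous_snd).mul
        ((hα.continuous_orbit w).comp continuous_fst)
    · refine ae_of_all _ fun p => ?_
      simp only [Function.uncurry, norm_smul, Function.comp, Prod.swap]
      gcongr
      exact (norm_mul_le _ _).trans (by rw [hα.norm_map, hα.norm_map])
  rw [integral_integral_swap h_swap]
  refine integral_eq_zero_of_ae (ae_of_all _ fun s => ?_)
  have hi : Integrable fun t => ker φ t * ker ψ (s - t) := by
    obtain ⟨C, hC, hk⟩ := hψ.ker_decay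
    have h2 := hψ.ker_continuous
    refine (hφ.ker_integrable.norm.mul_const C).mono'
      (hφ.ker_integrable.1.mul (Continuous.aestronglyMeasurable (by fun_prop))) (ae_of_all _ fun t => ?_)
    rw [norm_mul]
    gcongr
    refine (hk _).trans (mul_le_of_le_one_right hC (inv_le_one_of_one_le₀ (by nlinarith [sq_nonneg (s - t)])))
  have e2 : (∫ t, (ker φ t * ker ψ (s - t)) • (α s x * α t w)) =
      α s x * smear α (fun t => ker φ t * ker ψ (s - t)) w := by
    rw [smear, ← integral_const_mul_of_integrable (hα.integrable hi w)]
    congr 1; ext t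
    rw [mul_smul_comm]
  change (∫ t, (ker φ t * ker ψ (s - t)) • (α s x * α t w)) = 0
  rw [e2, hw, hα.smear_tm hi hχ]
  have e3 : (fun γ => fourierT (fun t => ker φ t * ker ψ (s - t)) γ * χ γ) = fun _ => 0 := by
    ext b
    have hg : Integrable fun t : ℝ => ker φ t * Complex.exp (-(Complex.I * b * t)) := by
      refine hφ.ker_integrable.norm.mono' (hφ.ker_integrable.1.mul (Continuous.aestronglyMeasurable (by fun_prop))) ?_
      refine ae_of_all _ fun s => ?_
      rw [norm_mul, show -(Complex.I * b * s) = (-(b * s) : ℝ) * Complex.I by push_cast; ring,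
        Complex.norm_exp_ofReal_mul_I, mul_one]
    have h4 := integral_mul_ker_sub hg hψ s
    have h5 : fourierT (fun t => ker φ t * ker ψ (s - t)) b =
        ker (fun γ => fourierT (fun t : ℝ => ker φ t * Complex.exp (-(Complex.I * b * t))) γ * ψ γ) s := by
      rw [← h4, fourierT]
      congr 1; ext t; ring
    have h6 : ∀ a, fourierT (fun t : ℝ => ker φ t * Complex.exp (-(Complex.I * b * t))) a = φ (a + b) := by
      intro a
      rw [← hφ.fourierT_ker, fourierT, fourierT]
      congr 1; ext t
      rw [mul_assoc, ← Complex.exp_add]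
      congr 2; push_cast; ring
    rw [h5, ker, mul_assoc, ← integral_mul_const]
    simp_rw [h6]
    have : ∀ a : ℝ, φ (a + b) * ψ a * Complex.exp (Complex.I * a * s) * χ b = 0 := fun a => by
      rw [mul_right_comm, h a b, zero_mul]
    simp [this]
  rw [e3, tm_zero, mul_zero]

end IsCStarDynSys

end

section

variable {α : ℝ → X → X} {f g φ ψ χ : ℝ → ℂ} {F G : Set ℝ} {x y : X}
  {S T R S' T' V : Submodule ℂ X}

namespace IsCStarDynSys

lemma mem_spec_Icc_of_forall (hα : IsCStarDynSys α) {a b : ℝ}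
    (h : ∀ ε > 0, x ∈ hα.spec (Icc (a - ε) (b + ε))) : x ∈ hα.spec (Icc a b) := by
  simp only [← SetLike.mem_coe, ← hα.specC_eq isClosed_Icc] at h ⊢
  intro γ hγ
  constructor
  · exact le_of_forall_pos_le_add fun ε hε => by linarith [(h ε hε hγ).1]
  · exact le_of_forall_pos_le_add fun ε hε => (h ε hε hγ).2

lemma mul_mem_spec_Icc (hα : IsCStarDynSys α) {a b c d : ℝ} (hx : x ∈ hα.spec (Icc a b))
    (hy : y ∈ hα.spec (Icc c d)) : x * y ∈ hα.spec (Icc (a + c) (b + d)) := by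
  rcases lt_or_ge b a with hab | hab
  · rw [Icc_eq_empty (not_le.2 hab)] at hx
    rw [hα.spec_empty hx, zero_mul]; exact zero_mem _
  rcases lt_or_ge d c with hcd | hcd
  · rw [Icc_eq_empty (not_le.2 hcd)] at hy
    rw [hα.spec_empty hy, mul_zero]; exact zero_mem _
  refine hα.mem_spec_Icc_of_forall fun ε hε => ?_
  obtain ⟨ψ, hψ, hψ1, hψs⟩ := exists_plateau (a' := a - ε / 2) (a := a - ε / 4) (b := b + ε / 4)
    (b' := b + ε / 2) (by linarith) (by linarith) (by linarith)
  obtain ⟨χ, hχ, hχ1, hχs⟩ := exists_plateau (a' := c - ε / 2) (a := c - ε / 4) (b := d + ε / 4)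
    (b' := d + ε / 2) (by linarith) (by linarith) (by linarith)
  have ex := hα.tm_eq_self isOpen_Ioo hψ (fun γ hγ => hψ1 γ (Ioo_subset_Icc_self hγ))
    (Icc_subset_Ioo (by linarith) (by linarith)) hx
  have ey := hα.tm_eq_self isOpen_Ioo hχ (fun γ hγ => hχ1 γ (Ioo_subset_Icc_self hγ))
    (Icc_subset_Ioo (by linarith) (by linarith)) hy
  intro φ hφ hd
  rw [← ex, ← ey]
  refine hα.tm_mul_eq_zero hφ hψ hχ (fun p q => ?_) x y
  by_contra hne
  have h1 := subset_tsupport φ (left_ne_zero_of_mul (left_ne_zero_of_mul hne))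
  have h2 := hψs (subset_tsupport ψ (right_ne_zero_of_mul (left_ne_zero_of_mul hne)))
  have h3 := hχs (subset_tsupport χ (right_ne_zero_of_mul hne))
  exact disjoint_left.1 hd h1 ⟨by linarith [h2.1, h3.1], by linarith [h2.2, h3.2]⟩

lemma exists_Icc_of_tst (hα : IsCStarDynSys α) (hφ : Tst φ) (hx : x ∈ hα.spec F) (hF : IsClosed F) :
    ∃ N : ℝ, tm α φ x ∈ hα.spec (Icc (-N) N ∩ F) := by
  obtain ⟨N, hN⟩ := hφ.cpt.isCompact.isBounded.subset_closedBall 0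
  rw [Real.closedBall_eq_Icc, zero_sub, zero_add] at hN
  exact ⟨N, hα.mem_spec_inter isClosed_Icc hF (hα.tm_mem_spec hφ hN x) (hα.tm_mem_spec_of_mem hφ hx)⟩

lemma mul_mem_spec_Ici (hα : IsCStarDynSys α) {a c : ℝ} (hx : x ∈ hα.spec (Ici a))
    (hy : y ∈ hα.spec (Ici c)) : x * y ∈ hα.spec (Ici (a + c)) := by
  obtain ⟨φ, hφ, hφx⟩ := exists_approx x hα
  obtain ⟨ψ, hψ, hψx⟩ := exists_approx y hα
  refine (hα.isClosed_spec _).mem_of_tendsto (hφx.mul hψx) (Eventually.of_forall fun n => ?_)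
  obtain ⟨N, hN⟩ := hα.exists_Icc_of_tst (hφ n) hx isClosed_Ici
  obtain ⟨K, hK⟩ := hα.exists_Icc_of_tst (hψ n) hy isClosed_Ici
  refine hα.spec_mono Icc_subset_Ici_self (hα.mul_mem_spec_Icc (b := N) (d := K) ?_ ?_)
  · exact hα.spec_mono (show _ ⊆ Icc a N from fun z hz => ⟨hz.2, hz.1.2⟩) hN
  · exact hα.spec_mono (show _ ⊆ Icc c K from fun z hz => ⟨hz.2, hz.1.2⟩) hK

lemma star_mem_spec_Icc (hα : IsCStarDynSys α) {a b : ℝ} (hx : x ∈ hα.spec (Icc a b)) :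
    star x ∈ hα.spec (Icc (-b) (-a)) := by simpa using hα.star_mem_spec hx

lemma star_mem_spec_Ici (hα : IsCStarDynSys α) {a : ℝ} (hx : x ∈ hα.spec (Ici a)) :
    star x ∈ hα.spec (Iic (-a)) := by simpa using hα.star_mem_spec hx

lemma star_mem_spec_Iic (hα : IsCStarDynSys α) {a : ℝ} (hx : x ∈ hα.spec (Iic a)) :
    star x ∈ hα.spec (Ici (-a)) := by simpa using hα.star_mem_spec hx

lemma mul_mem_spec_Iic (hα : IsCStarDynSys α) {a c : ℝ} (hx : x ∈ hα.spec (Iic a))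
    (hy : y ∈ hα.spec (Iic c)) : x * y ∈ hα.spec (Iic (a + c)) := by
  have := hα.star_mem_spec_Ici
    (hα.mul_mem_spec_Ici (hα.star_mem_spec_Iic hy) (hα.star_mem_spec_Iic hx))
  rw [star_mul, star_star, star_star] at this
  exact hα.spec_mono (Iic_subset_Iic.2 (by linarith)) this

/-- Splitting an element with spectrum bounded below. -/
lemma exists_split (hα : IsCStarDynSys α) {c p q : ℝ} (hpq : p < q) (hx : x ∈ hα.spec (Ici c)) :
    ∃ φ, Tst φ ∧ tm α φ x ∈ hα.spec (Icc c q) ∧ x - tm α φ x ∈ hα.spec (Ici p) := by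
  obtain ⟨φ, hφ, hφ1, hφs⟩ := exists_plateau (a' := min c p - 2) (a := min c p - 1) (b := p)
    (b' := q) (by linarith) (by linarith [min_le_right c p]) hpq
  refine ⟨φ, hφ, ?_, ?_⟩
  · have := hα.mem_spec_inter isClosed_Icc isClosed_Ici (hα.tm_mem_spec hφ hφs x)
      (hα.tm_mem_spec_of_mem hφ hx)
    exact hα.spec_mono (show _ ⊆ Icc c q from fun z hz => ⟨hz.2, hz.1.2⟩) this
  · have := hα.sub_tm_mem_spec isOpen_Ioo hφ (fun γ hγ => hφ1 γ (Ioo_subset_Icc_self hγ)) hx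
    refine hα.spec_mono (fun z hz => ?_) this
    by_contra hz'
    exact hz.2 ⟨by linarith [min_le_left c p, mem_Ici.1 hz.1], not_le.1 hz'⟩

lemma smear_mem (hα : IsCStarDynSys α) (hS : IsClosed (S : Set X)) (hf : Integrable f)
    (h : ∀ t, α t x ∈ S) : smear α f x ∈ S := by
  have : IsClosed (S : Set X) := hS
  rw [← Submodule.Quotient.mk_eq_zero]
  have := S.mkQL.integral_comp_comm (hα.integrable hf x)
  change S.mkQL (smear α f x) = 0
  rw [smear, ← this]
  refine integral_eq_zero_of_ae (ae_of_all _ fun t => ?_)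
  simp only [map_smul]
  have : S.mkQL (α t x) = 0 := (Submodule.Quotient.mk_eq_zero S).2 (h t)
  rw [this, smul_zero]; rfl

lemma tm_mem (hα : IsCStarDynSys α) (hS : IsClosed (S : Set X)) (hi : Invariant α (S : Set X))
    (hφ : Tst φ) (hx : x ∈ S) : tm α φ x ∈ S :=
  hα.smear_mem hS hφ.ker_integrable fun t => hi t x hx

lemma invariant_spec (hα : IsCStarDynSys α) (F : Set ℝ) : Invariant α (hα.spec F : Set X) :=
  fun t _ hx => hα.map_mem_spec t hx

end IsCStarDynSys

/-! ### Closed spans and products of subspaces -/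

/-- Closed linear span, as a submodule. -/
def cl (S : Set X) : Submodule ℂ X := (Submodule.span ℂ S).topologicalClosure

lemma coe_cl (S : Set X) : (cl S : Set X) = ClosedSpan S := rfl

lemma isClosed_cl (S : Set X) : IsClosed (cl S : Set X) := Submodule.isClosed_topologicalClosure _

lemma subset_cl (S : Set X) : S ⊆ cl S :=
  Submodule.subset_span.trans (Submodule.le_topologicalClosure _)

lemma cl_le {A : Set X} (hV : IsClosed (V : Set X)) (h : A ⊆ V) : cl A ≤ V :=
  Submodule.topologicalClosure_minimal _ (Submodule.span_le.2 h) hV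

/-- Closed span of the products. -/
def pr (S T : Submodule ℂ X) : Submodule ℂ X := cl (MulSet2 (S : Set X) T)

infixl:70 " ⊡ " => pr

lemma isClosed_pr : IsClosed (S ⊡ T : Set X) := isClosed_cl _

lemma mul_mem_pr (hx : x ∈ S) (hy : y ∈ T) : x * y ∈ S ⊡ T := subset_cl _ ⟨x, hx, y, hy, rfl⟩

lemma pr_le (hV : IsClosed (V : Set X)) (h : ∀ s ∈ S, ∀ t ∈ T, s * t ∈ V) : S ⊡ T ≤ V :=
  cl_le hV (by rintro _ ⟨s, hs, t, ht, rfl⟩; exact h s hs t ht)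

lemma pr_mono (h : S ≤ S') (h' : T ≤ T') : S ⊡ T ≤ S' ⊡ T' :=
  pr_le isClosed_pr fun _ hs _ ht => mul_mem_pr (h hs) (h' ht)

/-- The elements which multiply a subspace into another one, from the left. -/
def lmult (S V : Submodule ℂ X) : Submodule ℂ X where
  carrier := {x | ∀ s ∈ S, x * s ∈ V}
  zero_mem' := fun s _ => by rw [zero_mul]; exact zero_mem _
  add_mem' := fun hx hy s hs => by rw [add_mul]; exact add_mem (hx s hs) (hy s hs)
  smul_mem' := fun c x hx s hs => by rw [smul_mul_assoc]; exact V.smul_mem c (hx s hs)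

/-- The elements which multiply a subspace into another one, from the right. -/
def rmult (S V : Submodule ℂ X) : Submodule ℂ X where
  carrier := {x | ∀ s ∈ S, s * x ∈ V}
  zero_mem' := fun s _ => by rw [mul_zero]; exact zero_mem _
  add_mem' := fun hx hy s hs => by rw [mul_add]; exact add_mem (hx s hs) (hy s hs)
  smul_mem' := fun c x hx s hs => by rw [mul_smul_comm]; exact V.smul_mem c (hx s hs)

lemma isClosed_lmult (hV : IsClosed (V : Set X)) : IsClosed (lmult S V : Set X) := by
  have : (lmult S V : Set X) = ⋂ s ∈ S, (fun x => x * s) ⁻¹' (V : Set X) := by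
    ext x; simp only [mem_iInter]; rfl
  rw [this]
  exact isClosed_iInter fun s => isClosed_iInter fun _ => hV.preimage (by fun_prop)

lemma isClosed_rmult (hV : IsClosed (V : Set X)) : IsClosed (rmult S V : Set X) := by
  have : (rmult S V : Set X) = ⋂ s ∈ S, (fun x => s * x) ⁻¹' (V : Set X) := by
    ext x; simp only [mem_iInter]; rfl
  rw [this]
  exact isClosed_iInter fun s => isClosed_iInter fun _ => hV.preimage (by fun_prop)

lemma mul_mem_of_mem_pr_left (hV : IsClosed (V : Set X)) (h : ∀ s ∈ S, ∀ t ∈ T, s * t * y ∈ V)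
    (hx : x ∈ S ⊡ T) : x * y ∈ V := by
  have : S ⊡ T ≤ lmult (Submodule.span ℂ {y}) V := pr_le (isClosed_lmult hV) fun s hs t ht z hz => by
    obtain ⟨c, rfl⟩ := Submodule.mem_span_singleton.1 hz
    rw [mul_smul_comm]; exact V.smul_mem c (h s hs t ht)
  exact this hx y (Submodule.mem_span_singleton_self y)

lemma mul_mem_of_mem_pr_right (hV : IsClosed (V : Set X)) (h : ∀ s ∈ S, ∀ t ∈ T, x * (s * t) ∈ V)
    (hy : y ∈ S ⊡ T) : x * y ∈ V := by
  have : S ⊡ T ≤ rmult (Submodule.span ℂ {x}) V := pr_le (isClosed_rmult hV) fun s hs t ht z hz => by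
    obtain ⟨c, rfl⟩ := Submodule.mem_span_singleton.1 hz
    rw [smul_mul_assoc]; exact V.smul_mem c (h s hs t ht)
  exact this hy x (Submodule.mem_span_singleton_self x)

lemma pr_assoc (S T R : Submodule ℂ X) : S ⊡ T ⊡ R = S ⊡ (T ⊡ R) := by
  apply le_antisymm
  · refine pr_le isClosed_pr fun s hs r hr => mul_mem_of_mem_pr_left isClosed_pr (fun a ha b hb => ?_) hs
    rw [mul_assoc]; exact mul_mem_pr ha (mul_mem_pr hb hr)
  · refine pr_le isClosed_pr fun s hs r hr => mul_mem_of_mem_pr_right isClosed_pr (fun a ha b hb => ?_) hr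
    rw [← mul_assoc]; exact mul_mem_pr (mul_mem_pr hs ha) hb

/-- The adjoint of a subspace. -/
def sst (S : Submodule ℂ X) : Submodule ℂ X where
  carrier := {x | star x ∈ S}
  zero_mem' := by simp
  add_mem' := fun {x y} hx hy => by
    change star (x + y) ∈ S; rw [star_add]; exact add_mem hx hy
  smul_mem' := fun c x hx => by
    change star (c • x) ∈ S; rw [star_smul]; exact S.smul_mem _ hx

lemma mem_sst : x ∈ sst S ↔ star x ∈ S := Iff.rfl

lemma star_mem_sst (hx : x ∈ S) : star x ∈ sst S := by rwa [mem_sst, star_star]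

lemma sst_sst (S : Submodule ℂ X) : sst (sst S) = S := by ext x; simp [mem_sst]

lemma isClosed_sst (hS : IsClosed (S : Set X)) : IsClosed (sst S : Set X) :=
  hS.preimage continuous_star

lemma sst_mono (h : S ≤ T) : sst S ≤ sst T := fun _ hx => h hx

lemma sst_pr (S T : Submodule ℂ X) : sst (S ⊡ T) = sst T ⊡ sst S := by
  have key : ∀ S T : Submodule ℂ X, sst T ⊡ sst S ≤ sst (S ⊡ T) := fun S T =>
    pr_le (isClosed_sst isClosed_pr) fun s hs t ht => by
      rw [mem_sst, star_mul]; exact mul_mem_pr ht hs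
  apply le_antisymm _ (key S T)
  have := sst_mono (key (sst T) (sst S))
  rwa [sst_sst, sst_sst, sst_sst] at this

lemma coe_sst (S : Submodule ℂ X) : (sst S : Set X) = star '' (S : Set X) := by
  ext x
  constructor
  · intro h; exact ⟨star x, h, star_star x⟩
  · rintro ⟨y, hy, rfl⟩; exact star_mem_sst hy

lemma cl_mulSet3 (S T R : Submodule ℂ X) : cl (MulSet3 (S : Set X) T R) = S ⊡ T ⊡ R := by
  apply le_antisymm
  · refine cl_le isClosed_pr ?_
    rintro _ ⟨s, hs, t, ht, r, hr, rfl⟩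
    exact mul_mem_pr (mul_mem_pr hs ht) hr
  · refine pr_le (isClosed_cl _) fun s hs r hr =>
      mul_mem_of_mem_pr_left (isClosed_cl _) (fun a ha b hb => subset_cl _ ⟨a, ha, b, hb, r, hr, rfl⟩) hs

namespace IsCStarDynSys

lemma sst_spec_Icc (hα : IsCStarDynSys α) (a b : ℝ) :
    sst (hα.spec (Icc a b)) = hα.spec (Icc (-b) (-a)) := by
  ext x
  constructor
  · intro h; simpa using hα.star_mem_spec_Icc (mem_sst.1 h)
  · intro h; simpa [mem_sst] using hα.star_mem_spec_Icc h

lemma sst_spec_Ici (hα : IsCStarDynSys α) (a : ℝ) :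
    sst (hα.spec (Ici a)) = hα.spec (Iic (-a)) := by
  ext x
  constructor
  · intro h; simpa using hα.star_mem_spec_Ici (mem_sst.1 h)
  · intro h; simpa [mem_sst] using hα.star_mem_spec_Iic h

lemma sst_spec_Iic (hα : IsCStarDynSys α) (a : ℝ) :
    sst (hα.spec (Iic a)) = hα.spec (Ici (-a)) := by
  rw [← sst_sst (hα.spec (Ici (-a))), sst_spec_Ici, neg_neg]

lemma invariant_cl (hα : IsCStarDynSys α) {A : Set X} (h : Invariant α A) :
    Invariant α (cl A : Set X) := by
  intro t x hx
  have : cl A ≤ (cl A).comap (hα.autL t : X →ₗ[ℂ] X) :=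
    cl_le ((isClosed_cl A).preimage (hα.autL t).continuous) fun z hz => subset_cl _ (h t z hz)
  exact this hx

lemma invariant_pr (hα : IsCStarDynSys α) (hS : Invariant α (S : Set X))
    (hT : Invariant α (T : Set X)) : Invariant α (S ⊡ T : Set X) := by
  refine hα.invariant_cl ?_
  rintro t _ ⟨s, hs, r, hr, rfl⟩
  exact ⟨_, hS t s hs, _, hT t r hr, hα.map_mul t s r⟩

lemma invariant_sst (hα : IsCStarDynSys α) (hS : Invariant α (S : Set X)) :
    Invariant α (sst S : Set X) := fun t x hx => by
  change star (α t x) ∈ S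
  rw [← hα.map_star]; exact hS t _ hx

lemma invariant_inf (hS : Invariant α (S : Set X)) (hT : Invariant α (T : Set X)) :
    Invariant α ((S ⊓ T : Submodule ℂ X) : Set X) := fun t x hx => ⟨hS t x hx.1, hT t x hx.2⟩

lemma invariant_top : Invariant α ((⊤ : Submodule ℂ X) : Set X) := fun _ _ _ => trivial

end IsCStarDynSys

end

section

variable {α : ℝ → X → X} {f g φ ψ χ : ℝ → ℂ} {F G : Set ℝ} {x y : X}
  {S T R S' T' V B Y : Submodule ℂ X}

/-- Closed *-subalgebras. -/
structure IsCS (B : Submodule ℂ X) : Prop where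
  closed : IsClosed (B : Set X)
  mul_mem : ∀ x ∈ B, ∀ y ∈ B, x * y ∈ B
  star_mem : ∀ x ∈ B, star x ∈ B

/-- Closed two-sided ideals. -/
structure IsId (Y : Submodule ℂ X) : Prop where
  closed : IsClosed (Y : Set X)
  mul_left : ∀ x, ∀ y ∈ Y, x * y ∈ Y
  mul_right : ∀ y ∈ Y, ∀ x, y * x ∈ Y

lemma IsCS.sst_eq (hB : IsCS B) : sst B = B := by
  ext x
  exact ⟨fun h => by simpa using hB.star_mem _ (mem_sst.1 h), fun h => hB.star_mem _ h⟩

lemma IsCS.exists_unit (hB : IsCS B) : ∃ l : Filter X, l.NeBot ∧ (∀ᶠ e in l, e ∈ B ∧ ‖e‖ ≤ 1) ∧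
    ∀ b ∈ B, Tendsto (fun e => e * b) l (𝓝 b) ∧ Tendsto (fun e => b * e) l (𝓝 b) := by
  let _ := cstarInst X
  let B' : NonUnitalStarSubalgebra ℂ X :=
    { B with mul_mem' := fun {a b} ha hb => hB.mul_mem a ha b hb
             star_mem' := fun {a} ha => hB.star_mem a ha }
  have hc : IsClosed (B' : Set X) := hB.closed
  let _ : NonUnitalCStarAlgebra B' := NonUnitalStarSubalgebra.nonUnitalCStarAlgebra B'
  let _ : PartialOrder B' := CStarAlgebra.spectralOrder B'
  have : StarOrderedRing B' := CStarAlgebra.spectralOrderedRing B'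
  have hl := CStarAlgebra.increasingApproximateUnit (A := B')
  have := hl.neBot
  refine ⟨(CStarAlgebra.approximateUnit B').map Subtype.val, inferInstance, ?_, fun b hb => ?_⟩
  · rw [eventually_map]
    filter_upwards [hl.eventually_norm] with e he
    exact ⟨e.2, he⟩
  · have h1 := hl.tendsto_mul_left ⟨b, hb⟩
    have h2 := hl.tendsto_mul_right ⟨b, hb⟩
    exact ⟨tendsto_map'_iff.2 ((continuous_subtype_val.tendsto _).comp h2),
      tendsto_map'_iff.2 ((continuous_subtype_val.tendsto _).comp h1)⟩

lemma IsCS.top : IsCS (⊤ : Submodule ℂ X) := ⟨isClosed_univ, fun _ _ _ _ => trivial, fun _ _ => trivial⟩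

lemma IsId.top : IsId (⊤ : Submodule ℂ X) := ⟨isClosed_univ, fun _ _ _ => trivial, fun _ _ _ => trivial⟩

lemma IsCS.le_pr_self (hB : IsCS B) : B ≤ B ⊡ B := fun b hb => by
  obtain ⟨l, hl, h1, h2⟩ := hB.exists_unit
  refine isClosed_pr.mem_of_tendsto (h2 b hb).1 ?_
  filter_upwards [h1] with e he
  exact mul_mem_pr he.1 hb

lemma le_pr_top : S ≤ S ⊡ ⊤ := fun b hb => by
  obtain ⟨l, hl, h1, h2⟩ := (IsCS.top (X := X)).exists_unit
  refine isClosed_pr.mem_of_tendsto (h2 b trivial).2 ?_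
  exact Eventually.of_forall fun e => mul_mem_pr hb trivial

lemma le_top_pr : S ≤ ⊤ ⊡ S := fun b hb => by
  obtain ⟨l, hl, h1, h2⟩ := (IsCS.top (X := X)).exists_unit
  refine isClosed_pr.mem_of_tendsto (h2 b trivial).1 ?_
  exact Eventually.of_forall fun e => mul_mem_pr trivial hb

lemma norm_sub_mul_sq_le {y u : X} (hu : ‖u‖ ≤ 1) :
    ‖y - y * u‖ ^ 2 ≤ 2 * ‖star y * y - star y * y * u‖ := by
  have h1 : star (y - y * u) * (y - y * u)
      = (star y * y - star y * y * u) - star u * (star y * y - star y * y * u) := by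
    rw [star_sub, star_mul]; noncomm_ring
  rw [sq, ← CStarRing.norm_star_mul_self, h1]
  refine (norm_sub_le _ _).trans ?_
  have := norm_mul_le (star u) (star y * y - star y * y * u)
  rw [norm_star] at this
  nlinarith [norm_nonneg (star y * y - star y * y * u)]

lemma tendsto_of_star_mul_self {l : Filter X}
    (h1 : ∀ᶠ e in l, e ∈ B ∧ ‖e‖ ≤ 1) (h2 : ∀ b ∈ B, Tendsto (fun e => b * e) l (𝓝 b))
    (hy : star y * y ∈ B) : Tendsto (fun u => y * u) l (𝓝 y) := by
  have h3 : Tendsto (fun u => 2 * ‖star y * y - star y * y * u‖) l (𝓝 0) := by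
    have := ((h2 _ hy).const_sub (star y * y)).norm.const_mul 2
    simpa using this
  have h4 : Tendsto (fun u => ‖y - y * u‖ ^ 2) l (𝓝 0) :=
    squeeze_zero' (Eventually.of_forall fun _ => by positivity)
      (h1.mono fun u hu => norm_sub_mul_sq_le hu.2) h3
  have h5 : Tendsto (fun u => ‖y - y * u‖) l (𝓝 0) := by
    have := h4.sqrt
    simpa using this
  have := (tendsto_zero_iff_norm_tendsto_zero.2 h5).const_sub y
  simpa using this

lemma IsId.pr_le_left (hY : IsId Y) : S ⊡ Y ≤ Y := pr_le hY.closed fun s _ y hy => hY.mul_left s y hy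

lemma IsId.pr_le_right (hY : IsId Y) : Y ⊡ S ≤ Y := pr_le hY.closed fun y hy s _ => hY.mul_right y hy s

lemma isCS_star_pr_pr (hY : IsId Y) (hs : sst Y = Y) (S : Submodule ℂ X) :
    IsCS (sst S ⊡ Y ⊡ S) := by
  have h1 : (sst S ⊡ Y ⊡ S) ⊡ (sst S ⊡ Y ⊡ S) ≤ sst S ⊡ Y ⊡ S := by
    have h : sst S ⊡ (Y ⊡ S ⊡ sst S ⊡ Y) ⊡ S ≤ sst S ⊡ Y ⊡ S :=
      pr_mono (pr_mono le_rfl hY.pr_le_left) le_rfl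
    simpa only [pr_assoc] using h
  have h2 : sst (sst S ⊡ Y ⊡ S) = sst S ⊡ Y ⊡ S := by
    rw [sst_pr, sst_pr, sst_sst, hs, pr_assoc]
  refine ⟨isClosed_pr, fun x hx y hy => h1 (mul_mem_pr hx hy), fun x hx => ?_⟩
  rw [← h2, mem_sst, star_star]; exact hx

/-- Every subspace is contained in its own product with its adjoint. -/
lemma le_pr_sst_pr (S : Submodule ℂ X) : S ≤ S ⊡ (sst S ⊡ ⊤ ⊡ S) := fun c hc => by
  have hst : sst (⊤ : Submodule ℂ X) = ⊤ := by ext; simp [mem_sst]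
  have hB := isCS_star_pr_pr IsId.top hst S
  obtain ⟨l, hl, h1, h2⟩ := hB.exists_unit
  have h3 : star c * c ∈ sst S ⊡ ⊤ ⊡ S := by
    rw [pr_assoc]; refine mul_mem_pr (star_mem_sst hc) (le_top_pr hc)
  refine isClosed_pr.mem_of_tendsto (tendsto_of_star_mul_self h1 (fun b hb => (h2 b hb).2) h3) ?_
  filter_upwards [h1] with e he
  exact mul_mem_pr hc he.1

lemma IsId.adjoint (hY : IsId Y) : IsId (sst Y) :=
  ⟨isClosed_sst hY.closed, fun x y hy => by rw [mem_sst, star_mul]; exact hY.mul_right _ hy _,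
    fun y hy x => by rw [mem_sst, star_mul]; exact hY.mul_left _ _ hy⟩

lemma IsId.isCS (hY : IsId Y) : IsCS Y := by
  refine ⟨hY.closed, fun x _ y hy => hY.mul_left x y hy, fun x hx => ?_⟩
  have h1 := le_pr_sst_pr Y hx
  rw [← pr_assoc, ← pr_assoc] at h1
  exact ((pr_mono (pr_mono hY.adjoint.pr_le_left le_rfl) le_rfl).trans
    ((pr_mono hY.adjoint.pr_le_right le_rfl).trans hY.adjoint.pr_le_right)) h1

lemma IsId.sst_eq (hY : IsId Y) : sst Y = Y := hY.isCS.sst_eq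

lemma IsId.pr_self (hY : IsId Y) : Y ⊡ Y = Y := le_antisymm hY.pr_le_left hY.isCS.le_pr_self

lemma IsId.isCS_star (hY : IsId Y) (S : Submodule ℂ X) : IsCS (sst S ⊡ Y ⊡ S) :=
  isCS_star_pr_pr hY hY.sst_eq S

/-- A positive element dominated by an element of a C*-subalgebra factors through it. -/
lemma IsCS.mem_pr_of_le (hB : IsCS B) {b : X} (hb : b ∈ B) (h : star y * y ≤ b) : y ∈ ⊤ ⊡ B := by
  let _ := cstarInst X
  obtain ⟨l, hl, h1, h2⟩ := hB.exists_unit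
  obtain ⟨k, hk, k1, k2⟩ := (IsCS.top (X := X)).exists_unit
  have key : ∀ u, ‖u‖ ≤ 1 → ‖y - y * u‖ ^ 2 ≤ 2 * ‖b - b * u‖ := fun u hu => by
    have t1 : Tendsto (fun e => ‖y * (e - e * u)‖ ^ 2) k (𝓝 (‖y - y * u‖ ^ 2)) := by
      simp only [mul_sub, ← mul_assoc]
      exact ((((k2 y trivial).2).sub ((k2 y trivial).2.mul_const u)).norm.pow 2)
    have t2 : Tendsto (fun e => 2 * ‖b * (e - e * u)‖) k (𝓝 (2 * ‖b - b * u‖)) := by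
      simp only [mul_sub, ← mul_assoc]
      exact ((((k2 b trivial).2).sub ((k2 b trivial).2.mul_const u)).norm.const_mul 2)
    refine le_of_tendsto_of_tendsto t1 t2 (k1.mono fun e he => ?_)
    have h3 := CStarAlgebra.norm_le_norm_of_nonneg_of_le
      (star_left_conjugate_nonneg (star_mul_self_nonneg y) (e - e * u))
      (star_left_conjugate_le_conjugate h (e - e * u))
    have h4 : ‖y * (e - e * u)‖ ^ 2 = ‖star (e - e * u) * (star y * y) * (e - e * u)‖ := by
      rw [sq, ← CStarRing.norm_star_mul_self, star_mul]; simp only [mul_assoc]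
    have h5 : ‖e - e * u‖ ≤ 2 := by
      refine (norm_sub_le _ _).trans ?_
      nlinarith [norm_mul_le e u, he.2, norm_nonneg e, norm_nonneg u]
    change ‖y * (e - e * u)‖ ^ 2 ≤ 2 * ‖b * (e - e * u)‖
    rw [h4]
    refine h3.trans ?_
    rw [mul_assoc]
    refine (norm_mul_le _ _).trans ?_
    rw [norm_star]
    gcongr
  have h3 : Tendsto (fun u => 2 * ‖b - b * u‖) l (𝓝 0) := by
    have := (((h2 b hb).2).const_sub b).norm.const_mul 2
    simpa using this
  have h4 : Tendsto (fun u => ‖y - y * u‖ ^ 2) l (𝓝 0) :=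
    squeeze_zero' (Eventually.of_forall fun _ => by positivity)
      (h1.mono fun u hu => key u hu.2) h3
  have h5 : Tendsto (fun u => ‖y - y * u‖) l (𝓝 0) := by
    have := h4.sqrt
    simpa using this
  have h6 : Tendsto (fun u => y * u) l (𝓝 y) := by
    have := (tendsto_zero_iff_norm_tendsto_zero.2 h5).const_sub y
    simpa using this
  refine isClosed_pr.mem_of_tendsto h6 ?_
  filter_upwards [h1] with e he
  exact mul_mem_pr trivial he.1

lemma exists_star_mul_self_of_nonneg (h : 0 ≤ x) : ∃ y : X, x = star y * y := by
  let _ := cstarInst X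
  exact CStarAlgebra.nonneg_iff_eq_star_mul_self.1 h

lemma IsId.mem_star_pr_of_le (hY : IsId Y) (S : Submodule ℂ X) {b : X}
    (hb : b ∈ sst S ⊡ Y ⊡ S) (hx : 0 ≤ x) (hxb : x ≤ b) : x ∈ sst S ⊡ Y ⊡ S := by
  obtain ⟨y, rfl⟩ := exists_star_mul_self_of_nonneg hx
  have h1 := (hY.isCS_star S).mem_pr_of_le hb hxb
  have h2 : ⊤ ⊡ (sst S ⊡ Y ⊡ S) ≤ Y ⊡ S := by
    rw [← pr_assoc, ← pr_assoc]
    exact pr_mono hY.pr_le_left le_rfl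
  have h3 := mul_mem_pr (star_mem_sst (h2 h1)) (h2 h1)
  rw [sst_pr, hY.sst_eq, ← pr_assoc, pr_assoc (sst S), hY.pr_self] at h3
  exact h3

lemma IsId.hereditary_star_pr (hY : IsId Y) (S : Submodule ℂ X) :
    IsHereditaryIn (Y : Set X) (sst S ⊡ Y ⊡ S : Submodule ℂ X) := by
  have hB := hY.isCS_star S
  refine ⟨?_, hB.closed, ⟨⟨zero_mem _, fun x hx y hy => add_mem hx hy,
    fun c x hx => Submodule.smul_mem _ c hx, hB.mul_mem⟩, hB.star_mem⟩, fun x _ b hb h0 hxb => ?_⟩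
  · exact SetLike.coe_subset_coe.2 ((pr_mono hY.pr_le_left le_rfl).trans hY.pr_le_right)
  · exact hY.mem_star_pr_of_le S hb h0 hxb

lemma IsHereditaryIn.isCS (hB : IsHereditaryIn (Y : Set X) (B : Set X)) : IsCS B :=
  ⟨hB.2.1, hB.2.2.1.1.2.2.2, hB.2.2.1.2⟩

lemma IsHereditaryIn.star_mul_mul_self_mem (hY : IsId Y)
    (hB : IsHereditaryIn (Y : Set X) (B : Set X)) {b : X} (hb : b ∈ B) (x : X) :
    star b * x * b ∈ B := by
  let _ := cstarInst X
  have h : Submodule.span ℂ {a : X | 0 ≤ a} ≤ rmult (Submodule.span ℂ {star b})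
      (lmult (Submodule.span ℂ {b}) B) := by
    refine Submodule.span_le.2 fun a ha => ?_
    rintro s hs t ht
    obtain ⟨c, rfl⟩ := Submodule.mem_span_singleton.1 hs
    obtain ⟨d, rfl⟩ := Submodule.mem_span_singleton.1 ht
    rw [smul_mul_assoc, mul_smul_comm, smul_mul_assoc]
    refine B.smul_mem _ (B.smul_mem _ ?_)
    have h1 : star b * a * b ≤ ‖a‖ • (star b * b) :=
      CStarAlgebra.star_left_conjugate_le_norm_smul (IsSelfAdjoint.of_nonneg ha)
    refine hB.2.2.2 _ (hY.mul_left _ _ (hB.1 hb)) _ ?_ (star_left_conjugate_nonneg ha b) h1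
    have := B.smul_mem ((‖a‖ : ℝ) : ℂ) (hB.isCS.mul_mem _ (hB.isCS.star_mem _ hb) _ hb)
    simpa using this
  rw [CStarAlgebra.span_nonneg] at h
  exact h (trivial : x ∈ (⊤ : Submodule ℂ X)) _ (Submodule.mem_span_singleton_self _) _
    (Submodule.mem_span_singleton_self _)

lemma IsHereditaryIn.mul_mul_mem (hY : IsId Y)
    (hB : IsHereditaryIn (Y : Set X) (B : Set X)) {a b : X} (ha : a ∈ B) (hb : b ∈ B) (x : X) :
    a * x * b ∈ B := by
  have key : ∀ a ∈ B, star a * x * b ∈ B := fun a ha => by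
    have h1 := hB.star_mul_mul_self_mem hY (B.add_mem hb ha) x
    have h2 := hB.star_mul_mul_self_mem hY (B.sub_mem hb ha) x
    have h3 := hB.star_mul_mul_self_mem hY (B.add_mem hb (B.smul_mem Complex.I ha)) x
    have h4 := hB.star_mul_mul_self_mem hY (B.sub_mem hb (B.smul_mem Complex.I ha)) x
    have h5 := B.smul_mem (1 / 4 : ℂ) (add_mem (sub_mem h1 h2)
      (B.smul_mem Complex.I (sub_mem h3 h4)))
    convert h5 using 1
    simp only [star_add, star_sub, star_smul, add_mul, sub_mul, mul_add, mul_sub, smul_mul_assoc,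
      mul_smul_comm, Complex.star_def, Complex.conj_I, smul_add, smul_sub, smul_smul, neg_smul, neg_mul, smul_neg]
    match_scalars <;> ring_nf <;> simp <;> norm_num
  simpa using key _ (hB.isCS.star_mem _ ha)

lemma IsHereditaryIn.pr_pr_le (hY : IsId Y) (hB : IsHereditaryIn (Y : Set X) (B : Set X)) :
    B ⊡ ⊤ ⊡ B ≤ B :=
  pr_le hB.2.1 fun _ hs _ ht => mul_mem_of_mem_pr_left hB.2.1
    (fun _ ha _ _ => hB.mul_mul_mem hY ha ht _) hs

namespace IsCStarDynSys

lemma exists_seq_unit (hα : IsCStarDynSys α) (hB : IsCS B) (hi : Invariant α (B : Set X)) {b : X}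
    (hb : b ∈ B) : ∃ e : ℕ → X, (∀ n, e n ∈ B ∧ ‖e n‖ ≤ 1) ∧
      ∀ s, Tendsto (fun n => e n * α s b) atTop (𝓝 (α s b)) := by
  obtain ⟨l, hl, h1, h2⟩ := hB.exists_unit
  obtain ⟨q, hq⟩ := TopologicalSpace.exists_dense_seq ℝ
  have h3 : ∀ n : ℕ, ∃ e, (e ∈ B ∧ ‖e‖ ≤ 1) ∧
      ∀ i ∈ Finset.range n, ‖e * α (q i) b - α (q i) b‖ < 1 / ((n : ℝ) + 1) := fun n => by
    refine (h1.and ((Finset.eventually_all _).2 fun i _ => ?_)).exists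
    have := tendsto_iff_norm_sub_tendsto_zero.1 (h2 _ (hi (q i) b hb)).1
    exact this.eventually (gt_mem_nhds (by positivity))
  choose e he1 he2 using h3
  refine ⟨e, he1, fun s => ?_⟩
  rw [Metric.tendsto_atTop]
  intro ε hε
  obtain ⟨i, hi⟩ := hq.exists_mem_open
    (((hα.continuous_orbit b).sub continuous_const).norm.isOpen_preimage (Iio (ε / 4)) isOpen_Iio
      : IsOpen ((fun t => ‖α t b - α s b‖) ⁻¹' Iio (ε / 4))) ⟨s, by simp [hε]⟩
  change ‖α (q i) b - α s b‖ < ε / 4 at hi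
  obtain ⟨N, hN⟩ := exists_nat_one_div_lt (show 0 < ε / 4 by linarith)
  refine ⟨max N (i + 1), fun n hn => ?_⟩
  have h4 := he2 n i (Finset.mem_range.2 (by have := le_max_right N (i+1); omega))
  have h5 : 1 / ((n : ℝ) + 1) ≤ 1 / ((N : ℝ) + 1) := by
    have : (N : ℝ) ≤ n := by exact_mod_cast (le_max_left _ _).trans hn
    gcongr
  rw [dist_eq_norm]
  have h6 : e n * α s b - α s b = (e n * α (q i) b - α (q i) b) - e n * (α (q i) b - α s b)
    + (α (q i) b - α s b) := by noncomm_ring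
  rw [h6]
  refine (norm_add_le _ _).trans_lt ?_
  have h7 := norm_sub_le (e n * α (q i) b - α (q i) b) (e n * (α (q i) b - α s b))
  have h8 := norm_mul_le (e n) (α (q i) b - α s b)
  have h9 := mul_le_of_le_one_left (norm_nonneg (α (q i) b - α s b)) (he1 n).2
  linarith

/-- Approximate units may be chosen with small spectrum. -/
lemma le_unit_pr (hα : IsCStarDynSys α) (hB : IsCS B) (hi : Invariant α (B : Set X)) {η : ℝ}
    (hη : 0 < η) (hS : S ≤ B) : S ≤ (B ⊓ hα.spec (Icc (-η) η)) ⊡ S := fun b hb => by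
  obtain ⟨e, he, het⟩ := hα.exists_seq_unit hB hi (hS hb)
  obtain ⟨φ, hφ, hφ1, hφs⟩ := exists_plateau (a' := -η) (a := 0) (b := 0) (b' := η)
    (by linarith) le_rfl hη
  have hk : ∫ s, ker φ s = 1 := by
    have := hφ.fourierT_ker 0
    rw [hφ1 0 (by simp)] at this
    simpa [fourierT] using this
  have h1 : ∀ n, tm α φ (e n) * b = ∫ s, ker φ s • (α s (e n) * b) := fun n => by
    have := (ContinuousLinearMap.mul ℂ X).flip b |>.integral_comp_comm
      (hα.integrable hφ.ker_integrable (e n))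
    simpa [tm, smear] using this.symm
  have h2 : Tendsto (fun n => tm α φ (e n) * b) atTop (𝓝 (∫ s, ker φ s • b)) := by
    simp only [h1]
    refine tendsto_integral_of_dominated_convergence (fun s => ‖ker φ s‖ * ‖b‖) (fun n => ?_)
      (hφ.ker_integrable.norm.mul_const _) (fun n => ae_of_all _ fun s => ?_)
      (ae_of_all _ fun s => ?_)
    · exact (hφ.ker_continuous.smul ((hα.continuous_orbit _).mul continuous_const)).aestronglyMeasurable
    · rw [norm_smul]
      gcongr
      refine (norm_mul_le _ _).trans ?_
      rw [hα.norm_map]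
      exact mul_le_of_le_one_left (norm_nonneg _) (he n).2
    · refine Tendsto.const_smul ?_ _
      have h3 := (hα.autL s).continuous.tendsto _ |>.comp (het (-s))
      have h4 : ((hα.autL s) ∘ fun n => e n * α (-s) b) = fun n => α s (e n) * b := by
        funext n
        simp [hα.autL_apply, hα.map_mul, hα.apply_neg]
      rw [h4, hα.autL_apply, hα.apply_neg] at h3
      exact h3
  rw [integral_smul_const, hk, one_smul] at h2
  refine isClosed_pr.mem_of_tendsto h2 (Eventually.of_forall fun n => mul_mem_pr ⟨?_, ?_⟩ hb)
  · exact hα.tm_mem hB.closed hi hφ (he n).1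
  · exact hα.tm_mem_spec hφ hφs _

lemma le_pr_unit (hα : IsCStarDynSys α) (hB : IsCS B) (hi : Invariant α (B : Set X)) {η : ℝ}
    (hη : 0 < η) (hS : S ≤ B) : S ≤ S ⊡ (B ⊓ hα.spec (Icc (-η) η)) := by
  have h1 : sst S ≤ B := hB.sst_eq ▸ sst_mono hS
  have := sst_mono (hα.le_unit_pr hB hi hη h1)
  have h2 : sst (B ⊓ hα.spec (Icc (-η) η)) = B ⊓ hα.spec (Icc (-η) η) := by
    change sst B ⊓ sst (hα.spec (Icc (-η) η)) = _
    rw [hB.sst_eq, hα.sst_spec_Icc, neg_neg]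
  rwa [sst_pr, sst_sst, h2] at this

end IsCStarDynSys

end

section

variable {α : ℝ → X → X} {f g φ ψ χ : ℝ → ℂ} {F G : Set ℝ} {x y : X}
  {S T R S' T' V B Y K W : Submodule ℂ X}

/-- Closed sum of two subspaces. -/
def sc (S T : Submodule ℂ X) : Submodule ℂ X := (S ⊔ T).topologicalClosure

infixl:65 " ⊹ " => sc

lemma isClosed_sc : IsClosed (S ⊹ T : Set X) := Submodule.isClosed_topologicalClosure _

lemma le_sc_left : S ≤ S ⊹ T := le_sup_left.trans (Submodule.le_topologicalClosure _)

lemma le_sc_right : T ≤ S ⊹ T := le_sup_right.trans (Submodule.le_topologicalClosure _)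

lemma sc_le (hV : IsClosed (V : Set X)) (h1 : S ≤ V) (h2 : T ≤ V) : S ⊹ T ≤ V :=
  Submodule.topologicalClosure_minimal _ (sup_le h1 h2) hV

lemma coe_sc : (S ⊹ T : Set X) = closure ((S : Set X) + (T : Set X)) := by
  rw [← Submodule.coe_sup]; rfl

lemma sc_pr_le (hV : IsClosed (V : Set X)) (h1 : S ⊡ R ≤ V) (h2 : T ⊡ R ≤ V) : (S ⊹ T) ⊡ R ≤ V := by
  have : S ⊹ T ≤ lmult R V := sc_le (isClosed_lmult hV)
    (fun s hs r hr => h1 (mul_mem_pr hs hr)) (fun s hs r hr => h2 (mul_mem_pr hs hr))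
  exact pr_le hV fun s hs r hr => this hs r hr

lemma pr_sc_le (hV : IsClosed (V : Set X)) (h1 : R ⊡ S ≤ V) (h2 : R ⊡ T ≤ V) : R ⊡ (S ⊹ T) ≤ V := by
  have : S ⊹ T ≤ rmult R V := sc_le (isClosed_rmult hV)
    (fun s hs r hr => h1 (mul_mem_pr hr hs)) (fun s hs r hr => h2 (mul_mem_pr hr hs))
  exact pr_le hV fun r hr s hs => this hs r hr

/-- Closed subalgebras. -/
structure IsAlg (B : Submodule ℂ X) : Prop where
  closed : IsClosed (B : Set X)
  pr_le : B ⊡ B ≤ B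

lemma IsAlg.sc (hS : IsAlg S) (hT : T ⊡ T ≤ S ⊹ T) (h1 : S ⊡ T ≤ S ⊹ T) (h2 : T ⊡ S ≤ S ⊹ T) :
    IsAlg (S ⊹ T) :=
  ⟨isClosed_sc, sc_pr_le isClosed_sc (pr_sc_le isClosed_sc (hS.pr_le.trans le_sc_left) h1)
    (pr_sc_le isClosed_sc h2 hT)⟩

lemma isAlg_lmult (hV : IsClosed (V : Set X)) : IsAlg (lmult V V) :=
  ⟨isClosed_lmult hV, pr_le (isClosed_lmult hV) fun s hs t ht v hv => by
    rw [mul_assoc]; exact hs _ (ht v hv)⟩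

lemma isAlg_rmult (hV : IsClosed (V : Set X)) : IsAlg (rmult V V) :=
  ⟨isClosed_rmult hV, pr_le (isClosed_rmult hV) fun s hs t ht v hv => by
    rw [← mul_assoc]; exact ht _ (hs v hv)⟩

/-- The closed two-sided ideal generated by a subspace. -/
def idl (S : Submodule ℂ X) : Submodule ℂ X := ⊤ ⊡ S ⊡ ⊤

lemma isId_idl (S : Submodule ℂ X) : IsId (idl S) := by
  refine ⟨isClosed_pr, fun x y hy => ?_, fun y hy x => ?_⟩
  · have h := mul_mem_pr (Submodule.mem_top : x ∈ (⊤ : Submodule ℂ X)) hy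
    rw [idl, ← pr_assoc, ← pr_assoc] at h
    exact pr_mono (pr_mono le_top le_rfl) le_rfl h
  · have h := mul_mem_pr hy (Submodule.mem_top : x ∈ (⊤ : Submodule ℂ X))
    rw [idl, pr_assoc] at h
    exact pr_mono le_rfl le_top h

lemma le_idl : S ≤ idl S := le_top_pr.trans le_pr_top

lemma idl_le (hK : IsId K) (h : S ≤ K) : idl S ≤ K :=
  (pr_mono (pr_mono le_rfl h) le_rfl).trans ((pr_mono hK.pr_le_left le_rfl).trans hK.pr_le_right)

lemma pr_bot : S ⊡ ⊥ = ⊥ := le_bot_iff.1 (pr_le isClosed_singleton fun s _ t ht => by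
  rw [(Submodule.mem_bot ℂ).1 ht, mul_zero]; exact zero_mem _)

lemma bot_pr : ⊥ ⊡ S = ⊥ := le_bot_iff.1 (pr_le isClosed_singleton fun s hs t _ => by
  rw [(Submodule.mem_bot ℂ).1 hs, zero_mul]; exact zero_mem _)

lemma IsCS.le_pr_right (hB : IsCS B) (h : S ≤ B) : S ≤ S ⊡ B := fun b hb => by
  obtain ⟨l, hl, h1, h2⟩ := hB.exists_unit
  refine isClosed_pr.mem_of_tendsto (h2 b (h hb)).2 ?_
  filter_upwards [h1] with e he
  exact mul_mem_pr hb he.1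

lemma IsCS.le_pr_left (hB : IsCS B) (h : S ≤ B) : S ≤ B ⊡ S := fun b hb => by
  obtain ⟨l, hl, h1, h2⟩ := hB.exists_unit
  refine isClosed_pr.mem_of_tendsto (h2 b (h hb)).1 ?_
  filter_upwards [h1] with e he
  exact mul_mem_pr he.1 hb

lemma sst_inf (S T : Submodule ℂ X) : sst (S ⊓ T) = sst S ⊓ sst T := rfl

lemma sst_top : sst (⊤ : Submodule ℂ X) = ⊤ := IsCS.top.sst_eq

lemma sst_le_iff : sst S ≤ T ↔ S ≤ sst T :=
  ⟨fun h => by simpa [sst_sst] using sst_mono h, fun h => by simpa [sst_sst] using sst_mono h⟩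

namespace IsCStarDynSys

lemma smear_mem_spec (hα : IsCStarDynSys α) (hf : Integrable f) (x : X) :
    smear α f x ∈ hα.spec (tsupport (fourierT f)) := fun φ hφ hd => by
  rw [tm, hα.smear_comm hφ.ker_integrable hf, ← tm, hα.smear_tm hf hφ]
  convert tm_zero x using 2
  funext γ
  by_contra h
  exact disjoint_left.1 hd (subset_tsupport _ (right_ne_zero_of_mul h))
    (subset_tsupport _ (left_ne_zero_of_mul h))

lemma pr_Ici_le (hα : IsCStarDynSys α) (a b : ℝ) :
    hα.spec (Ici a) ⊡ hα.spec (Ici b) ≤ hα.spec (Ici (a + b)) :=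
  pr_le (hα.isClosed_spec _) fun _ hs _ ht => hα.mul_mem_spec_Ici hs ht

lemma pr_Iic_le (hα : IsCStarDynSys α) (a b : ℝ) :
    hα.spec (Iic a) ⊡ hα.spec (Iic b) ≤ hα.spec (Iic (a + b)) :=
  pr_le (hα.isClosed_spec _) fun _ hs _ ht => hα.mul_mem_spec_Iic hs ht

lemma pr_Icc_le (hα : IsCStarDynSys α) (a b c d : ℝ) :
    hα.spec (Icc a b) ⊡ hα.spec (Icc c d) ≤ hα.spec (Icc (a + c) (b + d)) :=
  pr_le (hα.isClosed_spec _) fun _ hs _ ht => hα.mul_mem_spec_Icc hs ht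

lemma isAlg_Ici (hα : IsCStarDynSys α) : IsAlg (hα.spec (Ici 0)) :=
  ⟨hα.isClosed_spec _, by simpa using hα.pr_Ici_le 0 0⟩

lemma spec_univ (hα : IsCStarDynSys α) : hα.spec univ = ⊤ := by
  rw [eq_top_iff]; intro x _ φ hφ hd
  rw [disjoint_univ] at hd
  have : φ = fun _ => 0 := by
    funext γ; by_contra h
    exact (hd ▸ subset_tsupport φ h : γ ∈ (∅ : Set ℝ))
  rw [this, tm_zero]

lemma disj_eq_bot (hα : IsCStarDynSys α) (hF : IsClosed F) (hG : IsClosed G)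
    (hd : Disjoint F G) (h1 : S ≤ hα.spec F) (h2 : S ≤ hα.spec G) : S = ⊥ :=
  (Submodule.eq_bot_iff _).2 fun _ hx => hα.eq_zero_of_disjoint hF hG hd (h1 hx) (h2 hx)

lemma le_spec_inter (hα : IsCStarDynSys α) (hF : IsClosed F) (hG : IsClosed G)
    (h1 : S ≤ hα.spec F) (h2 : S ≤ hα.spec G) : S ≤ hα.spec (F ∩ G) :=
  fun _ hx => hα.mem_spec_inter hF hG (h1 hx) (h2 hx)

/-- Density of the elements with compact spectrum inside an invariant subspace. -/
lemma le_of_Icc (hα : IsCStarDynSys α) (hS : IsClosed (S : Set X)) (hSi : Invariant α (S : Set X))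
    (hF : IsClosed F) (hSF : S ≤ hα.spec F) (hV : IsClosed (V : Set X))
    (h : ∀ n : ℝ, 0 < n → S ⊓ hα.spec (Icc (-n) n ∩ F) ≤ V) : S ≤ V := fun x hx => by
  obtain ⟨φ, hφ, hφx⟩ := exists_approx x hα
  refine hV.mem_of_tendsto hφx (Eventually.of_forall fun n => ?_)
  obtain ⟨N, hN⟩ := hα.exists_Icc_of_tst (hφ n) (hSF hx) hF
  refine h (max N 1) (by positivity) ⟨hα.tm_mem hS hSi (hφ n) hx, hα.spec_mono ?_ hN⟩
  exact inter_subset_inter_left _ (Icc_subset_Icc (neg_le_neg (le_max_left _ _)) (le_max_left _ _))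

lemma le_of_Icc_top (hα : IsCStarDynSys α) (hV : IsClosed (V : Set X))
    (h : ∀ n : ℝ, 0 < n → hα.spec (Icc (-n) n) ≤ V) : ⊤ ≤ V :=
  hα.le_of_Icc isClosed_univ invariant_top isClosed_univ (by rw [hα.spec_univ]) hV
    fun n hn => by rw [inter_univ]; exact inf_le_right.trans (h n hn)

/-- If a closed invariant subspace has dense sum with `spec [c, ∞)`, it contains the
elements with spectrum strictly below `c`. -/
lemma spec_Iic_le_of_sc_eq_top (hα : IsCStarDynSys α) (hK : IsClosed (K : Set X))
    (hKi : Invariant α (K : Set X)) {c d : ℝ} (hcd : d < c) (h : K ⊹ hα.spec (Ici c) = ⊤) :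
    hα.spec (Iic d) ≤ K := by
  refine hα.le_of_Icc (hα.isClosed_spec _) (hα.invariant_spec _) isClosed_Iic le_rfl hK
    fun n hn => ?_
  rintro x ⟨-, hx⟩
  rcases le_or_gt (-n) d with hnd | hnd
  · obtain ⟨χ, hχ, hχ1, hχs⟩ := exists_plateau (a' := -n - 2) (a := -n - 1) (b := (c + d) / 2)
      (b' := (3 * c + d) / 4) (by linarith) (by linarith) (by linarith)
    have e : tm α χ x = x := by
      refine hα.tm_eq_self isOpen_Ioo hχ (fun γ hγ => hχ1 γ (Ioo_subset_Icc_self hγ)) ?_ hx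
      rintro z ⟨hz, hz2⟩
      simp only [mem_Icc, mem_Iic, mem_Ioo] at hz hz2 ⊢
      constructor <;> linarith
    have key : K ⊹ hα.spec (Ici c) ≤ K.comap (hα.tmL hχ : X →ₗ[ℂ] X) := by
      refine sc_le (hK.preimage (hα.tmL hχ).continuous) (fun z hz => hα.tm_mem hK hKi hχ hz)
        fun z hz => ?_
      change tm α χ z ∈ K
      rw [hz χ hχ (disjoint_left.2 fun γ h1 h2 => ?_)]
      · exact zero_mem _
      · have := (hχs h1).2
        have := mem_Ici.1 h2
        linarith
    rw [h] at key
    rw [← e]; exact key trivial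
  · rw [show Icc (-n) n ∩ Iic d = ∅ by ext z; simp; intro h1 _; linarith] at hx
    rw [hα.spec_empty hx]; exact zero_mem _

lemma eq_bot_of_le_Ici (hα : IsCStarDynSys α) (h : ∀ c : ℝ, S ≤ hα.spec (Ici c)) : S = ⊥ := by
  refine (Submodule.eq_bot_iff _).2 fun x hx => hα.eq_zero_of_tm fun φ hφ => ?_
  obtain ⟨N, hN⟩ := hφ.2.bddAbove_image (f := id) continuousOn_id |>.imp fun N hN => hN
  refine h (N + 1) hx φ hφ (disjoint_left.2 fun γ h1 h2 => ?_)
  have := hN ⟨γ, h1, rfl⟩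
  simp only [id, mem_Ici] at this h2; linarith

lemma mem_actSpec_iff (hα : IsCStarDynSys α) {γ : ℝ} : γ ∈ actSpec α (S : Set X) ↔
    ∀ ε > 0, S ⊓ hα.spec (Icc (γ - ε) (γ + ε)) ≠ ⊥ := by
  refine forall₂_congr fun ε _ => not_congr ?_
  rw [hα.specC_eq isClosed_Icc, ← Submodule.coe_inf, ← Submodule.bot_coe (R := ℂ),
    SetLike.coe_set_eq]

lemma isClosed_actSpec (hα : IsCStarDynSys α) : IsClosed (actSpec α (S : Set X)) := by
  refine isClosed_of_closure_subset fun γ hγ => hα.mem_actSpec_iff.2 fun ε hε => ?_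
  rw [Metric.mem_closure_iff] at hγ
  obtain ⟨γ', h1, h2⟩ := hγ (ε / 2) (by linarith)
  rw [Real.dist_eq, abs_lt] at h2
  have h3 := hα.mem_actSpec_iff.1 h1 (ε / 2) (by linarith)
  exact fun h => h3 (eq_bot_mono (inf_le_inf_left _ (hα.spec_mono
    (Icc_subset_Icc (by linarith) (by linarith)))) h)

end IsCStarDynSys

end

section

variable {α : ℝ → X → X} {f g φ ψ χ : ℝ → ℂ} {F G : Set ℝ} {x y : X}
  {S T R S' T' V B Y K W : Submodule ℂ X}

lemma IsSubalgebra.exists_eq {W : Set X} (h : IsSubalgebra W) :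
    ∃ S : Submodule ℂ X, (S : Set X) = W :=
  ⟨⟨⟨⟨W, fun ha hb => h.2.1 _ ha _ hb⟩, h.1⟩, fun c _ hx => h.2.2.1 c _ hx⟩, rfl⟩

lemma IsClosedTwoSidedIdealIn.exists_eq {A K : Set X} (h : IsClosedTwoSidedIdealIn A K) :
    ∃ S : Submodule ℂ X, (S : Set X) = K :=
  ⟨⟨⟨⟨K, fun ha hb => h.2.2.2.1 _ ha _ hb⟩, h.2.2.1⟩, fun c _ hx => h.2.2.2.2.1 c _ hx⟩, rfl⟩

lemma isClosedTwoSidedIdealIn_iff : IsClosedTwoSidedIdealIn (S : Set X) (K : Set X) ↔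
    K ≤ S ∧ IsClosed (K : Set X) ∧ S ⊡ K ≤ K ∧ K ⊡ S ≤ K := by
  constructor
  · rintro ⟨h1, h2, -, -, -, h3⟩
    exact ⟨h1, h2, pr_le h2 fun s hs k hk => (h3 s hs k hk).1,
      pr_le h2 fun k hk s hs => (h3 s hs k hk).2⟩
  · rintro ⟨h1, h2, h3, h4⟩
    exact ⟨h1, h2, zero_mem _, fun x hx y hy => add_mem hx hy, fun c x hx => K.smul_mem c hx,
      fun s hs k hk => ⟨h3 (mul_mem_pr hs hk), h4 (mul_mem_pr hk hs)⟩⟩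

lemma isId_iff : IsId K ↔ IsClosed (K : Set X) ∧ ⊤ ⊡ K ≤ K ∧ K ⊡ ⊤ ≤ K :=
  ⟨fun h => ⟨h.closed, h.pr_le_left, h.pr_le_right⟩, fun h => ⟨h.1, fun _ _ hy => h.2.1
    (mul_mem_pr Submodule.mem_top hy), fun _ hy _ => h.2.2 (mul_mem_pr hy Submodule.mem_top)⟩⟩

lemma isClosedTwoSidedIdealIn_univ_iff :
    IsClosedTwoSidedIdealIn (univ : Set X) (K : Set X) ↔ IsId K := by
  rw [← Submodule.top_coe (R := ℂ), isClosedTwoSidedIdealIn_iff, isId_iff]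
  simp

/-- A closed ideal of a C*-subalgebra which is absorbed by `T` is an ideal for `T`. -/
lemma IsCS.pr_le_of_pr_le (hB : IsCS B) (hK : K ≤ B) (hT : T ⊡ B ≤ B) (h : B ⊡ K ≤ K) :
    T ⊡ K ≤ K :=
  calc T ⊡ K ≤ T ⊡ (B ⊡ K) := pr_mono le_rfl (hB.le_pr_left hK)
    _ = T ⊡ B ⊡ K := (pr_assoc ..).symm
    _ ≤ B ⊡ K := pr_mono hT le_rfl
    _ ≤ K := h

lemma IsCS.pr_le_of_pr_le' (hB : IsCS B) (hK : K ≤ B) (hT : B ⊡ T ≤ B) (h : K ⊡ B ≤ K) :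
    K ⊡ T ≤ K :=
  calc K ⊡ T ≤ K ⊡ B ⊡ T := pr_mono (hB.le_pr_right hK) le_rfl
    _ = K ⊡ (B ⊡ T) := pr_assoc ..
    _ ≤ K ⊡ B := pr_mono le_rfl hT
    _ ≤ K := h

lemma alphaSimple_iff (hY : IsId Y) : AlphaSimple α (Y : Set X) ↔
    ∀ K : Submodule ℂ X, IsId K → K ≤ Y → Invariant α (K : Set X) → K = ⊥ ∨ K = Y := by
  constructor
  · intro h K hK hKY hi
    have := h K (isClosedTwoSidedIdealIn_iff.2 ⟨hKY, hK.closed, hK.pr_le_left, hK.pr_le_right⟩) hi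
    rwa [← Submodule.bot_coe (R := ℂ), SetLike.coe_set_eq, SetLike.coe_set_eq] at this
  · intro h K' hK' hi
    obtain ⟨K, rfl⟩ := hK'.exists_eq
    obtain ⟨h1, h2, h3, h4⟩ := isClosedTwoSidedIdealIn_iff.1 hK'
    have := h K (isId_iff.2 ⟨h2, hY.isCS.pr_le_of_pr_le h1 hY.pr_le_left h3,
      hY.isCS.pr_le_of_pr_le' h1 hY.pr_le_right h4⟩) h1 hi
    rwa [← Submodule.bot_coe (R := ℂ), SetLike.coe_set_eq, SetLike.coe_set_eq]

lemma isMaximalClosedSubalgebra_iff : IsMaximalClosedSubalgebra (S : Set X) ↔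
    IsAlg S ∧ S ≠ ⊤ ∧ ∀ W, IsAlg W → S ≤ W → W = S ∨ W = ⊤ := by
  have key : ∀ W : Submodule ℂ X, IsAlg W ↔ IsClosed (W : Set X) ∧ IsSubalgebra (W : Set X) :=
    fun W => ⟨fun h => ⟨h.1, zero_mem _, fun x hx y hy => add_mem hx hy,
      fun c x hx => W.smul_mem c hx, fun x hx y hy => h.2 (mul_mem_pr hx hy)⟩,
      fun h => ⟨h.1, pr_le h.1 fun x hx y hy => h.2.2.2.2 x hx y hy⟩⟩
  constructor
  · rintro ⟨h1, h2, h3, h4⟩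
    refine ⟨(key _).2 ⟨h1, h2⟩, fun h => h3 (by rw [h]; rfl), fun W hW hSW => ?_⟩
    have := h4 W ((key _).1 hW).1 ((key _).1 hW).2 hSW
    rwa [← Submodule.top_coe (R := ℂ), SetLike.coe_set_eq, SetLike.coe_set_eq] at this
  · rintro ⟨h1, h2, h3⟩
    obtain ⟨h4, h5⟩ := (key _).1 h1
    refine ⟨h4, h5, ?_, fun W' hc hW' hSW => ?_⟩
    · rwa [← Submodule.top_coe (R := ℂ), Ne, SetLike.coe_set_eq]
    · obtain ⟨W, rfl⟩ := hW'.exists_eq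
      have := h3 W ((key _).2 ⟨hc, hW'⟩) hSW
      rwa [← Submodule.top_coe (R := ℂ), SetLike.coe_set_eq, SetLike.coe_set_eq]

namespace IsCStarDynSys

/-- The closed span of the elements of `S` with strictly positive spectrum. -/
def pos (hα : IsCStarDynSys α) (S : Submodule ℂ X) : Submodule ℂ X :=
  cl {x | x ∈ S ∧ ∃ μ > 0, x ∈ hα.spec (Ici μ)}

lemma inf_spec_le_pos (hα : IsCStarDynSys α) {μ : ℝ} (hμ : 0 < μ) :
    S ⊓ hα.spec (Ici μ) ≤ hα.pos S := fun _ hx => subset_cl _ ⟨hx.1, μ, hμ, hx.2⟩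

lemma pos_le (hα : IsCStarDynSys α) (hV : IsClosed (V : Set X))
    (h : ∀ μ > 0, S ⊓ hα.spec (Ici μ) ≤ V) : hα.pos S ≤ V :=
  cl_le hV (by rintro _ ⟨hx, μ, hμ, hx'⟩; exact h μ hμ ⟨hx, hx'⟩)

lemma invariant_pos (hα : IsCStarDynSys α) (hS : Invariant α (S : Set X)) :
    Invariant α (hα.pos S : Set X) :=
  hα.invariant_cl (by rintro t x ⟨hx, μ, hμ, hx'⟩; exact ⟨hS t x hx, μ, hμ, hα.invariant_spec _ t x hx'⟩)

lemma exists_Ici_of_isCompact (hK : IsCompact F) (h : F ⊆ Ioi 0) : ∃ μ > 0, F ⊆ Ici μ := by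
  rcases F.eq_empty_or_nonempty with rfl | hne
  · exact ⟨1, one_pos, empty_subset _⟩
  · obtain ⟨m, hm, hm'⟩ := hK.exists_isLeast hne
    exact ⟨m, h hm, hm'⟩

lemma specO_Ioi (hα : IsCStarDynSys α) (hS : IsClosed (S : Set X)) (hSi : Invariant α (S : Set X)) :
    specO α (S : Set X) (Ioi 0) = (hα.pos S : Set X) := by
  rw [specO, ← coe_cl, SetLike.coe_set_eq]
  refine le_antisymm (cl_le (isClosed_cl _) ?_) (hα.pos_le (isClosed_cl _) fun μ hμ x hx => ?_)
  · rintro _ ⟨x, hx, f, hf, hc, hs, rfl⟩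
    obtain ⟨μ, hμ, h⟩ := exists_Ici_of_isCompact hc hs
    exact subset_cl _ ⟨hα.smear_mem hS hf fun t => hSi t x hx, μ, hμ, hα.spec_mono h (hα.smear_mem_spec hf x)⟩
  · obtain ⟨φ, hφ, hφx⟩ := exists_approx x hα
    refine (isClosed_cl _).mem_of_tendsto hφx (Eventually.of_forall fun n => ?_)
    obtain ⟨N, hN⟩ := hα.exists_Icc_of_tst (hφ n) hx.2 isClosed_Ici
    obtain ⟨χ, hχ, hχ1, hχs⟩ := exists_plateau (a' := μ / 3) (a := μ / 2) (b := max N μ + 1)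
      (b' := max N μ + 2) (by linarith) (by linarith [le_max_right N μ]) (by linarith)
    have e : tm α χ (tm α (φ n) x) = tm α (φ n) x := by
      refine hα.tm_eq_self isOpen_Ioo hχ (fun γ hγ => hχ1 γ (Ioo_subset_Icc_self hγ)) ?_ hN
      rintro z ⟨hz, hz2⟩
      simp only [mem_Icc, mem_Ici, mem_Ioo] at hz hz2 ⊢
      exact ⟨by linarith, by linarith [le_max_left N μ]⟩
    rw [← e]
    have e2 : fourierT (ker χ) = χ := funext hχ.fourierT_ker
    refine subset_cl _ ⟨_, hα.tm_mem hS hSi (hφ n) hx.1, ker χ, hχ.ker_integrable, ?_, ?_, rfl⟩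
    · rw [e2]; exact hχ.2
    · rw [e2]; exact hχs.trans fun z hz => lt_of_lt_of_le (by positivity) hz.1

lemma le_spec_actSpec (hα : IsCStarDynSys α) (hS : IsClosed (S : Set X))
    (hSi : Invariant α (S : Set X)) : S ≤ hα.spec (actSpec α (S : Set X)) := fun x hx => by
  rw [← SetLike.mem_coe, ← hα.specC_eq hα.isClosed_actSpec]
  intro γ hγ
  refine hα.mem_actSpec_iff.2 fun ε hε h => ?_
  obtain ⟨χ, hχ, hχ1, hχs⟩ := exists_plateau (a' := γ - ε) (a := γ) (b := γ)
      (b' := γ + ε) (by linarith) le_rfl (by linarith)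
  have h1 : tm α χ x ∈ S ⊓ hα.spec (Icc (γ - ε) (γ + ε)) :=
    ⟨hα.tm_mem hS hSi hχ hx, hα.tm_mem_spec hχ hχs x⟩
  rw [h, Submodule.mem_bot] at h1
  have := hγ _ hχ.ker_integrable h1
  rw [hχ.fourierT_ker, hχ1 γ (by simp)] at this
  exact one_ne_zero this

lemma exists_mem_actSpec (hα : IsCStarDynSys α) (hS : IsClosed (S : Set X))
    (hSi : Invariant α (S : Set X)) (hF : IsClosed F) (h : S ⊓ hα.spec F ≠ ⊥) :
    ∃ γ ∈ F, γ ∈ actSpec α (S : Set X) := by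
  by_contra! h1
  exact h (hα.disj_eq_bot hF hα.isClosed_actSpec (disjoint_left.2 h1) inf_le_right
    (inf_le_left.trans (hα.le_spec_actSpec hS hSi)))

lemma sst_eq_bot : sst S = ⊥ ↔ S = ⊥ := by
  simp only [Submodule.eq_bot_iff, mem_sst]
  exact ⟨fun h x hx => star_eq_zero.1 (h (star x) (by simpa using hx)),
    fun h x hx => star_eq_zero.1 (h _ hx)⟩

lemma neg_mem_actSpec (hα : IsCStarDynSys α) (hS : sst S = S) {γ : ℝ}
    (h : γ ∈ actSpec α (S : Set X)) : -γ ∈ actSpec α (S : Set X) := by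
  refine hα.mem_actSpec_iff.2 fun ε hε h1 => hα.mem_actSpec_iff.1 h ε hε ?_
  rw [← sst_eq_bot, sst_inf, hS, hα.sst_spec_Icc, ← h1]
  congr 3 <;> ring

lemma spec_inf_ne_bot_of_mem_actSpec (hα : IsCStarDynSys α) {γ : ℝ} {U : Set ℝ}
    (h : γ ∈ actSpec α (S : Set X)) (hU : U ∈ 𝓝 γ) : S ⊓ hα.spec U ≠ ⊥ := by
  obtain ⟨ε, hε, h1⟩ := Metric.nhds_basis_closedBall.mem_iff.1 hU
  rw [Real.closedBall_eq_Icc] at h1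
  exact fun h2 => hα.mem_actSpec_iff.1 h ε hε
    (eq_bot_mono (inf_le_inf_left _ (hα.spec_mono h1)) h2)

lemma top_le_spec_zero (hα : IsCStarDynSys α) (h : ∀ μ > 0, hα.spec (Ici μ) = ⊥) :
    ⊤ ≤ hα.spec {0} := by
  have h0 := hα.le_spec_actSpec (S := ⊤) isClosed_univ invariant_top
  have h1 : ∀ γ ∈ actSpec α ((⊤ : Submodule ℂ X) : Set X), γ ≤ 0 := fun γ hγ => by
    by_contra! hpos
    refine hα.spec_inf_ne_bot_of_mem_actSpec hγ (Ici_mem_nhds (half_lt_self hpos)) ?_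
    rw [h _ (by linarith), inf_bot_eq]
  refine h0.trans (hα.spec_mono fun γ hγ => le_antisymm (h1 γ hγ) ?_)
  have := h1 _ (hα.neg_mem_actSpec sst_top hγ)
  linarith

/-- `γ` is strongly in the spectrum of `B`. -/
def Str (hα : IsCStarDynSys α) (B : Submodule ℂ X) (γ : ℝ) : Prop :=
  ∀ ε > 0, B ≤ B ⊡ (B ⊓ hα.spec (Icc (γ - ε) (γ + ε)))

lemma mem_strongSpec_iff (hα : IsCStarDynSys α) (hB : IsCS B) {γ : ℝ} :
    γ ∈ strongSpec α (B : Set X) ↔ hα.Str B γ := by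
  refine forall₂_congr fun ε _ => ?_
  rw [hα.specC_eq isClosed_Icc, ← Submodule.coe_inf, ← coe_sst, ← coe_cl, cl_mulSet3,
    SetLike.coe_set_eq]
  set E := B ⊓ hα.spec (Icc (γ - ε) (γ + ε))
  have h1 : sst E ≤ B := hB.sst_eq ▸ sst_mono inf_le_left
  have hBB : B ⊡ B ≤ B := pr_le hB.closed fun x hx y hy => hB.mul_mem x hx y hy
  constructor
  · intro h
    exact h.ge.trans (pr_mono ((pr_mono h1 le_rfl).trans hBB) le_rfl)
  · intro h
    refine le_antisymm ((pr_mono ((pr_mono h1 le_rfl).trans hBB) inf_le_left).trans hBB) ?_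
    have h2 : B ≤ sst E ⊡ B := by simpa only [sst_pr, hB.sst_eq] using sst_mono h
    calc B ≤ B ⊡ E := h
      _ ≤ _ := pr_mono h2 le_rfl

lemma mem_connesSpec_iff (hα : IsCStarDynSys α) {γ : ℝ} :
    γ ∈ ConnesSpec α (Y : Set X) ↔ ∀ B : Submodule ℂ X, IsHereditaryIn (Y : Set X) (B : Set X) →
      B ≠ ⊥ → Invariant α (B : Set X) → hα.Str B γ := by
  simp only [ConnesSpec, mem_iInter, mem_ofPred_eq]
  constructor
  · intro h B h1 h2 h3
    rw [← hα.mem_strongSpec_iff h1.isCS]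
    exact h B ⟨h1, by rwa [← Submodule.bot_coe (R := ℂ), Ne, SetLike.coe_set_eq], h3⟩
  · rintro h B' ⟨h1, h2, h3⟩
    obtain ⟨B, rfl⟩ := h1.2.2.1.1.exists_eq
    rw [← Submodule.bot_coe (R := ℂ), Ne, SetLike.coe_set_eq] at h2
    exact (hα.mem_strongSpec_iff h1.isCS).2 (h B h1 h2 h3)

end IsCStarDynSys

end

section

variable {α : ℝ → X → X} {f g φ ψ χ : ℝ → ℂ} {x y : X} {S T V B Y K W : Submodule ℂ X}
  {H : Type*} [NormedAddCommGroup H] [InnerProductSpace ℂ H] {L : X →L[ℂ] H →L[ℂ] H}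
  {F : ℝ → Submodule ℂ H}

lemma IsCStarDynSys.spec_compl_le (hα : IsCStarDynSys α) {a b : ℝ} (hab : a < b) :
    hα.spec (univ \ Ioo a b) ≤ hα.spec (Iic a) ⊹ hα.spec (Ici b) := by
  refine hα.le_of_Icc (hα.isClosed_spec _) (hα.invariant_spec _)
    (isClosed_univ.sdiff isOpen_Ioo) le_rfl isClosed_sc fun n hn => ?_
  rintro z ⟨-, hz⟩
  obtain ⟨χ, hχ, hχ1, hχs⟩ := exists_plateau (a' := a + (b - a) / 4) (a := (a + b) / 2)
    (b := max n b + 1) (b' := max n b + 2) (by linarith) (by linarith [le_max_right n b])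
    (by linarith)
  have h1 : tm α χ z ∈ hα.spec (Ici b) := by
    refine hα.spec_mono ?_ (hα.mem_spec_inter (isClosed_Icc.inter (isClosed_univ.sdiff isOpen_Ioo))
      (isClosed_tsupport χ) (hα.tm_mem_spec_of_mem hχ hz) (hα.tm_mem_spec hχ le_rfl z))
    rintro γ ⟨⟨-, -, hγ⟩, hγ2⟩
    have h3 := (hχs hγ2).1
    by_contra h4
    exact hγ ⟨by linarith, not_le.1 h4⟩
  have h2 : z - tm α χ z ∈ hα.spec (Iic a) := by
    refine hα.spec_mono ?_ (hα.sub_tm_mem_spec isOpen_Ioo hχ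
      (fun γ hγ => hχ1 γ (Ioo_subset_Icc_self hγ)) hz)
    rintro γ ⟨⟨⟨-, h3⟩, -, hγ⟩, hγ2⟩
    by_contra h4
    rw [mem_Iic, not_le] at h4
    rw [mem_Ioo, not_and, not_lt] at hγ hγ2
    have h5 := hγ h4
    have h6 := hγ2 (by linarith)
    linarith [le_max_left n b]
  have := add_mem (le_sc_left h2) (le_sc_right (S := hα.spec (Iic a)) h1)
  rwa [sub_add_cancel] at this

/-- A scalar Bernstein-type estimate. -/
lemma Tst.norm_sub_le (hφ : Tst φ) {h : ℝ → ℂ} (hc : Continuous h) {M δ : ℝ} (hδ : 0 < δ)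
    (hM : ∀ s, ‖h s‖ ≤ M) (hh : ∀ t, h t = ∫ s, (δ * ker φ (δ * s)) * h (s + t)) (t : ℝ) :
    ‖h t - h 0‖ ≤ kmod φ (δ * t) * M := by
  have hM0 : 0 ≤ M := (norm_nonneg _).trans (hM 0)
  have e1 : ∀ t, h t = ∫ s, (δ * ker φ (δ * s - δ * t)) * h s := fun t => by
    rw [hh, ← integral_sub_right_eq_self _ t]
    simp only [sub_add_cancel, mul_sub]
  have i1 : ∀ t, Integrable fun s => (δ * ker φ (δ * s - δ * t)) * h s := fun t => by
    refine Integrable.mul_bdd (c := M) ?_ hc.aestronglyMeasurable (ae_of_all _ hM)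
    exact ((hφ.ker_integrable.comp_sub_right (δ * t)).comp_mul_left' hδ.ne').const_mul _
  have e : kmod φ (δ * t) = ∫ s, δ * ‖ker φ (δ * s - δ * t) - ker φ (δ * s)‖ := by
    rw [integral_const_mul, Measure.integral_comp_mul_left (fun s => ‖ker φ (s - δ * t) - ker φ s‖) δ,
      abs_of_pos (by positivity), smul_eq_mul, mul_inv_cancel_left₀ hδ.ne', kmod]
  rw [e1 t, e1 0, ← integral_sub (i1 t) (i1 0), e, ← integral_mul_const]
  refine norm_integral_le_of_norm_le ?_ (ae_of_all _ fun s => ?_)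
  · have h1 : Integrable fun s => ker φ (s - δ * t) - ker φ s :=
      (hφ.ker_integrable.comp_sub_right _).sub hφ.ker_integrable
    exact ((h1.comp_mul_left' hδ.ne').norm.const_mul δ).mul_const _
  · rw [← sub_mul, ← mul_sub, norm_mul, norm_mul, mul_zero, sub_zero, Complex.norm_real,
      Real.norm_of_nonneg hδ.le]
    gcongr
    exact hM s

/-- Pythagoras for modulated orthogonal sums. -/
lemma norm_sum_smul_of_orthogonal {v : ℕ → H} {c : ℕ → ℂ} (hc : ∀ i, ‖c i‖ = 1) {m : ℕ}
    (hv : ∀ i j, i < j → inner ℂ (v j) (v i) = 0) :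
    ‖∑ i ∈ Finset.range m, c i • v i‖ = ‖∑ i ∈ Finset.range m, v i‖ := by
  have key : ∀ d : ℕ → ℂ, (∀ i, ‖d i‖ = 1) → ‖∑ i ∈ Finset.range m, d i • v i‖ *
      ‖∑ i ∈ Finset.range m, d i • v i‖ = ∑ i ∈ Finset.range m, ‖v i‖ * ‖v i‖ := by
    intro d hd
    induction m with
    | zero => simp
    | succ m ih =>
      rw [Finset.sum_range_succ, Finset.sum_range_succ,
        norm_add_sq_eq_norm_sq_add_norm_sq_of_inner_eq_zero (𝕜 := ℂ), ih, norm_smul, hd, one_mul]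
      rw [sum_inner]
      refine Finset.sum_eq_zero fun i hi => ?_
      rw [inner_smul_left, inner_smul_right, ← inner_conj_symm, hv i m (Finset.mem_range.1 hi)]
      simp
  have h1 := key c hc
  have h2 := key 1 (by simp)
  simp only [Pi.one_apply, one_smul] at h2
  rw [← h2] at h1
  exact (mul_self_inj_of_nonneg (norm_nonneg _) (norm_nonneg _)).1 h1

/-- A filtration of a Hilbert space compatible with the spectral filtration of the action. -/
structure IsFilt (hα : IsCStarDynSys α) (L : X →L[ℂ] H →L[ℂ] H) (F : ℝ → Submodule ℂ H) : Prop where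
  mul : ∀ x y v, L (x * y) v = L x (L y v)
  adj : ∀ x v w, inner ℂ (L x v) w = inner ℂ v (L (star x) w)
  anti : Antitone F
  closed : ∀ s, IsClosed (F s : Set H)
  shift : ∀ a b, ∀ x ∈ hα.spec (Ici a), ∀ v ∈ F b, L x v ∈ F (a + b)

namespace IsFilt

variable {hα : IsCStarDynSys α}

lemma inner_eq_zero (hF : IsFilt hα L F) {p p' q q' a b : ℝ} (hab : a < b) (h1 : q' ≤ b + p)
    (h2 : p' ≤ q - a) {v w : H} (hv : v ∈ F p) (hv' : v ∈ (F p')ᗮ) (hw : w ∈ F q)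
    (hw' : w ∈ (F q')ᗮ) (hx : x ∈ hα.spec (univ \ Ioo a b)) : inner ℂ w (L x v) = 0 := by
  let ℓ : X →L[ℂ] ℂ := (innerSL ℂ w).comp ((ContinuousLinearMap.apply ℂ H v).comp L)
  have hℓ : ∀ x, ℓ x = inner ℂ w (L x v) := fun x => rfl
  have : hα.spec (univ \ Ioo a b) ≤ LinearMap.ker (ℓ : X →ₗ[ℂ] ℂ) := by
    refine (hα.spec_compl_le hab).trans (sc_le ?_ (fun z hz => ?_) fun z hz => ?_)
    · exact isClosed_singleton.preimage ℓ.continuous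
    · change ℓ z = 0
      rw [hℓ, ← inner_conj_symm, hF.adj, ← inner_conj_symm, Complex.conj_conj]
      exact hv' _ (hF.anti (by linarith) (hF.shift _ _ _ (hα.star_mem_spec_Iic hz) _ hw))
    · change ℓ z = 0
      rw [hℓ, ← inner_conj_symm, hw' _ (hF.anti h1 (hF.shift _ _ _ hz _ hv)), _root_.map_zero]
  exact this hx

lemma bernstein (hF : IsFilt hα L F) (hφ : Tst φ) (hφ1 : ∀ γ ∈ Icc (-1) 1, φ γ = 1)
    {δ : ℝ} (hδ : 0 < δ) {ι κ : Type} (J : Finset ι) (K : Finset κ) {p : ι → ℝ} {q : κ → ℝ}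
    {v : ι → H} {w : κ → H}
    (hv : ∀ i, v i ∈ F (p i)) (hv' : ∀ i, v i ∈ (F (p i + δ))ᗮ)
    (hw : ∀ i, w i ∈ F (q i)) (hw' : ∀ i, w i ∈ (F (q i + δ))ᗮ) {C D : ℝ}
    (hC : ∀ s : ℝ, ‖∑ i ∈ J, Complex.exp (-(Complex.I * p i * s)) • v i‖ ≤ C)
    (hD : ∀ s : ℝ, ‖∑ i ∈ K, Complex.exp (-(Complex.I * q i * s)) • w i‖ ≤ D) (x : X) (t : ℝ) :
    ‖inner ℂ (∑ i ∈ K, w i) (L (α t x) (∑ i ∈ J, v i)) -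
      inner ℂ (∑ i ∈ K, Complex.exp (-(Complex.I * q i * (-t : ℝ))) • w i)
        (L x (∑ i ∈ J, Complex.exp (-(Complex.I * p i * (-t : ℝ))) • v i))‖ ≤
      kmod φ (δ * t) * (‖L‖ * ‖x‖ * C * D) := by
  set h : ℝ → ℂ := fun s =>
    inner ℂ (∑ i ∈ K, Complex.exp (-(Complex.I * q i * (s - t : ℝ))) • w i)
        (L (α s x) (∑ i ∈ J, Complex.exp (-(Complex.I * p i * (s - t : ℝ))) • v i)) with hh
  have e0 : h 0 = inner ℂ (∑ i ∈ K, Complex.exp (-(Complex.I * q i * (-t : ℝ))) • w i)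
        (L x (∑ i ∈ J, Complex.exp (-(Complex.I * p i * (-t : ℝ))) • v i)) := by
    simp only [hh, zero_sub, hα.map_zero_time]
  have et : h t = inner ℂ (∑ i ∈ K, w i) (L (α t x) (∑ i ∈ J, v i)) := by
    simp [hh]
  have hsum : ∀ s, h s = ∑ i ∈ J, ∑ k ∈ K, Complex.exp (Complex.I * (q k - p i : ℝ) * (s - t : ℝ)) *
      inner ℂ (w k) (L (α s x) (v i)) := fun s => by
    simp only [hh, map_sum, map_smul, inner_sum, sum_inner, inner_smul_left, inner_smul_right]
    refine Finset.sum_congr rfl fun i _ => ?_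
    rw [Finset.mul_sum]
    refine Finset.sum_congr rfl fun k _ => ?_
    rw [← mul_assoc, ← Complex.exp_conj, ← Complex.exp_add]
    congr 2
    simp
    ring
  rw [← et, ← e0]
  refine hφ.norm_sub_le ?_ hδ (fun s => ?_) (fun r => ?_) t
  · have := hα.continuous_orbit x
    simp only [hh]
    fun_prop
  · refine (norm_inner_le_norm _ _).trans ?_
    have h1 := (L (α s x)).le_opNorm (∑ i ∈ J, Complex.exp (-(Complex.I * p i * (s - t : ℝ))) • v i)
    have h2 := L.le_opNorm (α s x)
    rw [hα.norm_map] at h2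
    have hC0 := (norm_nonneg _).trans (hC 0)
    have hD0 := (norm_nonneg _).trans (hD 0)
    calc _ ≤ D * (‖L‖ * ‖x‖ * C) := by
          gcongr
          · exact hD _
          · refine h1.trans ?_
            gcongr
            exact hC _
      _ = _ := by ring
  · have key : ∀ i k, inner ℂ (w k) (L (α r x) (v i)) = ∫ s, (δ * ker φ (δ * s)) *
        (Complex.exp (Complex.I * (q k - p i : ℝ) * s) * inner ℂ (w k) (L (α (s + r) x) (v i))) := by
      intro i k
      have hV : Tst (fun γ => φ (δ⁻¹ * γ + -(δ⁻¹ * (q k - p i)))) :=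
        hφ.comp_affine (inv_ne_zero hδ.ne') _
      have h1 : α r x - tm α (fun γ => φ (δ⁻¹ * γ + -(δ⁻¹ * (q k - p i)))) (α r x) ∈
          hα.spec (univ \ Ioo (q k - p i - δ) (q k - p i + δ)) := by
        refine hα.sub_tm_mem_spec isOpen_Ioo hV (fun γ hγ => hφ1 _ ?_) ?_
        · rw [← mul_neg, ← mul_add, mem_Icc, inv_mul_le_iff₀ hδ, le_inv_mul_iff₀ hδ]
          constructor <;> linarith [hγ.1, hγ.2]
        · rw [hα.spec_univ]; trivial
      have h2 := hF.inner_eq_zero (by linarith) (by linarith) (by linarith) (hv i) (hv' i) (hw k)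
        (hw' k) h1
      rw [_root_.map_sub, _root_.sub_apply, inner_sub_right, sub_eq_zero] at h2
      rw [h2, tm, smear]
      let ℓ : X →L[ℂ] ℂ := (innerSL ℂ (w k)).comp ((ContinuousLinearMap.apply ℂ H (v i)).comp L)
      change ℓ _ = _
      rw [← ℓ.integral_comp_comm (hα.integrable hV.ker_integrable _)]
      congr 1; ext s
      rw [map_smul, ker_mul_exp_dilate φ hδ, ← hα.map_add_time, smul_eq_mul]
      change _ * inner ℂ (w k) (L (α (s + r) x) (v i)) = _
      ring
    have hi : ∀ i k, Integrable fun s => (δ * ker φ (δ * s)) *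
        (Complex.exp (Complex.I * (q k - p i : ℝ) * (s + r - t : ℝ)) *
          inner ℂ (w k) (L (α (s + r) x) (v i))) := by
      intro i k
      refine Integrable.mul_bdd (c := ‖w k‖ * (‖L‖ * ‖x‖ * ‖v i‖)) ?_ ?_ (ae_of_all _ fun s => ?_)
      · exact (hφ.ker_integrable.comp_mul_left' hδ.ne').const_mul _
      · have := hα.continuous_orbit x
        exact Continuous.aestronglyMeasurable (by fun_prop)
      · rw [norm_mul, show Complex.I * (q k - p i : ℝ) * (s + r - t : ℝ) =
          ((q k - p i) * (s + r - t) : ℝ) * Complex.I by push_cast; ring,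
          Complex.norm_exp_ofReal_mul_I, one_mul]
        refine (norm_inner_le_norm _ _).trans ?_
        gcongr
        refine ((L _).le_opNorm _).trans ?_
        gcongr
        rw [← hα.norm_map (s + r) x]
        exact L.le_opNorm _
    simp only [hsum, Finset.mul_sum]
    rw [integral_finsetSum _ fun i _ => integrable_finsetSum _ fun k _ => hi i k]
    refine Finset.sum_congr rfl fun i _ => ?_
    rw [integral_finsetSum _ fun k _ => hi i k]
    refine Finset.sum_congr rfl fun k _ => ?_
    rw [key, ← integral_const_mul]
    congr 1; ext s
    rw [show Complex.I * (q k - p i : ℝ) * (s + r - t : ℝ) = Complex.I * (q k - p i : ℝ) * (r - t : ℝ) +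
      Complex.I * (q k - p i : ℝ) * s by push_cast; ring, Complex.exp_add]
    ring

end IsFilt

end

section

variable {α : ℝ → X → X} {f g φ ψ χ : ℝ → ℂ} {x y : X} {S T V B Y K W : Submodule ℂ X}
  {H : Type*} [NormedAddCommGroup H] [InnerProductSpace ℂ H] {L : X →L[ℂ] H →L[ℂ] H}
  {F : ℝ → Submodule ℂ H}

lemma exists_blocks (hF : Antitone F) [∀ s, (F s).HasOrthogonalProjection] {a δ : ℝ} (hδ : 0 ≤ δ)
    {m : ℕ} {ξ : H} (h1 : ξ ∈ F a) (h2 : ξ ∈ (F (a + m * δ))ᗮ) : ∃ v : ℕ → H,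
    (∀ i : ℕ, v i ∈ F (a + i * δ)) ∧ (∀ i : ℕ, v i ∈ (F (a + i * δ + δ))ᗮ) ∧
      ∑ i ∈ Finset.range m, v i = ξ := by
  have h3 : ∀ i : ℕ, F (a + (i + 1 : ℕ) * δ) ≤ F (a + i * δ) := fun i => hF (by push_cast; linarith)
  refine ⟨fun i => (F (a + i * δ)).starProjection ξ - (F (a + (i + 1 : ℕ) * δ)).starProjection ξ,
    fun i => ?_, fun i => ?_, ?_⟩
  · exact sub_mem (Submodule.starProjection_apply_mem _ _)
      (h3 i (Submodule.starProjection_apply_mem _ _))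
  · rw [show a + i * δ + δ = a + (i + 1 : ℕ) * δ by push_cast; ring]
    have := sub_mem ((F (a + (i + 1 : ℕ) * δ)).sub_starProjection_mem_orthogonal ξ)
      (Submodule.orthogonal_le (h3 i) ((F (a + i * δ)).sub_starProjection_mem_orthogonal ξ))
    simpa using this
  · rw [Finset.sum_range_sub' (fun i : ℕ => (F (a + i * δ)).starProjection ξ)]
    rw [(Submodule.starProjection_apply_eq_zero_iff _).2 h2, sub_zero]
    simpa [Submodule.starProjection_eq_self_iff] using h1

lemma inner_blocks (hF : Antitone F) {a δ : ℝ} (hδ : 0 ≤ δ) {v : ℕ → H}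
    (h1 : ∀ i : ℕ, v i ∈ F (a + i * δ)) (h2 : ∀ i : ℕ, v i ∈ (F (a + i * δ + δ))ᗮ) (i j : ℕ)
    (hij : i < j) : inner ℂ (v j) (v i) = 0 := by
  refine h2 i _ (hF ?_ (h1 j))
  have : (i : ℝ) + 1 ≤ j := by exact_mod_cast hij
  nlinarith

namespace IsFilt

variable {hα : IsCStarDynSys α} [∀ s, (F s).HasOrthogonalProjection]

lemma inner_map_eq_zero (hF : IsFilt hα L F) (hx : ∀ v ∈ F 0, L x v ∈ F 0) {R : ℝ} (hR : 0 ≤ R)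
    {ξ η : H} (h1 : ξ ∈ F 0) (h2 : ξ ∈ (F R)ᗮ) (h3 : η ∈ F (-R)) (h4 : η ∈ (F 0)ᗮ) (t : ℝ) :
    inner ℂ η (L (α t x) ξ) = 0 := by
  obtain ⟨φ, hφ, hφ1, -⟩ := exists_plateau (a' := -2) (a := -1) (b := 1) (b' := 2)
    (by norm_num) (by norm_num) (by norm_num)
  rcases hR.eq_or_lt with rfl | hR
  · rw [neg_zero] at h3
    rw [inner_self_eq_zero.1 (h4 η h3), inner_zero_left]
  have key : ∀ m : ℕ, ‖inner ℂ η (L (α t x) ξ)‖ ≤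
      kmod φ (R / (m + 1 : ℕ) * t) * (‖L‖ * ‖x‖ * ‖ξ‖ * ‖η‖) := by
    intro m
    have hδ : 0 < R / (m + 1 : ℕ) := by positivity
    have e : (m + 1 : ℕ) * (R / (m + 1 : ℕ)) = R := by field_simp
    obtain ⟨v, hv, hv', rfl⟩ := exists_blocks (m := m + 1) (a := 0) hF.anti hδ.le h1
      (by rwa [e, zero_add])
    obtain ⟨w, hw, hw', rfl⟩ := exists_blocks (m := m + 1) (a := -R) hF.anti hδ.le h3
      (by rwa [e, neg_add_cancel])
    have hnorm : ∀ p s : ℝ, ‖Complex.exp (-(Complex.I * p * s))‖ = 1 := fun p s => by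
      rw [show -(Complex.I * p * s) = (-(p * s) : ℝ) * Complex.I by push_cast; ring,
        Complex.norm_exp_ofReal_mul_I]
    have := hF.bernstein hφ hφ1 hδ (Finset.range (m + 1)) (Finset.range (m + 1)) hv hv' hw hw'
      (fun s => (norm_sum_smul_of_orthogonal (c := fun i =>
        Complex.exp (-(Complex.I * (0 + i * (R / (m + 1 : ℕ)) : ℝ) * s)))
        (fun i => hnorm _ _) (inner_blocks hF.anti hδ.le hv hv')).le)
      (fun s => (norm_sum_smul_of_orthogonal (c := fun i =>
        Complex.exp (-(Complex.I * (-R + i * (R / (m + 1 : ℕ)) : ℝ) * s)))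
        (fun i => hnorm _ _) (inner_blocks hF.anti hδ.le hw hw')).le) x t
    refine le_trans (le_of_eq ?_) this
    have h0 : ∀ u ∈ F 0, ∀ w ∈ (F 0)ᗮ, ∀ b : ℂ, b = b - inner ℂ w (L x u) := fun u hu w hw b => by
      rw [Submodule.inner_left_of_mem_orthogonal (hx u hu) hw, sub_zero]
    refine congrArg norm (h0 _ ?_ _ ?_ _)
    · refine sum_mem fun i hi => Submodule.smul_mem _ _ (hF.anti ?_ (hv i))
      positivity
    · refine sum_mem fun i hi => Submodule.smul_mem _ _ (Submodule.orthogonal_le (hF.anti ?_) (hw' i))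
      have h5 : (i + 1 : ℝ) ≤ (m + 1 : ℕ) := by exact_mod_cast Finset.mem_range.1 hi
      have h6 := mul_le_mul_of_nonneg_right h5 hδ.le
      rw [e] at h6
      linarith
  have lim : Tendsto (fun m : ℕ => kmod φ (R / (m + 1 : ℕ) * t) * (‖L‖ * ‖x‖ * ‖ξ‖ * ‖η‖)) atTop
      (𝓝 (0 * (‖L‖ * ‖x‖ * ‖ξ‖ * ‖η‖))) := by
    refine (hφ.kmod_tendsto.comp ?_).mul_const _
    have := (((tendsto_const_div_atTop_nhds_zero_nat R).comp (tendsto_add_atTop_nat 1)).mul_const t)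
    simpa using this
  rw [zero_mul] at lim
  exact norm_le_zero_iff.1 (ge_of_tendsto' lim key)

/-- Elements preserving the base of a compatible filtration form an invariant set. -/
theorem map_mem [CompleteSpace H] (hF : IsFilt hα L F) (hx : ∀ v ∈ F 0, L x v ∈ F 0) (t : ℝ) :
    ∀ v ∈ F 0, L (α t x) v ∈ F 0 := by
  intro ξ hξ
  rw [← (F 0).orthogonal_orthogonal]
  intro η hη
  set y := α t x
  have hclosed : ∀ (G : Submodule ℂ H) (v : H), IsClosed (G : Set H) →
      (∀ n > 0, ∀ z ∈ hα.spec (Ici (-n)), L z v ∈ G) → L y v ∈ G := fun G v hG h => by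
    let ℓ : X →L[ℂ] H := (ContinuousLinearMap.apply ℂ H v).comp L
    have : ⊤ ≤ G.comap (ℓ : X →ₗ[ℂ] H) := hα.le_of_Icc_top (hG.preimage ℓ.continuous)
      fun n hn z hz => h n hn z (hα.spec_mono Icc_subset_Ici_self hz)
    exact this Submodule.mem_top
  have hanti : ∀ R : ℕ, F R ≤ F 0 := fun R => hF.anti (by positivity)
  have hanti' : ∀ R : ℕ, F 0 ≤ F (-R) := fun R => hF.anti (by simp)
  have hmon : Monotone fun R : ℕ => (F R)ᗮ := fun a b hab =>
    Submodule.orthogonal_le (hF.anti (by exact_mod_cast hab))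
  have hmon' : Monotone fun R : ℕ => F (-R) := fun a b hab => hF.anti (by simpa using hab)
  set Q := (⨆ R : ℕ, (F R)ᗮ).topologicalClosure
  set Q' := (⨆ R : ℕ, F (-R)).topologicalClosure
  have : CompleteSpace Q := (Submodule.isClosed_topologicalClosure _).completeSpace_coe
  have : CompleteSpace Q' := (Submodule.isClosed_topologicalClosure _).completeSpace_coe
  have t1 := Submodule.starProjection_tendsto_closure_iSup (fun R : ℕ => (F R)ᗮ) hmon ξ
  have t2 := Submodule.starProjection_tendsto_closure_iSup (fun R : ℕ => F (-R)) hmon' η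
  have z1 : ∀ R : ℕ, inner ℂ ((F (-R)).starProjection η) (L y ((F R)ᗮ.starProjection ξ)) = 0 := by
    intro R
    refine hF.inner_map_eq_zero hx (Nat.cast_nonneg R) ?_ (Submodule.starProjection_apply_mem _ _)
      (Submodule.starProjection_apply_mem _ _) ?_ t
    · rw [Submodule.starProjection_orthogonal_val]
      exact sub_mem hξ (hanti R (Submodule.starProjection_apply_mem _ _))
    · have := sub_mem hη (Submodule.orthogonal_le (hanti' R)
        ((F (-R)).sub_starProjection_mem_orthogonal η))
      simpa using this
  have z2 : inner ℂ (Q'.starProjection η) (L y (Q.starProjection ξ)) = 0 := by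
    have lim := t2.inner (𝕜 := ℂ) (((L y).continuous.tendsto _).comp t1)
    exact tendsto_nhds_unique lim (by simp only [Function.comp_def, z1]; exact tendsto_const_nhds)
  have z3 : inner ℂ (Q'.starProjection η) (L y (ξ - Q.starProjection ξ)) = 0 := by
    have h1 : ∀ R : ℕ, ξ - Q.starProjection ξ ∈ F R := fun R => by
      rw [← (F R).orthogonal_orthogonal]
      exact Submodule.orthogonal_le ((le_iSup (fun R : ℕ => (F R)ᗮ) R).trans
        (Submodule.le_topologicalClosure _)) (Q.sub_starProjection_mem_orthogonal ξ)
    have h2 : L y (ξ - Q.starProjection ξ) ∈ F 0 := hclosed _ _ (hF.closed 0) fun n hn z hz => by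
      obtain ⟨N, hN⟩ := exists_nat_ge n
      exact hF.anti (by linarith) (hF.shift _ _ _ hz _ (h1 N))
    have h3 : ∀ R : ℕ, inner ℂ ((F (-R)).starProjection η) (L y (ξ - Q.starProjection ξ)) = 0 := by
      intro R
      rw [Submodule.inner_starProjection_left_eq_right,
        Submodule.starProjection_eq_self_iff.2 (hanti' R h2)]
      exact Submodule.inner_left_of_mem_orthogonal h2 hη
    have lim := t2.inner (𝕜 := ℂ) (tendsto_const_nhds (x := L y (ξ - Q.starProjection ξ)))
    exact tendsto_nhds_unique lim (by simp only [h3]; exact tendsto_const_nhds)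
  have z4 : inner ℂ (η - Q'.starProjection η) (L y ξ) = 0 := by
    have h1 : L y ξ ∈ Q' := hclosed _ _ (Submodule.isClosed_topologicalClosure _) fun n hn z hz => by
      obtain ⟨N, hN⟩ := exists_nat_ge n
      refine Submodule.le_topologicalClosure _ ((le_iSup (fun R : ℕ => F (-R)) N) ?_)
      exact hF.anti (by linarith) (hF.shift _ _ _ hz _ hξ)
    exact Submodule.inner_left_of_mem_orthogonal h1 (Q'.sub_starProjection_mem_orthogonal η)
  have e1 := add_eq_zero_iff_eq_neg.2 (by rw [z2, z3, neg_zero] :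
    inner ℂ (Q'.starProjection η) (L y (Q.starProjection ξ)) =
      -inner ℂ (Q'.starProjection η) (L y (ξ - Q.starProjection ξ)))
  rw [← inner_add_right, ← map_add, add_sub_cancel] at e1
  rw [inner_sub_left, e1, sub_zero] at z4
  exact z4

end IsFilt

end

section

/-- The cone used to dominate a bounded functional by a positive one. -/
def domCone (φ : X →L[ℂ] ℂ) : Set (X × ℝ) :=
  {p | 0 ≤ p.1 ∧ 0 ≤ p.2 ∧ ∃ z, star z * z ≤ p.2 • p.1 ∧ φ z = p.2}

lemma zero_mem_domCone (φ : X →L[ℂ] ℂ) : (0, 0) ∈ domCone φ :=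
  ⟨le_rfl, le_rfl, 0, by simp, by simp⟩

lemma star_mul_self_mem_domCone (φ : X →L[ℂ] ℂ) (x : X) :
    (star x * x, ‖φ x‖ ^ 2) ∈ domCone φ := by
  refine ⟨star_mul_self_nonneg x, by positivity, (starRingEnd ℂ (φ x)) • x, ?_, ?_⟩
  · refine le_of_eq ?_
    rw [star_smul, smul_mul_smul_comm, ← Complex.coe_smul]
    congr 1
    push_cast
    rw [Complex.star_def, Complex.conj_conj, Complex.mul_conj']
  · rw [map_smul, smul_eq_mul, mul_comm, Complex.mul_conj']
    push_cast; rfl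

lemma add_mem_domCone {φ : X →L[ℂ] ℂ} {p q : X × ℝ} (hp : p ∈ domCone φ) (hq : q ∈ domCone φ) :
    p + q ∈ domCone φ := by
  let _ := cstarInst X
  obtain ⟨hs, hr, z, hz, hφz⟩ := hp
  obtain ⟨hs', hr', w, hw, hφw⟩ := hq
  have zero : ∀ v : X, star v * v ≤ 0 → v = 0 := fun v hv =>
    CStarRing.star_mul_self_eq_zero_iff v |>.1 (le_antisymm hv (star_mul_self_nonneg v))
  have cross : star z * w + star w * z ≤ q.2 • p.1 + p.2 • q.1 := by
    have hnn : 0 ≤ q.2 • p.1 + p.2 • q.1 := add_nonneg (smul_nonneg hr' hs) (smul_nonneg hr hs')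
    rcases hr.eq_or_lt with h0 | hr0
    · rw [zero z (by simpa [← h0] using hz)]; simpa using hnn
    rcases hr'.eq_or_lt with h0 | hr0'
    · rw [zero w (by simpa [← h0] using hw)]; simpa using hnn
    have h1 := star_mul_self_nonneg (q.2 • z - p.2 • w)
    have e : star (q.2 • z - p.2 • w) * (q.2 • z - p.2 • w) =
        (q.2 * q.2) • (star z * z) + (p.2 * p.2) • (star w * w) -
          (p.2 * q.2) • (star z * w + star w * z) := by
      simp only [star_sub, star_smul, star_trivial, sub_mul, mul_sub, smul_mul_smul_comm, smul_add]
      rw [mul_comm q.2 p.2]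
      abel
    rw [e, sub_nonneg] at h1
    have h2 : (p.2 * q.2) • (star z * w + star w * z) ≤
        (p.2 * q.2) • (q.2 • p.1 + p.2 • q.1) := by
      refine h1.trans ?_
      rw [smul_add, smul_smul, smul_smul, show p.2 * q.2 * q.2 = q.2 * q.2 * p.2 by ring,
        show p.2 * q.2 * p.2 = p.2 * p.2 * q.2 by ring, mul_smul (q.2 * q.2) p.2, mul_smul (p.2 * p.2) q.2]
      exact add_le_add (smul_le_smul_of_nonneg_left hz (mul_nonneg hr' hr'))
        (smul_le_smul_of_nonneg_left hw (mul_nonneg hr hr))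
    exact (smul_le_smul_iff_of_pos_left (mul_pos hr0 hr0')).1 h2
  refine ⟨add_nonneg hs hs', add_nonneg hr hr', z + w, ?_, by simp [hφz, hφw]⟩
  have e : star (z + w) * (z + w) = star z * z + star w * w + (star z * w + star w * z) := by
    simp only [star_add, add_mul, mul_add]; abel
  rw [e]
  refine (add_le_add (add_le_add hz hw) cross).trans (le_of_eq ?_)
  simp only [Prod.snd_add, Prod.fst_add, add_smul, smul_add]
  abel

lemma smul_mem_domCone {φ : X →L[ℂ] ℂ} {p : X × ℝ} (hp : p ∈ domCone φ) {c : ℝ} (hc : 0 ≤ c) :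
    c • p ∈ domCone φ := by
  let _ := cstarInst X
  obtain ⟨hs, hr, z, hz, hφz⟩ := hp
  refine ⟨smul_nonneg hc hs, smul_nonneg hc hr, c • z, ?_, ?_⟩
  · rw [star_smul, star_trivial, smul_mul_smul_comm, Prod.smul_fst, Prod.smul_snd, smul_eq_mul,
      smul_smul, show c * p.2 * c = (c * c) * p.2 by ring, mul_smul _ p.2]
    exact smul_le_smul_of_nonneg_left hz (mul_nonneg hc hc)
  · rw [← Complex.coe_smul, map_smul, hφz]
    simp

lemma snd_le_of_mem_domCone {φ : X →L[ℂ] ℂ} {p : X × ℝ} (hp : p ∈ domCone φ) :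
    p.2 ≤ ‖φ‖ ^ 2 * ‖p.1‖ := by
  let _ := cstarInst X
  obtain ⟨hs, hr, z, hz, hφz⟩ := hp
  rcases hr.eq_or_lt with h0 | hr0
  · rw [← h0]; positivity
  have h1 : ‖star z * z‖ ≤ ‖p.2 • p.1‖ :=
    CStarAlgebra.norm_le_norm_of_nonneg_of_le (star_mul_self_nonneg z) hz
  rw [CStarRing.norm_star_mul_self, norm_smul, Real.norm_of_nonneg hr] at h1
  have h2 := φ.le_opNorm z
  rw [hφz, Complex.norm_real, Real.norm_of_nonneg hr] at h2
  have h3 : p.2 * p.2 ≤ p.2 * (‖φ‖ ^ 2 * ‖p.1‖) := by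
    have h4 := mul_le_mul h2 h2 hr (by positivity)
    have h5 := mul_le_mul_of_nonneg_left h1 (sq_nonneg ‖φ‖)
    nlinarith
  exact le_of_mul_le_mul_left h3 hr0

section

open scoped ComplexOrder

/-- A bounded functional on a C*-algebra is dominated by a positive one. -/
lemma exists_positive_dominating (φ : X →L[ℂ] ℂ) :
    let _ := cstarInst X
    ∃ ψ : X →ₚ[ℂ] ℂ, ∀ x, ‖φ x‖ ^ 2 ≤ (ψ (star x * x)).re := by
  intro _
  set C : ℝ := ‖φ‖ ^ 2
  have hC : 0 ≤ C := by positivity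
  have : Nonempty (domCone φ) := ⟨⟨_, zero_mem_domCone φ⟩⟩
  let N : X → ℝ := fun a => ⨅ p : domCone φ, (C * ‖a + p.1.1‖ - p.1.2)
  have low : ∀ a, ∀ p ∈ domCone φ, -(C * ‖a‖) ≤ C * ‖a + p.1‖ - p.2 := fun a p hp => by
    have h1 := snd_le_of_mem_domCone hp
    have h2 : ‖p.1‖ ≤ ‖a + p.1‖ + ‖a‖ := by
      simpa using norm_sub_le (a + p.1) a
    have h3 := mul_le_mul_of_nonneg_left h2 hC
    linarith
  have bdd : ∀ a, BddBelow (range fun p : domCone φ => C * ‖a + p.1.1‖ - p.1.2) := fun a =>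
    ⟨-(C * ‖a‖), by rintro _ ⟨p, rfl⟩; exact low a p.1 p.2⟩
  have Nle : ∀ a, ∀ p ∈ domCone φ, N a ≤ C * ‖a + p.1‖ - p.2 := fun a p hp =>
    ciInf_le (bdd a) ⟨p, hp⟩
  have hN1 : ∀ c : ℝ, 0 < c → ∀ a, N (c • a) = c * N a := by
    have h : ∀ c : ℝ, 0 < c → ∀ a, N (c • a) ≤ c * N a := fun c hc a => by
      rw [← div_le_iff₀' hc]
      refine le_ciInf fun p => ?_
      rw [div_le_iff₀' hc]
      refine (Nle _ _ (smul_mem_domCone p.2 hc.le)).trans (le_of_eq ?_)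
      rw [Prod.smul_fst, Prod.smul_snd, ← smul_add, norm_smul, Real.norm_of_nonneg hc.le, smul_eq_mul]
      ring
    intro c hc a
    refine le_antisymm (h c hc a) ?_
    have := h c⁻¹ (inv_pos.2 hc) (c • a)
    rw [inv_smul_smul₀ hc.ne'] at this
    rwa [← le_inv_mul_iff₀ hc]
  have hN2 : ∀ a b, N (a + b) ≤ N a + N b := fun a b => by
    refine le_ciInf_add_ciInf fun p q => ?_
    refine (Nle _ _ (add_mem_domCone p.2 q.2)).trans ?_
    have h1 : ‖a + b + (p.1 + q.1).1‖ ≤ ‖a + p.1.1‖ + ‖b + q.1.1‖ := by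
      rw [Prod.fst_add, add_add_add_comm]; exact norm_add_le _ _
    have h2 := mul_le_mul_of_nonneg_left h1 hC
    rw [Prod.snd_add]
    linarith
  obtain ⟨g, -, hg⟩ := exists_extension_of_le_sublinear (⟨⊥, 0⟩ : X →ₗ.[ℝ] ℝ) N hN1 hN2 (by
    rintro ⟨x, hx⟩
    obtain rfl : x = 0 := by simpa using hx
    refine le_ciInf fun p => ?_
    simpa using low 0 p.1 p.2)
  have hg1 : ∀ x, ‖φ x‖ ^ 2 ≤ g (star x * x) := fun x => by
    have h1 := (hg (-(star x * x))).trans (Nle _ _ (star_mul_self_mem_domCone φ x))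
    rw [map_neg] at h1
    simp only [neg_add_cancel, norm_zero, mul_zero, zero_sub] at h1
    linarith
  let h : Module.Dual ℝ X :=
    { toFun := fun a => g ((1 / 2 : ℝ) • (a + star a))
      map_add' := fun a b => by rw [← map_add, ← smul_add, star_add]; congr 2; abel
      map_smul' := fun c a => by
        rw [star_smul, star_trivial, ← smul_add, smul_comm, map_smul, RingHom.id_apply] }
  let ψ₀ : X →ₗ[ℂ] ℂ := h.extendRCLike
  have hψ : ∀ a, IsSelfAdjoint a → ψ₀ a = g a := fun a ha => by
    have h1 : h a = g a := by
      change g ((1 / 2 : ℝ) • (a + star a)) = g a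
      rw [ha.star_eq, ← two_smul ℝ a, smul_smul]; norm_num
    have h2 : h (Complex.I • a) = 0 := by
      change g ((1 / 2 : ℝ) • (Complex.I • a + star (Complex.I • a))) = 0
      rw [star_smul, ha.star_eq, Complex.star_def, Complex.conj_I, neg_smul, add_neg_cancel,
        smul_zero, map_zero]
    simp [ψ₀, Module.Dual.extendRCLike_apply, h1, h2]
  refine ⟨PositiveLinearMap.mk₀ ψ₀ fun a ha => ?_, fun x => ?_⟩
  · obtain ⟨y, hy⟩ := CStarAlgebra.nonneg_iff_eq_star_mul_self.1 ha
    rw [hy, hψ _ (.star_mul_self y)]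
    exact_mod_cast (sq_nonneg _).trans (hg1 y)
  · change _ ≤ (ψ₀ (star x * x)).re
    rw [hψ _ (.star_mul_self x), Complex.ofReal_re]
    exact hg1 x

end

end

section

variable {α : ℝ → X → X} {x y : X} {S T V B Y K W : Submodule ℂ X}

section

open scoped ComplexOrder

/-- The GNS representation dominating a bounded functional. -/
lemma exists_rep.{u} {X : Type u} [NonUnitalNormedRing X] [StarRing X] [CStarRing X]
    [NormedSpace ℂ X] [IsScalarTower ℂ X X] [SMulCommClass ℂ X X] [StarModule ℂ X]
    [CompleteSpace X] [PartialOrder X] [StarOrderedRing X] (φ : X →L[ℂ] ℂ) : ∃ (H : Type u) (_ : NormedAddCommGroup H)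
    (_ : InnerProductSpace ℂ H) (_ : CompleteSpace H) (L : X →L[ℂ] H →L[ℂ] H) (Λ : X →L[ℂ] H),
    (∀ x y v, L (x * y) v = L x (L y v)) ∧
    (∀ x v w, inner ℂ (L x v) w = inner ℂ v (L (star x) w)) ∧
    (∀ x y, L x (Λ y) = Λ (x * y)) ∧ ∀ x, ‖φ x‖ ≤ ‖Λ x‖ := by
  let _ := cstarInst X
  obtain ⟨ψ, hψ⟩ := exists_positive_dominating φ
  obtain ⟨C, hC⟩ := ψ.exists_norm_apply_le
  have hnorm : ∀ x : X, ‖((ψ.toPreGNS x : ψ.PreGNS) : ψ.GNS)‖ ^ 2 = (ψ (star x * x)).re := fun x => by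
    rw [UniformSpace.Completion.norm_coe, ← Complex.ofReal_re (‖ψ.toPreGNS x‖ ^ 2)]
    congr 1
    rw [Complex.ofReal_pow, ψ.preGNS_norm_sq]
    rfl
  let Λ₀ : X →ₗ[ℂ] ψ.GNS :=
    (UniformSpace.Completion.toComplL (𝕜 := ℂ) (E := ψ.PreGNS)).toLinearMap.comp ψ.toPreGNS.toLinearMap
  have hΛ₀ : ∀ x, Λ₀ x = ((ψ.toPreGNS x : ψ.PreGNS) : ψ.GNS) := fun x => rfl
  let Λ : X →L[ℂ] ψ.GNS := Λ₀.mkContinuous (Real.sqrt C) fun x => by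
    rw [hΛ₀, ← sq_le_sq₀ (by positivity) (by positivity), hnorm, mul_pow, Real.sq_sqrt C.coe_nonneg]
    refine (Complex.re_le_norm _).trans ((hC _).trans (le_of_eq ?_))
    rw [CStarRing.norm_star_mul_self, sq]
  let L : X →L[ℂ] ψ.GNS →L[ℂ] ψ.GNS :=
    LinearMap.mkContinuous
      { toFun := ψ.gnsNonUnitalStarAlgHom
        map_add' := _root_.map_add _
        map_smul' := fun c x => by rw [map_smul]; rfl } 1 fun x => by
      rw [one_mul]
      exact NonUnitalStarAlgHom.norm_apply_le ψ.gnsNonUnitalStarAlgHom x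
  have hL : ∀ x, L x = ψ.gnsNonUnitalStarAlgHom x := fun x => rfl
  refine ⟨ψ.GNS, inferInstance, inferInstance, inferInstance, L, Λ, fun x y v => ?_,
    fun x v w => ?_, fun x y => ?_, fun x => ?_⟩
  · rw [hL, hL, hL, map_mul]; rfl
  · rw [hL, hL, map_star, ContinuousLinearMap.star_eq_adjoint, ContinuousLinearMap.adjoint_inner_right]
  · change ψ.gnsNonUnitalStarAlgHom x ((ψ.toPreGNS y : ψ.PreGNS) : ψ.GNS) = _
    rw [PositiveLinearMap.gnsNonUnitalStarAlgHom_apply_coe]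
    rfl
  · rw [← sq_le_sq₀ (norm_nonneg _) (norm_nonneg _)]
    exact (hψ x).trans (hnorm x).ge

end

namespace IsCStarDynSys

/-- The filtration of `X` generated by a left module over the analytic subalgebra. -/
def filt (hα : IsCStarDynSys α) (W : Submodule ℂ X) (s : ℝ) : Submodule ℂ X :=
  open Classical in if s = 0 then W else hα.spec (Ici s) ⊡ W

lemma filt_zero (hα : IsCStarDynSys α) : hα.filt W 0 = W := if_pos rfl

lemma le_filt (hα : IsCStarDynSys α) (hW : hα.spec (Ici 0) ⊡ W ≤ W) (s : ℝ) :
    hα.spec (Ici s) ⊡ W ≤ hα.filt W s := by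
  unfold filt
  split_ifs with h
  · rwa [h]
  · exact le_rfl

lemma filt_antitone (hα : IsCStarDynSys α) (hW : hα.spec (Ici 0) ⊡ W ≤ W) :
    Antitone (hα.filt W) := by
  intro s t hst
  rcases hst.eq_or_lt with rfl | hst
  · exact le_rfl
  have h1 : hα.filt W t ≤ hα.spec (Ici s) ⊡ W := by
    unfold filt
    split_ifs with h
    · refine (hα.le_unit_pr IsCS.top invariant_top (neg_pos.2 (h ▸ hst)) le_top).trans
        (pr_mono (inf_le_right.trans (hα.spec_mono fun γ hγ => ?_)) le_rfl)
      simpa using hγ.1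
    · exact pr_mono (hα.spec_mono (Ici_subset_Ici.2 hst.le)) le_rfl
  exact h1.trans (hα.le_filt hW s)

lemma pr_filt_le (hα : IsCStarDynSys α) (hW : hα.spec (Ici 0) ⊡ W ≤ W) (a b : ℝ) :
    hα.spec (Ici a) ⊡ hα.filt W b ≤ hα.filt W (a + b) := by
  by_cases h : b = 0
  · subst h
    rw [filt_zero, add_zero]
    exact hα.le_filt hW a
  · rw [filt, if_neg h, ← pr_assoc]
    exact (pr_mono (hα.pr_Ici_le a b) le_rfl).trans (hα.le_filt hW _)

/-- The stabiliser, in a suitable representation, of a closed left module over the analytic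
subalgebra is invariant under the action. -/
theorem exists_invariant_stabilizer (hα : IsCStarDynSys α) (hW : IsAlg W)
    (hA : hα.spec (Ici 0) ≤ W) (hy : y ∉ W) : ∃ T V : Submodule ℂ X, IsAlg T ∧
      Invariant α (T : Set X) ∧ W ≤ T ∧ IsClosed (V : Set X) ∧ T ⊡ W ≤ V ∧ y ∉ V := by
  have hAW : hα.spec (Ici 0) ⊡ W ≤ W := (pr_mono hA le_rfl).trans hW.pr_le
  obtain ⟨φ, hφ, hφW⟩ : ∃ φ : X →L[ℂ] ℂ, φ y ≠ 0 ∧ ∀ w ∈ W, φ w = 0 := by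
    have := hW.closed
    have hne : (W.mkQL y : X ⧸ W) ≠ 0 := fun h => hy ((Submodule.Quotient.mk_eq_zero W).1 h)
    obtain ⟨g, hg⟩ := SeparatingDual.exists_ne_zero (R := ℂ) hne
    refine ⟨g.comp W.mkQL, hg, fun w hw => ?_⟩
    have : (W.mkQL w : X ⧸ W) = 0 := (Submodule.Quotient.mk_eq_zero W).2 hw
    rw [ContinuousLinearMap.comp_apply, this, _root_.map_zero]
  obtain ⟨H, _, _, _, L, Λ, hmul, hadj, hΛ, hdom⟩ := exists_rep φ
  let F : ℝ → Submodule ℂ H := fun s => ((hα.filt W s).map (Λ : X →ₗ[ℂ] H)).topologicalClosure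
  have hF : IsFilt hα L F :=
    { mul := hmul
      adj := hadj
      anti := fun s t hst => Submodule.topologicalClosure_mono
        (Submodule.map_mono (hα.filt_antitone hAW hst))
      closed := fun s => Submodule.isClosed_topologicalClosure _
      shift := fun a b x hx v hv => by
        have : F b ≤ (F (a + b)).comap (L x : H →ₗ[ℂ] H) := by
          refine Submodule.topologicalClosure_minimal _ ?_
            ((Submodule.isClosed_topologicalClosure _).preimage (L x).continuous)
          rintro _ ⟨z, hz, rfl⟩
          refine Submodule.le_topologicalClosure _ ⟨x * z, ?_, (hΛ x z).symm⟩
          exact hα.pr_filt_le hAW a b (mul_mem_pr hx hz)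
        exact this hv }
  have hF0 : F 0 = (W.map (Λ : X →ₗ[ℂ] H)).topologicalClosure := by
    simp only [F, filt_zero]
  have : ∀ s, (F s).HasOrthogonalProjection := fun s => by
    have : CompleteSpace (F s) := (hF.closed s).completeSpace_coe
    infer_instance
  have hmem : ∀ w ∈ W, Λ w ∈ F 0 := fun w hw => by
    rw [hF0]; exact Submodule.le_topologicalClosure _ ⟨w, hw, rfl⟩
  let T : Submodule ℂ X :=
    { carrier := {x | ∀ v ∈ F 0, L x v ∈ F 0}
      add_mem' := fun {a b} ha hb v hv => by
        rw [_root_.map_add]; exact add_mem (ha v hv) (hb v hv)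
      zero_mem' := fun v hv => by rw [_root_.map_zero]; exact zero_mem _
      smul_mem' := fun c a ha v hv => by rw [map_smul]; exact Submodule.smul_mem _ _ (ha v hv) }
  have hTc : IsClosed (T : Set X) := by
    have : (T : Set X) = ⋂ v ∈ F 0, {x | L x v ∈ F 0} := by ext; simp [T]
    rw [this]
    exact isClosed_biInter fun v _ => (hF.closed 0).preimage
      ((ContinuousLinearMap.apply ℂ H v).comp L).continuous
  refine ⟨T, (F 0).comap (Λ : X →ₗ[ℂ] H), ⟨hTc, pr_le hTc fun a ha b hb v hv => ?_⟩,
    fun t x hx => hF.map_mem hx t, fun w hw v hv => ?_, (hF.closed 0).preimage Λ.continuous,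
    pr_le ((hF.closed 0).preimage Λ.continuous) fun a ha w hw => ?_, fun hyV => hφ ?_⟩
  · rw [hmul]; exact ha _ (hb v hv)
  · have : F 0 ≤ (F 0).comap (L w : H →ₗ[ℂ] H) := by
      nth_rewrite 1 [hF0]
      refine Submodule.topologicalClosure_minimal _ ?_ ((hF.closed 0).preimage (L w).continuous)
      rintro _ ⟨z, hz, rfl⟩
      change L w (Λ z) ∈ F 0
      rw [hΛ]
      exact hmem _ (hW.pr_le (mul_mem_pr hw hz))
    exact this hv
  · change Λ (a * w) ∈ F 0
    rw [← hΛ]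
    exact ha _ (hmem w hw)
  · change Λ y ∈ F 0 at hyV
    rw [hF0, ← SetLike.mem_coe, Submodule.topologicalClosure_coe, Metric.mem_closure_iff] at hyV
    refine norm_le_zero_iff.1 (le_of_forall_pos_le_add fun ε hε => ?_)
    obtain ⟨_, ⟨w, hw, rfl⟩, h⟩ := hyV ε hε
    have h1 := hdom (y - w)
    rw [_root_.map_sub, _root_.map_sub, hφW w hw, sub_zero, ← dist_eq_norm] at h1
    rw [zero_add]
    exact h1.trans h.le

end IsCStarDynSys

end

section

variable {α : ℝ → X → X} {x y : X} {S T V B Y K W E : Submodule ℂ X} {φ χ : ℝ → ℂ}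

namespace IsCStarDynSys

lemma inf_Ici_le_of_tm_mem (hα : IsCStarDynSys α) (hS : IsClosed (S : Set X))
    (hSi : Invariant α (S : Set X)) (hV : IsClosed (V : Set X)) {c s : ℝ} (hcs : c < s)
    (h : ∀ χ, Tst χ → (∀ γ ∈ tsupport χ, c < γ) → ∀ x ∈ S, tm α χ x ∈ V) :
    S ⊓ hα.spec (Ici s) ≤ V := by
  refine hα.le_of_Icc (F := Ici s) (by exact hS.inter (hα.isClosed_spec _))
    (invariant_inf hSi (hα.invariant_spec _)) isClosed_Ici inf_le_right hV fun n hn => ?_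
  rintro x ⟨⟨hxS, -⟩, hx⟩
  obtain ⟨χ, hχ, hχ1, hχs⟩ := exists_plateau (a' := (3 * c + s) / 4) (a := (c + s) / 2)
    (b := max n s + 1) (b' := max n s + 2) (by linarith) (by linarith [le_max_right n s]) (by linarith)
  have e : tm α χ x = x := by
    refine hα.tm_eq_self isOpen_Ioo hχ (fun γ hγ => hχ1 γ (Ioo_subset_Icc_self hγ)) ?_ hx
    rintro z ⟨hz, hz2⟩
    simp only [mem_Icc, mem_Ici, mem_Ioo] at hz hz2 ⊢
    constructor <;> linarith [le_max_left n s]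
  rw [← e]
  exact h χ hχ (fun γ hγ => lt_of_lt_of_le (by linarith) (hχs hγ).1) x hxS

lemma tm_mem_of_split (hα : IsCStarDynSys α) (hY : IsClosed (Y : Set X))
    (hYi : Invariant α (Y : Set X)) (hV : IsClosed (V : Set X)) (hVi : Invariant α (V : Set X))
    {c p q : ℝ} (hpq : p < q) (hχ : Tst χ) (hχs : ∀ γ ∈ tsupport χ, c < γ) {f : X → X}
    (hf : Continuous f) (hadd : ∀ u v, f (u + v) = f u + f v)
    (h1 : ∀ z ∈ hα.spec (Iic q), f z ∈ hα.spec (Iic c))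
    (h2 : ∀ z ∈ Y ⊓ hα.spec (Ici p), f z ∈ V) (hy : y ∈ Y) : tm α χ (f y) ∈ V := by
  obtain ⟨φ, hφ, hφy⟩ := exists_approx y hα
  refine hV.mem_of_tendsto
    (((((hα.tmL hχ).continuous.comp hf).tendsto y).comp hφy)) (Eventually.of_forall fun n => ?_)
  have hz := hα.tm_mem hY hYi (hφ n) hy
  obtain ⟨N, hN⟩ := hα.exists_Icc_of_tst (hφ n) (F := univ) (x := y)
    (by rw [hα.spec_univ]; trivial) isClosed_univ
  obtain ⟨ψ, hψ, h3, h4⟩ := hα.exists_split hpq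
    (hα.spec_mono (fun γ hγ => hγ.1.1 : Icc (-N) N ∩ univ ⊆ Ici (-N)) hN)
  have hz1 := hα.tm_mem hY hYi hψ hz
  change hα.tmL hχ (f (tm α (φ n) y)) ∈ V
  generalize tm α (φ n) y = z at *
  have e : z = tm α ψ z + (z - tm α ψ z) := by abel
  rw [e, hadd, _root_.map_add]
  refine V.add_mem ?_ (hα.tm_mem hV hVi hχ (h2 _ ⟨Y.sub_mem hz hz1, h4⟩))
  have := h1 _ (hα.spec_mono (fun γ hγ => hγ.2 : Icc (-N) q ⊆ Iic q) h3) χ hχ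
    (disjoint_left.2 fun γ h5 h6 => absurd (hχs γ h5) (not_lt.2 h6))
  rw [hα.tmL_apply hχ, this]
  exact zero_mem _

lemma pr_inf_Ici_le (hα : IsCStarDynSys α) (hSi : Invariant α (S : Set X)) {a p s : ℝ}
    (hS : S ≤ hα.spec (Iic a)) (hY : IsClosed (Y : Set X)) (hYi : Invariant α (Y : Set X))
    (h : a + p < s) : (S ⊡ Y) ⊓ hα.spec (Ici s) ≤ S ⊡ (Y ⊓ hα.spec (Ici p)) := by
  have hVi := hα.invariant_pr hSi (invariant_inf hYi (hα.invariant_spec (Ici p)))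
  refine hα.inf_Ici_le_of_tm_mem isClosed_pr (hα.invariant_pr hSi hYi) isClosed_pr
    (c := (a + p + s) / 2) (by linarith) fun χ hχ hχs x hx => ?_
  have : S ⊡ Y ≤ (S ⊡ (Y ⊓ hα.spec (Ici p))).comap (hα.tmL hχ : X →ₗ[ℂ] X) := by
    refine pr_le (isClosed_pr.preimage (hα.tmL hχ).continuous) fun u hu y hy => ?_
    refine hα.tm_mem_of_split (p := p) (q := (p + s - a) / 2) hY hYi isClosed_pr hVi (by linarith)
      hχ hχs (f := fun z => u * z) (by fun_prop) (fun _ _ => mul_add _ _ _) (fun z hz => ?_)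
      (fun z hz => mul_mem_pr hu hz) hy
    have := hα.mul_mem_spec_Iic (hS hu) hz
    convert this using 3; ring
  exact this hx

lemma pr_inf_Ici_le' (hα : IsCStarDynSys α) (hSi : Invariant α (S : Set X)) {a p s : ℝ}
    (hS : S ≤ hα.spec (Iic a)) (hY : IsClosed (Y : Set X)) (hYi : Invariant α (Y : Set X))
    (h : a + p < s) : (Y ⊡ S) ⊓ hα.spec (Ici s) ≤ (Y ⊓ hα.spec (Ici p)) ⊡ S := by
  have hVi := hα.invariant_pr (invariant_inf hYi (hα.invariant_spec (Ici p))) hSi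
  refine hα.inf_Ici_le_of_tm_mem isClosed_pr (hα.invariant_pr hYi hSi) isClosed_pr
    (c := (a + p + s) / 2) (by linarith) fun χ hχ hχs x hx => ?_
  have : Y ⊡ S ≤ ((Y ⊓ hα.spec (Ici p)) ⊡ S).comap (hα.tmL hχ : X →ₗ[ℂ] X) := by
    refine pr_le (isClosed_pr.preimage (hα.tmL hχ).continuous) fun y hy u hu => ?_
    refine hα.tm_mem_of_split (p := p) (q := (p + s - a) / 2) hY hYi isClosed_pr hVi (by linarith)
      hχ hχs (f := fun z => z * u) (by fun_prop) (fun _ _ => add_mul _ _ _) (fun z hz => ?_)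
      (fun z hz => mul_mem_pr hz hu) hy
    have := hα.mul_mem_spec_Iic hz (hS hu)
    convert this using 3; ring
  exact this hx

lemma exists_pow_left (hα : IsCStarDynSys α) {a b : ℝ} (hE : E ≤ hα.spec (Icc a b))
    (hEi : Invariant α (E : Set X)) (hB : B ≤ E ⊡ B) (n : ℕ) :
    ∃ P : Submodule ℂ X, Invariant α (P : Set X) ∧
      P ≤ hα.spec (Icc ((n + 1) * a) ((n + 1) * b)) ∧ B ≤ P ⊡ B ∧ ∀ T, IsAlg T → E ≤ T → P ≤ T := by
  induction n with
  | zero => exact ⟨E, hEi, by simpa using hE, hB, fun T _ h => h⟩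
  | succ n ih =>
    obtain ⟨P, hPi, hP, hPB, hPT⟩ := ih
    refine ⟨P ⊡ E, hα.invariant_pr hPi hEi, ?_, ?_, fun T hT h => (pr_mono (hPT T hT h) h).trans hT.pr_le⟩
    · refine ((pr_mono hP hE).trans (hα.pr_Icc_le _ _ _ _)).trans (hα.spec_mono (le_of_eq ?_))
      push_cast; congr 1 <;> ring
    · rw [pr_assoc]
      exact hPB.trans (pr_mono le_rfl hB)

lemma exists_pow_right (hα : IsCStarDynSys α) {a b : ℝ} (hE : E ≤ hα.spec (Icc a b))
    (hEi : Invariant α (E : Set X)) (hB : B ≤ B ⊡ E) (n : ℕ) :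
    ∃ P : Submodule ℂ X, Invariant α (P : Set X) ∧
      P ≤ hα.spec (Icc ((n + 1) * a) ((n + 1) * b)) ∧ B ≤ B ⊡ P ∧ ∀ T, IsAlg T → E ≤ T → P ≤ T := by
  induction n with
  | zero => exact ⟨E, hEi, by simpa using hE, hB, fun T _ h => h⟩
  | succ n ih =>
    obtain ⟨P, hPi, hP, hPB, hPT⟩ := ih
    refine ⟨E ⊡ P, hα.invariant_pr hEi hPi, ?_, ?_, fun T hT h => (pr_mono h (hPT T hT h)).trans hT.pr_le⟩
    · refine ((pr_mono hE hP).trans (hα.pr_Icc_le _ _ _ _)).trans (hα.spec_mono (le_of_eq ?_))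
      push_cast; congr 1 <;> ring
    · rw [← pr_assoc]
      exact hPB.trans (pr_mono hB le_rfl)

end IsCStarDynSys

end

section

variable {α : ℝ → X → X} {x y : X} {S T V B Y K W E C : Submodule ℂ X} {φ χ : ℝ → ℂ}

lemma IsAlg.pr_le_of_le (hT : IsAlg T) (h1 : S ≤ T) (h2 : V ≤ T) : S ⊡ V ≤ T :=
  (pr_mono h1 h2).trans hT.pr_le

lemma le_lmult (h : S ⊡ T ≤ V) : S ≤ lmult T V := fun _ hx _ hs => h (mul_mem_pr hx hs)

lemma le_rmult (h : S ⊡ T ≤ V) : T ≤ rmult S V := fun _ hx _ hs => h (mul_mem_pr hs hx)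

lemma pr_le_of_le_lmult (hV : IsClosed (V : Set X)) (h : S ≤ lmult T V) : S ⊡ T ≤ V :=
  pr_le hV fun _ hs _ ht => h hs _ ht

lemma pr_le_of_le_rmult (hV : IsClosed (V : Set X)) (h : T ≤ rmult S V) : S ⊡ T ≤ V :=
  pr_le hV fun _ hs _ ht => h ht _ hs

lemma eq_bot_of_sst_pr_self (h : sst S ⊡ S = ⊥) : S = ⊥ :=
  (Submodule.eq_bot_iff _).2 fun x hx => by
    have := mul_mem_pr (star_mem_sst hx) hx
    rw [h, Submodule.mem_bot] at this
    exact CStarRing.star_mul_self_eq_zero_iff x |>.1 this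

lemma IsHereditaryIn.self (hY : IsId Y) : IsHereditaryIn (Y : Set X) (Y : Set X) :=
  ⟨le_rfl, hY.closed, ⟨⟨Y.zero_mem, fun _ h _ h' => Y.add_mem h h', fun c _ h => Y.smul_mem c h,
    fun _ _ _ h' => hY.mul_left _ _ h'⟩, hY.isCS.star_mem⟩, fun _ h _ _ _ _ => h⟩

namespace IsCStarDynSys

lemma sst_inf_Icc (hα : IsCStarDynSys α) (hB : sst B = B) (a b : ℝ) :
    sst (B ⊓ hα.spec (Icc a b)) = B ⊓ hα.spec (Icc (-b) (-a)) := by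
  rw [sst_inf, hB, hα.sst_spec_Icc]

lemma sst_Str (hα : IsCStarDynSys α) (hB : sst B = B) {γ : ℝ} (h : hα.Str B γ) {ε : ℝ} (hε : 0 < ε) :
    B ≤ (B ⊓ hα.spec (Icc (-γ - ε) (-γ + ε))) ⊡ B := by
  have := sst_mono (h ε hε)
  rw [sst_pr, hB, hα.sst_inf_Icc hB] at this
  convert this using 5 <;> ring

/-- An algebra containing the analytic subalgebra and sufficiently many elements with
strictly negative spectrum of a hereditary subalgebra contains the ideal it generates. -/
lemma idl_le_of_strong (hα : IsCStarDynSys α) (hT : IsAlg T) (hA : hα.spec (Ici 0) ≤ T)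
    (hB : IsCS B) (hBi : Invariant α (B : Set X)) {κ ε : ℝ} (hε : 0 < ε) (hεκ : ε < κ)
    (h1 : hα.Str B κ) (h2 : hα.Str B (-κ)) (hE : B ⊓ hα.spec (Icc (-κ - ε) (-κ + ε)) ≤ T) :
    idl B ≤ T := by
  have hBs := hB.sst_eq
  have hnat : ∀ n : ℝ, ∃ k : ℕ, n < (k + 1) * (κ - ε) := fun n => by
    obtain ⟨k, hk⟩ := exists_nat_gt (n / (κ - ε))
    rw [div_lt_iff₀ (by linarith)] at hk
    exact ⟨k, by nlinarith⟩
  have hBT : B ≤ T := by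
    refine hα.le_of_Icc hB.closed hBi isClosed_univ (by rw [hα.spec_univ]; exact le_top) hT.closed
      fun n hn => ?_
    obtain ⟨k, hk⟩ := hnat n
    obtain ⟨P, hPi, hP, hPB, hPT⟩ := hα.exists_pow_left (inf_le_right)
      (invariant_inf hBi (hα.invariant_spec _)) (hα.sst_Str hBs h1 hε) k
    have h3 := hα.pr_inf_Ici_le (s := -n) (p := 0) hPi
      (hP.trans (hα.spec_mono Icc_subset_Iic_self)) hB.closed hBi (by nlinarith)
    refine (le_inf (inf_le_left.trans hPB) (inf_le_right.trans
      (hα.spec_mono fun γ hγ => hγ.1.1))).trans (h3.trans ?_)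
    exact hT.pr_le_of_le (hPT T hT hE) (inf_le_right.trans hA)
  have key : ∀ n m : ℝ, hα.spec (Icc (-n) n) ⊡ B ⊡ hα.spec (Icc (-m) m) ≤ T := fun n m => by
    obtain ⟨k, hk⟩ := hnat n
    obtain ⟨l, hl⟩ := hnat m
    have h3 := hα.sst_Str hBs h2 hε
    rw [neg_neg] at h3
    obtain ⟨P, hPi, hP, hPB, -⟩ := hα.exists_pow_left inf_le_right
      (invariant_inf hBi (hα.invariant_spec _)) h3 k
    obtain ⟨Q, hQi, hQ, hQB, -⟩ := hα.exists_pow_right inf_le_right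
      (invariant_inf hBi (hα.invariant_spec _)) (h1 ε hε) l
    have h4 : hα.spec (Icc (-n) n) ⊡ P ≤ T := by
      refine ((pr_mono (hα.spec_mono Icc_subset_Ici_self)
        (hP.trans (hα.spec_mono Icc_subset_Ici_self))).trans (hα.pr_Ici_le _ _)).trans
        ((hα.spec_mono (Ici_subset_Ici.2 ?_)).trans hA)
      nlinarith
    have h5 : Q ⊡ hα.spec (Icc (-m) m) ≤ T := by
      refine ((pr_mono (hQ.trans (hα.spec_mono Icc_subset_Ici_self))
        (hα.spec_mono Icc_subset_Ici_self)).trans (hα.pr_Ici_le _ _)).trans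
        ((hα.spec_mono (Ici_subset_Ici.2 ?_)).trans hA)
      nlinarith
    have h6 : B ≤ P ⊡ B ⊡ Q := by
      rw [pr_assoc]; exact hPB.trans (pr_mono le_rfl hQB)
    refine (pr_mono (pr_mono le_rfl h6) le_rfl).trans ?_
    rw [← pr_assoc, ← pr_assoc, pr_assoc]
    exact hT.pr_le_of_le (hT.pr_le_of_le h4 hBT) h5
  have key2 : ∀ n : ℝ, hα.spec (Icc (-n) n) ⊡ (B ⊡ ⊤) ≤ T := fun n => by
    rw [← pr_assoc]
    exact pr_le_of_le_rmult hT.closed (hα.le_of_Icc_top (isClosed_rmult hT.closed)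
      fun m _ => le_rmult (key n m))
  rw [idl, pr_assoc]
  exact pr_le_of_le_lmult hT.closed (hα.le_of_Icc_top (isClosed_lmult hT.closed)
    fun m _ => le_lmult (key2 m))

lemma exists_gap (hα : IsCStarDynSys α) (hY : IsId Y) (hYi : Invariant α (Y : Set X)) {g : ℝ} (hg : 0 < g)
    (h : g ∈ actSpec α (Y : Set X)) : ∃ κ ∈ actSpec α (Y : Set X), 0 < κ ∧ ∃ ε > 0, ε < κ ∧ 6 * ε < g ∧
      Y ⊓ hα.spec (Ici (g - κ - 6 * ε)) ≤ hα.spec (Ici 0) := by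
  by_cases h1 : ∃ κ ∈ actSpec α (Y : Set X), 0 < κ ∧ κ < g
  · obtain ⟨κ, hκ, h0, hκg⟩ := h1
    have := min_le_left (κ / 2) (min ((g - κ) / 6) (g / 12))
    have h3 := (min_le_right (κ / 2) (min ((g - κ) / 6) (g / 12))).trans (min_le_left _ _)
    have h4 := (min_le_right (κ / 2) (min ((g - κ) / 6) (g / 12))).trans (min_le_right _ _)
    have hpos : 0 < min (κ / 2) (min ((g - κ) / 6) (g / 12)) :=
      lt_min (by linarith) (lt_min (by linarith) (by linarith))
    exact ⟨κ, hκ, h0, min (κ / 2) (min ((g - κ) / 6) (g / 12)), hpos, by linarith, by linarith,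
      inf_le_right.trans (hα.spec_mono (Ici_subset_Ici.2 (by linarith)))⟩
  · push Not at h1
    refine ⟨g, h, hg, g / 12, by linarith, by linarith, by linarith, ?_⟩
    refine (hα.le_spec_inter hα.isClosed_actSpec isClosed_Ici
      (inf_le_left.trans (hα.le_spec_actSpec hY.closed hYi)) inf_le_right).trans
      (hα.spec_mono fun γ hγ => ?_)
    by_contra h2
    have h2 : γ < 0 := not_le.1 h2
    have h3 := h1 _ (hα.neg_mem_actSpec hY.sst_eq hγ.1) (by linarith)
    have := mem_Ici.1 hγ.2
    linarith

lemma ideal_le_of_not_le (hα : IsCStarDynSys α) (hY : IsId Y) (hYi : Invariant α (Y : Set X))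
    (hs : ∀ K, IsId K → K ≤ Y → Invariant α (K : Set X) → K = ⊥ ∨ K = Y)
    (hneg : ∀ μ > 0, hα.spec (Iic (-μ)) ≤ Y)
    (hstr : ∀ γ ∈ actSpec α (Y : Set X), ∀ B : Submodule ℂ X, IsHereditaryIn (Y : Set X) (B : Set X) →
      B ≠ ⊥ → Invariant α (B : Set X) → hα.Str B γ)
    (hW : IsAlg W) (hA : hα.spec (Ici 0) ≤ W) (hWA : ¬ W ≤ hα.spec (Ici 0)) : Y ≤ W := by
  intro y hyY
  by_contra hy
  obtain ⟨T, V, hT, hTi, hWT, hV, hTWV, hyV⟩ := hα.exists_invariant_stabilizer hW hA hy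
  have hAT := hA.trans hWT
  obtain ⟨g, hg0, hg⟩ : ∃ g > 0, -g ∈ actSpec α (T : Set X) := by
    by_contra! h
    refine hWA (hWT.trans ((hα.le_spec_actSpec hT.closed hTi).trans (hα.spec_mono fun γ hγ => ?_)))
    by_contra h2
    have h2 : γ < 0 := not_le.1 h2
    exact h (-γ) (by linarith) (by rwa [neg_neg])
  have hTY : ∀ ε, ε < g → T ⊓ hα.spec (Icc (-g - ε) (-g + ε)) ≤ Y := fun ε hε =>
    inf_le_right.trans ((hα.spec_mono (fun γ hγ => (by have := hγ.2; simp only [mem_Iic]; linarith :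
      γ ∈ Iic (-(g - ε))))).trans (hneg (g - ε) (by linarith)))
  have hgY : -g ∈ actSpec α (Y : Set X) := hα.mem_actSpec_iff.2 fun ε hε h => by
    refine hα.mem_actSpec_iff.1 hg (min ε (g / 2)) (by positivity) (eq_bot_mono ?_ h)
    exact le_inf (hTY _ (by linarith [min_le_right ε (g / 2)])) (inf_le_right.trans (hα.spec_mono
      (Icc_subset_Icc (by linarith [min_le_left ε (g / 2)]) (by linarith [min_le_left ε (g / 2)]))))
  have hgY' := hα.neg_mem_actSpec hY.sst_eq hgY
  rw [neg_neg] at hgY'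
  obtain ⟨κ, hκ, hκ0, ε, hε, hεκ, hεg, hgap⟩ := hα.exists_gap hY hYi hg0 hgY'
  have hκ' := hα.neg_mem_actSpec hY.sst_eq hκ
  set C := T ⊓ hα.spec (Icc (-g - ε) (-g + ε)) with hC
  have hCi : Invariant α (C : Set X) := invariant_inf hTi (hα.invariant_spec _)
  have hCY : C ≤ Y := hTY ε (by linarith)
  have hC0 : C ≠ ⊥ := hα.mem_actSpec_iff.1 hg ε hε
  have hB := hY.hereditary_star_pr C
  have hBCS := hY.isCS_star C
  set B := sst C ⊡ Y ⊡ C with hBdef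
  have hBi : Invariant α (B : Set X) :=
    hα.invariant_pr (hα.invariant_pr (hα.invariant_sst hCi) hYi) hCi
  have hB0 : B ≠ ⊥ := fun h => hC0 <| eq_bot_of_sst_pr_self <| eq_bot_mono
    (by rw [hBdef, pr_assoc]; exact pr_mono le_rfl (hY.isCS.le_pr_left hCY)) h
  have hCs : sst C ≤ hα.spec (Icc (g - ε) (g + ε)) := by
    refine (sst_mono inf_le_right).trans (le_of_eq ?_)
    rw [hα.sst_spec_Icc]; congr 2 <;> ring
  have hE : B ⊓ hα.spec (Icc (-κ - ε) (-κ + ε)) ≤ T := by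
    have h1 := hα.pr_inf_Ici_le (s := -κ - ε) (p := -κ - g - 3 * ε - ε / 4) (hα.invariant_sst hCi)
      (hCs.trans (hα.spec_mono Icc_subset_Iic_self)) (Y := Y ⊡ C) isClosed_pr
      (hα.invariant_pr hYi hCi) (by linarith)
    have h2 := hα.pr_inf_Ici_le' (s := -κ - g - 3 * ε - ε / 4) (p := -κ - 5 * ε) hCi
      (inf_le_right.trans (hα.spec_mono Icc_subset_Iic_self)) hY.closed hYi (by linarith)
    rw [← pr_assoc] at h1
    refine (inf_le_inf_left _ (hα.spec_mono Icc_subset_Ici_self)).trans (h1.trans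
      ((pr_mono le_rfl h2).trans ?_))
    rw [← pr_assoc]
    refine hT.pr_le_of_le (le_trans (le_trans (le_inf ?_ ?_) hgap) hAT) inf_le_left
    · exact (pr_mono le_rfl inf_le_left).trans hY.pr_le_left
    · refine ((pr_mono (hCs.trans (hα.spec_mono Icc_subset_Ici_self)) inf_le_right).trans
        (hα.pr_Ici_le _ _)).trans (hα.spec_mono (Ici_subset_Ici.2 (by linarith)))
  have hYT : Y ≤ T := by
    have h1 := hα.idl_le_of_strong hT hAT hBCS hBi hε hεκ (hstr κ hκ B hB hB0 hBi)
      (hstr _ hκ' B hB hB0 hBi) hE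
    rcases hs (idl B) (isId_idl B) (idl_le hY hB.1)
      (hα.invariant_pr (hα.invariant_pr invariant_top hBi) invariant_top) with h | h
    · exact absurd (eq_bot_mono le_idl h) hB0
    · exact h ▸ h1
  refine hyV (hTWV (pr_mono hYT (inf_le_right.trans ((hα.spec_mono ?_).trans hA))
    (hstr κ hκ Y (IsHereditaryIn.self hY) ?_ hYi ε hε hyY)))
  · exact fun γ hγ => (by linarith [hγ.1] : (0:ℝ) ≤ γ)
  · rintro rfl
    exact hC0 (le_bot_iff.1 hCY)

lemma eq_top_of_not_le_of_ideal (hα : IsCStarDynSys α) (hY : IsId Y) (hYi : Invariant α (Y : Set X))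
    (hs : ∀ K, IsId K → K ≤ Y → Invariant α (K : Set X) → K = ⊥ ∨ K = Y)
    (hpos : hα.pos Y = hα.pos ⊤) (hsp : actSpec α (Y : Set X) = ConnesSpec α (Y : Set X))
    (htop : Y ⊹ hα.spec (Ici 0) = ⊤)
    (hW : IsAlg W) (hA : hα.spec (Ici 0) ≤ W) (hWA : ¬ W ≤ hα.spec (Ici 0)) : W = ⊤ := by
  refine top_le_iff.1 (htop.ge.trans (sc_le hW.closed ?_ hA))
  refine hα.ideal_le_of_not_le hY hYi hs (fun μ hμ => ?_) (fun γ hγ => ?_) hW hA hWA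
  · have h1 : hα.spec (Ici μ) ≤ Y := by
      have := hα.inf_spec_le_pos (S := ⊤) hμ
      rw [top_inf_eq, ← hpos] at this
      exact this.trans (hα.pos_le hY.closed fun _ _ => inf_le_left)
    have h2 := sst_mono h1
    rwa [hY.sst_eq, hα.sst_spec_Ici] at h2
  · rw [hsp] at hγ
    exact hα.mem_connesSpec_iff.1 hγ

end IsCStarDynSys

end

section

variable {α : ℝ → X → X} {x y : X} {S T V B Y K W E C : Submodule ℂ X} {φ χ : ℝ → ℂ} {F G : Set ℝ}

lemma le_pr_of_sst_pr_le (hB : IsCS B) (h : sst S ⊡ S ≤ B) : S ≤ S ⊡ B := fun c hc => by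
  obtain ⟨l, hl, h1, h2⟩ := hB.exists_unit
  refine isClosed_pr.mem_of_tendsto (tendsto_of_star_mul_self h1 (fun b hb => (h2 b hb).2)
    (h (mul_mem_pr (star_mem_sst hc) hc))) ?_
  filter_upwards [h1] with e he
  exact mul_mem_pr hc he.1

lemma isCS_sst_pr (h : S ⊡ (sst S ⊡ S) ≤ S) : IsCS (sst S ⊡ S) := by
  have h2 : sst (sst S ⊡ S) = sst S ⊡ S := by rw [sst_pr, sst_sst]
  refine ⟨isClosed_pr, fun x hx y hy => ?_, fun x hx => ?_⟩
  · have := mul_mem_pr hx hy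
    rw [pr_assoc] at this
    exact pr_mono le_rfl h this
  · rw [← h2, mem_sst, star_star]; exact hx

namespace IsCStarDynSys

lemma pr_singleton_le (hα : IsCStarDynSys α) (a b : ℝ) :
    hα.spec {a} ⊡ hα.spec {b} ≤ hα.spec {a + b} := by
  simpa only [Icc_self] using hα.pr_Icc_le a a b b

lemma sst_spec_singleton (hα : IsCStarDynSys α) (a : ℝ) : sst (hα.spec {a}) = hα.spec {-a} := by
  simpa only [Icc_self] using hα.sst_spec_Icc a a

lemma exists_split_singleton (hα : IsCStarDynSys α) {a : ℝ} (hG : IsClosed G) (ha : a ∉ G)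
    (hx : x ∈ hα.spec (insert a G)) :
    ∃ φ, Tst φ ∧ tm α φ x ∈ hα.spec {a} ∧ x - tm α φ x ∈ hα.spec G := by
  obtain ⟨r, hr, h⟩ := Metric.nhds_basis_closedBall.mem_iff.1 (hG.isOpen_compl.mem_nhds ha)
  rw [Real.closedBall_eq_Icc] at h
  obtain ⟨φ, hφ, hφ1, hφs⟩ := exists_plateau (a' := a - r) (a := a - r / 2) (b := a + r / 2)
    (b' := a + r) (by linarith) (by linarith) (by linarith)
  have hc : IsClosed (insert a G) := by rw [← singleton_union]; exact isClosed_singleton.union hG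
  refine ⟨φ, hφ, hα.spec_mono ?_ (hα.mem_spec_inter isClosed_Icc hc (hα.tm_mem_spec hφ hφs x)
      (hα.tm_mem_spec_of_mem hφ hx)), hα.spec_mono ?_
    (hα.sub_tm_mem_spec isOpen_Ioo hφ (fun γ hγ => hφ1 γ (Ioo_subset_Icc_self hγ)) hx)⟩
  · rintro z ⟨hz, rfl | hz2⟩
    · rfl
    · exact absurd hz2 (h hz)
  · rintro z ⟨rfl | hz, hz2⟩
    · exact absurd ⟨by linarith, by linarith⟩ hz2
    · exact hz

lemma coe_spec_zero (hα : IsCStarDynSys α) : fixedPts α = (hα.spec {0} : Set X) :=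
  Set.ext fun _ => hα.mem_spec_zero_iff.symm

lemma Ici_ne_top (hα : IsCStarDynSys α) (hn : actSpec α (univ : Set X) ≠ {0})
    (hX : (⊤ : Submodule ℂ X) ≠ ⊥) : hα.spec (Ici 0) ≠ ⊤ := fun h => by
  have h1 : ⊤ ≤ hα.spec {0} := hα.top_le_spec_zero fun μ hμ => by
    rw [← sst_eq_bot, hα.sst_spec_Ici]
    refine hα.disj_eq_bot isClosed_Iic (isClosed_Ici (a := 0)) ?_ le_rfl (h ▸ le_top)
    exact disjoint_left.2 fun γ h1 h2 => by simp only [mem_Iic, mem_Ici] at h1 h2; linarith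
  refine hn (subset_antisymm (fun γ hγ => ?_) ?_)
  · by_contra h0
    rw [← Submodule.top_coe (R := ℂ)] at hγ
    refine hα.spec_inf_ne_bot_of_mem_actSpec hγ (U := Icc (γ - |γ| / 2) (γ + |γ| / 2)) ?_ ?_
    · exact Icc_mem_nhds (by linarith [abs_pos.2 h0]) (by linarith [abs_pos.2 h0])
    · refine hα.disj_eq_bot (isClosed_Icc) (isClosed_singleton (x := 0)) ?_ inf_le_right
        (le_top.trans h1)
      refine disjoint_singleton_right.2 fun h => ?_
      rcases lt_or_gt_of_ne h0 with h0 | h0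
      · rw [abs_of_neg h0] at h; linarith [h.2]
      · rw [abs_of_pos h0] at h; linarith [h.1]
  · rintro _ rfl
    rw [← Submodule.top_coe (R := ℂ)]
    refine hα.mem_actSpec_iff.2 fun ε hε h2 => hX (eq_bot_mono (le_inf le_rfl ?_) h2)
    exact h1.trans (hα.spec_mono (by rintro _ rfl; exact ⟨by linarith, by linarith⟩))

lemma ne_bot_of_actSpec_eq (hsp : actSpec α (Y : Set X) = ConnesSpec α (Y : Set X))
    (hα : IsCStarDynSys α) : Y ≠ ⊥ := by
  rintro rfl
  have h : (0 : ℝ) ∈ ConnesSpec α ((⊥ : Submodule ℂ X) : Set X) :=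
    hα.mem_connesSpec_iff.2 fun B hB hB0 => absurd (le_bot_iff.1 hB.1) hB0
  rw [← hsp] at h
  exact hα.mem_actSpec_iff.1 h 1 one_pos (bot_inf_eq _)

/-- The ideal of the fixed point algebra generated by the top spectral subspace. -/
def topIdl (hα : IsCStarDynSys α) (g : ℝ) : Submodule ℂ X := hα.spec {g} ⊡ hα.spec {-g}

lemma coe_topIdl (hα : IsCStarDynSys α) (g : ℝ) :
    ClosedSpan (MulSet2 (specC α ({g} : Set ℝ)) (star '' specC α ({g} : Set ℝ))) =
      (hα.topIdl g : Set X) := by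
  rw [hα.specC_eq isClosed_singleton, ← coe_sst, hα.sst_spec_singleton]; rfl

lemma isClosedTwoSidedIdealIn_topIdl (hα : IsCStarDynSys α) (g : ℝ) :
    IsClosedTwoSidedIdealIn (fixedPts α) (hα.topIdl g : Set X) := by
  rw [hα.coe_spec_zero, isClosedTwoSidedIdealIn_iff]
  refine ⟨(hα.pr_singleton_le _ _).trans (by rw [add_neg_cancel]), isClosed_pr, ?_, ?_⟩
  · rw [topIdl, ← pr_assoc]
    exact pr_mono ((hα.pr_singleton_le _ _).trans (by rw [zero_add])) le_rfl
  · rw [topIdl, pr_assoc]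
    exact pr_mono le_rfl ((hα.pr_singleton_le _ _).trans (by rw [add_zero]))

lemma topIdl_simple_iff (hα : IsCStarDynSys α) (g : ℝ) :
    (∀ K : Set X, IsClosedTwoSidedIdealIn (hα.topIdl g : Set X) K →
      K = {0} ∨ K = (hα.topIdl g : Set X)) ↔
    ∀ K : Submodule ℂ X, IsClosed (K : Set X) → K ≤ hα.topIdl g → hα.topIdl g ⊡ K ≤ K →
      K ⊡ hα.topIdl g ≤ K → K = ⊥ ∨ K = hα.topIdl g := by
  constructor
  · intro h K h1 h2 h3 h4
    have := h K (isClosedTwoSidedIdealIn_iff.2 ⟨h2, h1, h3, h4⟩)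
    rwa [← Submodule.bot_coe (R := ℂ), SetLike.coe_set_eq, SetLike.coe_set_eq] at this
  · intro h K' hK'
    obtain ⟨K, rfl⟩ := hK'.exists_eq
    obtain ⟨h2, h1, h3, h4⟩ := isClosedTwoSidedIdealIn_iff.1 hK'
    rw [← Submodule.bot_coe (R := ℂ), SetLike.coe_set_eq, SetLike.coe_set_eq]
    exact h K h1 h2 h3 h4

lemma eq_top_of_not_le_of_topIdl (hα : IsCStarDynSys α) {g : ℝ} (hg : 0 < g)
    (hsp : actSpec α (univ : Set X) = {-g, 0, g})
    (hs : ∀ K : Submodule ℂ X, IsClosed (K : Set X) → K ≤ hα.topIdl g → hα.topIdl g ⊡ K ≤ K →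
      K ⊡ hα.topIdl g ≤ K → K = ⊥ ∨ K = hα.topIdl g)
    (hW : IsAlg W) (hA : hα.spec (Ici 0) ≤ W) (hWA : ¬ W ≤ hα.spec (Ici 0)) : W = ⊤ := by
  have htop : ⊤ ≤ hα.spec {-g, 0, g} := by
    have := hα.le_spec_actSpec (S := ⊤) isClosed_univ invariant_top
    rwa [Submodule.top_coe, hsp] at this
  have hsplit : ∀ x, ∃ u ∈ hα.spec {-g}, x - u ∈ hα.spec (Ici 0) := fun x => by
    obtain ⟨φ, hφ, h1, h2⟩ := hα.exists_split_singleton (a := -g) (G := {0, g})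
      (Set.toFinite _).isClosed (by simp; constructor <;> intro h <;> linarith)
      (htop (trivial : x ∈ (⊤ : Submodule ℂ X)))
    exact ⟨_, h1, hα.spec_mono (by rintro _ (rfl | rfl); exacts [self_mem_Ici, hg.le]) h2⟩
  set V := W ⊓ hα.spec {-g} with hV
  have hVcl : IsClosed (V : Set X) := by exact hW.closed.inter (hα.isClosed_spec _)
  have hV0 : V ≠ ⊥ := fun h => hWA fun x hx => by
    obtain ⟨u, hu, hxu⟩ := hsplit x
    have : u ∈ V := ⟨by simpa using W.sub_mem hx (hA hxu), hu⟩
    rw [h, Submodule.mem_bot] at this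
    rwa [this, sub_zero] at hxu
  have hX0 : hα.spec {0} ≤ W := (hα.spec_mono (by rintro _ rfl; exact self_mem_Ici)).trans hA
  have h0V : hα.spec {0} ⊡ V ≤ V := le_inf (hW.pr_le_of_le hX0 inf_le_left)
    ((pr_mono le_rfl inf_le_right).trans ((hα.pr_singleton_le _ _).trans (by rw [zero_add])))
  have hV0' : V ⊡ hα.spec {0} ≤ V := le_inf (hW.pr_le_of_le inf_le_left hX0)
    ((pr_mono inf_le_right le_rfl).trans ((hα.pr_singleton_le _ _).trans (by rw [add_zero])))
  have hm1 : hα.spec {-g} ⊡ hα.spec {g} ≤ hα.spec {0} :=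
    (hα.pr_singleton_le _ _).trans (by rw [neg_add_cancel])
  have h1m : hα.spec {g} ⊡ hα.spec {-g} ≤ hα.spec {0} :=
    (hα.pr_singleton_le _ _).trans (by rw [add_neg_cancel])
  have hJ : hα.topIdl g ⊡ (hα.spec {g} ⊡ V) ≤ hα.spec {g} ⊡ V := by
    rw [topIdl, pr_assoc]
    refine pr_mono le_rfl ?_
    rw [← pr_assoc]
    exact (pr_mono hm1 le_rfl).trans h0V
  have hJ' : hα.spec {g} ⊡ V ⊡ hα.topIdl g ≤ hα.spec {g} ⊡ V := by
    rw [pr_assoc]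
    exact pr_mono le_rfl ((pr_mono le_rfl h1m).trans hV0')
  have hsst : sst (hα.spec {-g}) = hα.spec {g} := by rw [hα.sst_spec_singleton, neg_neg]
  have hJV : hα.spec {g} ⊡ V = hα.topIdl g := by
    refine (hs _ isClosed_pr (pr_mono le_rfl inf_le_right) hJ hJ').resolve_left fun h => hV0 ?_
    refine eq_bot_of_sst_pr_self (eq_bot_mono (pr_mono ?_ le_rfl) h)
    rw [← hsst]; exact sst_mono inf_le_right
  have hmW : hα.spec {-g} ≤ W := by
    have h1 : IsCS (sst (hα.spec {-g}) ⊡ hα.spec {-g}) := isCS_sst_pr (by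
      rw [hsst]
      exact (pr_mono le_rfl h1m).trans ((hα.pr_singleton_le _ _).trans (by rw [add_zero])))
    refine (le_pr_of_sst_pr_le h1 le_rfl).trans ?_
    rw [hsst, show hα.spec {g} ⊡ hα.spec {-g} = hα.topIdl g from rfl, ← hJV, ← pr_assoc]
    exact ((pr_mono hm1 le_rfl).trans h0V).trans inf_le_left
  refine top_le_iff.1 fun x _ => ?_
  obtain ⟨u, hu, hxu⟩ := hsplit x
  simpa using W.add_mem (hA hxu) (hmW hu)

/-- The spectral condition implies maximality. -/
theorem isMaximal_of_condition43 (hα : IsCStarDynSys α)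
    (hn : actSpec α (univ : Set X) ≠ {0}) (h : Condition43 α) :
    IsMaximalClosedSubalgebra (specC α (Ici (0 : ℝ))) := by
  rw [hα.specC_eq isClosed_Ici, isMaximalClosedSubalgebra_iff]
  suffices h : (⊤ : Submodule ℂ X) ≠ ⊥ ∧ ∀ W, IsAlg W → hα.spec (Ici 0) ≤ W →
      ¬ W ≤ hα.spec (Ici 0) → W = ⊤ from ⟨hα.isAlg_Ici, hα.Ici_ne_top hn h.1, fun W hW hA => by
    by_cases hWA : W ≤ hα.spec (Ici 0)
    · exact Or.inl (le_antisymm hWA hA)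
    · exact Or.inr (h.2 W hW hA hWA)⟩
  rcases h with ⟨g, hg, hsp, -, hs⟩ | ⟨Y', hYid, hYi, hYs, hpos, hsp, htop⟩
  · rw [hα.coe_topIdl, hα.topIdl_simple_iff] at hs
    refine ⟨fun h => ?_, fun W hW => hα.eq_top_of_not_le_of_topIdl hg hsp hs hW⟩
    have : g ∈ actSpec α ((⊤ : Submodule ℂ X) : Set X) := by rw [Submodule.top_coe, hsp]; simp
    exact hα.mem_actSpec_iff.1 this 1 one_pos (eq_bot_mono inf_le_left h)
  · obtain ⟨Y, rfl⟩ := hYid.exists_eq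
    have hY := isClosedTwoSidedIdealIn_univ_iff.1 hYid
    rw [alphaSimple_iff hY] at hYs
    rw [← Submodule.top_coe (R := ℂ), hα.specO_Ioi hY.closed hYi,
      hα.specO_Ioi isClosed_univ invariant_top, SetLike.coe_set_eq] at hpos
    rw [hα.specC_eq isClosed_Ici, ← coe_sc, ← Submodule.top_coe (R := ℂ), SetLike.coe_set_eq] at htop
    exact ⟨fun h => ne_bot_of_actSpec_eq hsp hα (eq_bot_mono le_top h), fun W hW hA hWA =>
      hα.eq_top_of_not_le_of_ideal hY hYi hYs hpos hsp htop hW hA hWA⟩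

end IsCStarDynSys

end

section

variable {α : ℝ → X → X} {x y : X} {S T V B Y K W E C R : Submodule ℂ X} {φ χ : ℝ → ℂ} {F G : Set ℝ}

lemma pr_pr_top_le : S ⊡ T ⊡ ⊤ ≤ S ⊡ ⊤ := by
  rw [pr_assoc]; exact pr_mono le_rfl le_top

lemma top_pr_pr_le : ⊤ ⊡ (S ⊡ T) ≤ ⊤ ⊡ T := by
  rw [← pr_assoc]; exact pr_mono le_top le_rfl

lemma sc_comm (S T : Submodule ℂ X) : S ⊹ T = T ⊹ S := by rw [sc, sup_comm]; rfl

lemma IsAlg.top_pr_sc (hS : IsAlg S) (h : R ⊡ S ≤ R) : IsAlg ((⊤ ⊡ R) ⊹ S) := by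
  rw [sc_comm]
  refine hS.sc (le_trans ?_ le_sc_right) (le_trans ?_ le_sc_right) (le_trans ?_ le_sc_right)
  · exact top_pr_pr_le.trans' (pr_mono le_top le_rfl)
  · exact top_pr_pr_le.trans' (pr_mono le_top le_rfl)
  · rw [pr_assoc]; exact pr_mono le_rfl h

lemma IsAlg.pr_top_sc (hS : IsAlg S) (h : S ⊡ R ≤ R) : IsAlg ((R ⊡ ⊤) ⊹ S) := by
  rw [sc_comm]
  refine hS.sc (le_trans ?_ le_sc_right) (le_trans ?_ le_sc_right) (le_trans ?_ le_sc_right)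
  · exact pr_pr_top_le.trans' (pr_mono le_rfl le_top)
  · rw [← pr_assoc]; exact pr_mono h le_rfl
  · exact pr_pr_top_le.trans' (pr_mono le_rfl le_top)

lemma IsAlg.isId_sc (hS : IsAlg S) (h : IsId Y) : IsAlg (Y ⊹ S) := by
  rw [sc_comm]
  exact hS.sc (h.pr_le_left.trans le_sc_right) (h.pr_le_left.trans le_sc_right)
    (h.pr_le_right.trans le_sc_right)

namespace IsCStarDynSys

/-- Maximality of the analytic subalgebra among proper closed subalgebras. -/
def AnalyticMaximal (hα : IsCStarDynSys α) : Prop :=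
  hα.spec (Ici 0) ≠ ⊤ ∧ ∀ W, IsAlg W → hα.spec (Ici 0) ≤ W → W = hα.spec (Ici 0) ∨ W = ⊤

/-- The ideal generated by the elements with strictly positive spectrum. -/
def posIdl (hα : IsCStarDynSys α) : Submodule ℂ X := idl (hα.pos ⊤)

lemma isId_posIdl (hα : IsCStarDynSys α) : IsId hα.posIdl := isId_idl _

lemma invariant_posIdl (hα : IsCStarDynSys α) : Invariant α (hα.posIdl : Set X) :=
  hα.invariant_pr (hα.invariant_pr invariant_top (hα.invariant_pos invariant_top)) invariant_top

lemma Ici_le_posIdl (hα : IsCStarDynSys α) {μ : ℝ} (hμ : 0 < μ) : hα.spec (Ici μ) ≤ hα.posIdl :=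
  (le_inf le_top le_rfl).trans ((hα.inf_spec_le_pos hμ).trans le_idl)

lemma Iic_le_posIdl (hα : IsCStarDynSys α) {μ : ℝ} (hμ : μ < 0) : hα.spec (Iic μ) ≤ hα.posIdl := by
  have := sst_mono (hα.Ici_le_posIdl (neg_pos.2 hμ))
  rwa [hα.isId_posIdl.sst_eq, hα.sst_spec_Ici, neg_neg] at this

lemma posIdl_le (hα : IsCStarDynSys α) (hK : IsId K) (h : ∀ μ > 0, hα.spec (Ici μ) ≤ K) :
    hα.posIdl ≤ K :=
  idl_le hK (hα.pos_le hK.closed fun μ hμ => inf_le_right.trans (h μ hμ))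

lemma pos_posIdl (hα : IsCStarDynSys α) : hα.pos hα.posIdl = hα.pos ⊤ := by
  refine le_antisymm (hα.pos_le (isClosed_cl _) fun μ hμ =>
    (inf_le_inf_right _ le_top).trans (hα.inf_spec_le_pos hμ)) (hα.pos_le (isClosed_cl _) fun μ hμ => ?_)
  exact (le_inf (inf_le_right.trans (hα.Ici_le_posIdl hμ)) inf_le_right).trans (hα.inf_spec_le_pos hμ)

lemma eq_bot_of_le_Ici_of_Iic (hα : IsCStarDynSys α) {a b : ℝ} (h1 : S ≤ hα.spec (Ici a))
    (h2 : S ≤ hα.spec (Iic b)) (hab : b < a) : S = ⊥ :=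
  hα.disj_eq_bot isClosed_Ici isClosed_Iic (disjoint_left.2 fun γ h3 h4 => by
    simp only [mem_Ici, mem_Iic] at h3 h4; linarith) h1 h2

lemma Ici_eq_bot_of_sst_le (hα : IsCStarDynSys α) {μ c : ℝ} (hc : -c < μ)
    (h : hα.spec (Iic (-μ)) ≤ hα.spec (Ici c)) : hα.spec (Ici μ) = ⊥ := by
  rw [← sst_eq_bot, hα.sst_spec_Ici]
  exact hα.eq_bot_of_le_Ici_of_Iic h le_rfl (by linarith)

lemma AnalyticMaximal.exists_Ici_ne_bot {hα : IsCStarDynSys α} (hm : hα.AnalyticMaximal) :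
    ∃ μ > 0, hα.spec (Ici μ) ≠ ⊥ := by
  by_contra! h
  refine hm.1 (top_le_iff.1 ((hα.top_le_spec_zero h).trans (hα.spec_mono ?_)))
  rintro _ rfl; exact self_mem_Ici

lemma AnalyticMaximal.posIdl_ne_bot {hα : IsCStarDynSys α} (hm : hα.AnalyticMaximal) :
    hα.posIdl ≠ ⊥ := fun h => by
  obtain ⟨μ, hμ, h1⟩ := hm.exists_Ici_ne_bot
  exact h1 (eq_bot_mono (hα.Ici_le_posIdl hμ) h)

lemma AnalyticMaximal.posIdl_sc {hα : IsCStarDynSys α} (hm : hα.AnalyticMaximal) :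
    hα.posIdl ⊹ hα.spec (Ici 0) = ⊤ := by
  refine (hm.2 _ (hα.isAlg_Ici.isId_sc hα.isId_posIdl) le_sc_right).resolve_left fun h => ?_
  obtain ⟨μ, hμ, h1⟩ := hm.exists_Ici_ne_bot
  exact h1 (hα.Ici_eq_bot_of_sst_le (by simpa using hμ)
    ((hα.Iic_le_posIdl (by linarith)).trans (le_sc_left.trans h.le)))

lemma AnalyticMaximal.posIdl_simple {hα : IsCStarDynSys α} (hm : hα.AnalyticMaximal) (hK : IsId K)
    (hKY : K ≤ hα.posIdl) (hKi : Invariant α (K : Set X)) : K = ⊥ ∨ K = hα.posIdl := by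
  rcases hm.2 _ (hα.isAlg_Ici.isId_sc hK) le_sc_right with h | h
  · left
    have h1 : K ≤ hα.spec (Ici 0) := le_sc_left.trans h.le
    have h2 : K ≤ hα.spec (Iic 0) := by
      have := sst_mono h1
      rwa [hK.sst_eq, hα.sst_spec_Ici, neg_zero] at this
    have h3 : ∀ μ > 0, K ⊡ hα.spec (Ici μ) = ⊥ := fun μ hμ =>
      hα.eq_bot_of_le_Ici_of_Iic ((pr_mono h1 le_rfl).trans (hα.pr_Ici_le _ _))
        (hK.pr_le_right.trans h2) (by linarith)
    have h4 : hα.posIdl ≤ rmult K ⊥ := by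
      have h5 : ⊤ ⊡ hα.pos ⊤ ≤ rmult K ⊥ := by
        refine pr_le (isClosed_rmult isClosed_singleton) fun x _ y hy k hk => ?_
        rw [← mul_assoc]
        have h6 : hα.pos ⊤ ≤ rmult K ⊥ := hα.pos_le (isClosed_rmult isClosed_singleton)
          fun μ hμ => inf_le_right.trans (le_rmult (h3 μ hμ).le)
        exact h6 hy _ (hK.mul_right k hk x)
      refine pr_le (isClosed_rmult isClosed_singleton) fun x hx y _ k hk => ?_
      rw [← mul_assoc, (Submodule.mem_bot ℂ).1 (h5 hx k hk), zero_mul]; exact zero_mem _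
    exact le_bot_iff.1 (hK.isCS.le_pr_self.trans (pr_le_of_le_rmult isClosed_singleton (hKY.trans h4)))
  · refine Or.inr (le_antisymm hKY (hα.posIdl_le hK fun μ hμ => ?_))
    have := sst_mono (hα.spec_Iic_le_of_sc_eq_top hK.closed hKi (neg_lt_zero.2 hμ) h)
    rwa [hα.sst_spec_Iic, hK.sst_eq, neg_neg] at this

/-- All four ways in which the strictly positive or negative elements generate `Y`. -/
structure Full (hα : IsCStarDynSys α) (Y : Submodule ℂ X) : Prop where
  isId : IsId Y
  invariant : Invariant α (Y : Set X)
  ne_bot : Y ≠ ⊥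
  Iic_top : ∀ μ > 0, Y = hα.spec (Iic (-μ)) ⊡ ⊤
  top_Ici : ∀ μ > 0, Y = ⊤ ⊡ hα.spec (Ici μ)
  Ici_top : ∀ μ > 0, Y = hα.spec (Ici μ) ⊡ ⊤
  top_Iic : ∀ μ > 0, Y = ⊤ ⊡ hα.spec (Iic (-μ))

lemma Ici_le_of_sc_eq_top (hα : IsCStarDynSys α) {μ ν : ℝ} (hν : 0 < ν)
    (h : (⊤ ⊡ hα.spec (Ici μ)) ⊹ hα.spec (Ici 0) = ⊤) : hα.spec (Ici ν) ≤ hα.spec (Iic (-μ)) ⊡ ⊤ := by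
  have := sst_mono (hα.spec_Iic_le_of_sc_eq_top isClosed_pr
    (hα.invariant_pr invariant_top (hα.invariant_spec _)) (neg_lt_zero.2 hν) h)
  rwa [hα.sst_spec_Iic, sst_pr, hα.sst_spec_Ici, neg_neg, sst_top] at this

lemma AnalyticMaximal.full {hα : IsCStarDynSys α} (hm : hα.AnalyticMaximal)
    (h : ∀ μ > 0, (⊤ ⊡ hα.spec (Ici μ)) ⊹ hα.spec (Ici 0) = ⊤) : hα.Full hα.posIdl := by
  have hs := hα.isId_posIdl.sst_eq
  have h1 : ∀ ν > 0, ∀ μ > 0, hα.spec (Ici ν) ≤ hα.spec (Iic (-μ)) ⊡ ⊤ := fun ν hν μ hμ =>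
    hα.Ici_le_of_sc_eq_top hν (h μ hμ)
  have h2 : ∀ μ > 0, hα.posIdl = hα.spec (Iic (-μ)) ⊡ ⊤ := fun μ hμ => by
    refine le_antisymm ?_ ((pr_mono (hα.Iic_le_posIdl (neg_lt_zero.2 hμ)) le_rfl).trans
      hα.isId_posIdl.pr_le_right)
    have h3 : ∀ ν > 0, ⊤ ⊡ hα.spec (Ici ν) ≤ hα.spec (Iic (-μ)) ⊡ ⊤ := fun ν hν => by
      refine pr_le_of_le_lmult isClosed_pr (hα.le_of_Icc_top (isClosed_lmult isClosed_pr)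
        fun n hn => le_lmult ?_)
      refine (pr_mono (hα.spec_mono Icc_subset_Iic_self) (h1 ν hν (n + μ) (by linarith))).trans ?_
      rw [← pr_assoc]
      exact pr_mono ((hα.pr_Iic_le _ _).trans (by rw [neg_add]; simp)) le_rfl
    have h4 : ⊤ ⊡ hα.pos ⊤ ≤ hα.spec (Iic (-μ)) ⊡ ⊤ :=
      pr_le_of_le_rmult isClosed_pr (hα.pos_le (isClosed_rmult isClosed_pr)
        fun ν hν => inf_le_right.trans (le_rmult (h3 ν hν)))
    exact (pr_mono h4 le_rfl).trans pr_pr_top_le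
  have h3 : ∀ μ > 0, hα.posIdl = ⊤ ⊡ hα.spec (Ici μ) := fun μ hμ => by
    conv_lhs => rw [← hs, h2 μ hμ]
    rw [sst_pr, sst_top, hα.sst_spec_Iic, neg_neg]
  have h4 : ∀ μ > 0, hα.posIdl = hα.spec (Ici μ) ⊡ ⊤ := fun μ hμ => by
    have hG : hα.spec (Ici μ) ⊡ ⊤ ≤ hα.posIdl :=
      (pr_mono (hα.Ici_le_posIdl hμ) le_rfl).trans hα.isId_posIdl.pr_le_right
    refine le_antisymm ?_ hG
    have hAR : hα.spec (Ici 0) ⊡ hα.spec (Ici μ) ≤ hα.spec (Ici μ) :=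
      (hα.pr_Ici_le _ _).trans (by rw [zero_add])
    rcases hm.2 _ (hα.isAlg_Ici.pr_top_sc hAR) le_sc_right with h5 | h5
    · have h6 : hα.spec (Ici μ) ⊡ ⊤ ≤ hα.spec (Ici 0) := le_sc_left.trans h5.le
      have h7 : hα.spec (Ici μ) ⊡ ⊤ ≤ (hα.spec (Ici μ) ⊡ ⊤) ⊡ hα.spec (Ici μ) := by
        refine (hα.isId_posIdl.isCS.le_pr_right hG).trans ?_
        conv_lhs => rw [h3 μ hμ, ← pr_assoc]
        exact pr_mono pr_pr_top_le le_rfl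
      have h8 : ∀ n : ℕ, hα.spec (Ici μ) ⊡ ⊤ ≤ hα.spec (Ici (n * μ)) := fun n => by
        induction n with
        | zero => simpa using h6
        | succ n ih =>
          refine h7.trans ((pr_mono ih le_rfl).trans ((hα.pr_Ici_le _ _).trans (le_of_eq ?_)))
          push_cast; congr 2; ring
      have h9 : hα.spec (Ici μ) ⊡ ⊤ = ⊥ := hα.eq_bot_of_le_Ici fun c => by
        obtain ⟨n, hn⟩ := exists_nat_gt (c / μ)
        rw [div_lt_iff₀ hμ] at hn
        exact (h8 n).trans (hα.spec_mono (Ici_subset_Ici.2 hn.le))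
      refine absurd ?_ hm.posIdl_ne_bot
      rw [h3 μ hμ, eq_bot_mono le_pr_top h9, pr_bot]
    · have h6 := hα.spec_Iic_le_of_sc_eq_top isClosed_pr
        (hα.invariant_pr (hα.invariant_spec _) invariant_top) (neg_lt_zero.2 hμ) h5
      conv_lhs => rw [h2 μ hμ]
      exact (pr_mono h6 le_rfl).trans pr_pr_top_le
  refine ⟨hα.isId_posIdl, hα.invariant_posIdl, hm.posIdl_ne_bot, h2, h3, h4, fun μ hμ => ?_⟩
  conv_lhs => rw [← hs, h4 μ hμ]
  rw [sst_pr, sst_top, hα.sst_spec_Ici]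

end IsCStarDynSys

end

section

variable {α : ℝ → X → X} {x y : X} {S T V B Y K W E C R D : Submodule ℂ X} {φ χ : ℝ → ℂ} {F G : Set ℝ}

namespace IsCStarDynSys

lemma Full.le_corner_pr {hα : IsCStarDynSys α} (hm : hα.AnalyticMaximal) (hY : hα.Full Y)
    (hCi : Invariant α (C : Set X)) {d κ ζ : ℝ} (hCd : C ≤ hα.spec (Ici (-d)))
    (hCA : ¬ C ≤ hα.spec (Ici 0)) (hκ : 0 < κ) (hζ : 0 < ζ) :
    Y ≤ ((⊤ ⊡ C) ⊓ hα.spec (Icc (-κ - d) (-κ + ζ))) ⊡ ⊤ := by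
  obtain ⟨P, hP⟩ : ∃ P, P = ((⊤ ⊡ C) ⊓ hα.spec (Icc (-κ - d) (-κ + ζ))) ⊡ ⊤ := ⟨_, rfl⟩
  rw [← hP]
  have hPc : IsClosed (P : Set X) := hP ▸ isClosed_pr
  obtain ⟨Z, hZ⟩ : ∃ Z, Z = P ⊹ hα.spec (Ici (-κ)) := ⟨_, rfl⟩
  have hZc : IsClosed (Z : Set X) := hZ ▸ isClosed_sc
  have hPZ : P ≤ Z := hZ ▸ le_sc_left
  have hSZ : hα.spec (Ici (-κ)) ≤ Z := hZ ▸ le_sc_right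
  have hCi' := hα.invariant_pr invariant_top hCi
  have hPi : Invariant α (P : Set X) :=
    hP ▸ hα.invariant_pr (invariant_inf hCi' (hα.invariant_spec _)) invariant_top
  have hPT : ∀ T, P ⊡ T ≤ P := fun T => by
    rw [hP, pr_assoc]; exact pr_mono le_rfl le_top
  have hsc : ∀ {T : Submodule ℂ X}, IsClosed (Z : Set X) → P ⊡ T ≤ Z → hα.spec (Ici (-κ)) ⊡ T ≤ Z → Z ⊡ T ≤ Z := by
    intro T h1 h2 h3; conv_lhs => rw [hZ]
    exact sc_pr_le h1 h2 h3
  have hA : hα.spec (Ici 0) ≤ rmult Z Z := by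
    refine le_rmult (hsc hZc ((hPT _).trans hPZ) (le_trans ?_ hSZ))
    exact (hα.pr_Ici_le _ _).trans (by rw [add_zero])
  have hCZ : C ≤ rmult Z Z := by
    refine le_rmult (hsc hZc ((hPT _).trans hPZ) fun x hx => ?_)
    have h1 : x ∈ ⊤ ⊡ C := pr_mono le_top le_rfl hx
    obtain ⟨φ, hφ, h2, h3⟩ := hα.exists_split (p := -κ) (q := -κ + ζ) (by linarith)
      ((pr_mono le_rfl hCd).trans (hα.pr_Ici_le _ _) hx)
    have h4 : tm α φ x ∈ P := hP ▸ le_pr_top ⟨hα.tm_mem isClosed_pr hCi' hφ h1, h2⟩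
    simpa using Z.add_mem (hPZ h4) (hSZ h3)
  have htop : rmult Z Z = ⊤ := (hm.2 _ (isAlg_rmult hZc) hA).resolve_left
    fun h => hCA (hCZ.trans h.le)
  have hZtop : Z = ⊤ := top_le_iff.1 <| by
    refine (hα.le_unit_pr IsCS.top invariant_top hκ le_rfl).trans ?_
    rw [top_inf_eq]
    exact (pr_mono ((hα.spec_mono Icc_subset_Ici_self).trans hSZ) le_rfl).trans
      (pr_le_of_le_rmult hZc htop.ge)
  have h5 := hα.spec_Iic_le_of_sc_eq_top hPc hPi (d := -(κ + 1)) (by linarith) (hZ ▸ hZtop)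
  rw [hY.Iic_top (κ + 1) (by linarith)]
  exact (pr_mono h5 le_rfl).trans (hPT _)

lemma Full.le_pr_corner {hα : IsCStarDynSys α} (hm : hα.AnalyticMaximal) (hY : hα.Full Y)
    (hCi : Invariant α (C : Set X)) {d κ ζ : ℝ} (hCd : C ≤ hα.spec (Ici (-d)))
    (hCA : ¬ C ≤ hα.spec (Ici 0)) (hκ : 0 < κ) (hζ : 0 < ζ) :
    Y ≤ ⊤ ⊡ ((C ⊡ ⊤) ⊓ hα.spec (Icc (-κ - d) (-κ + ζ))) := by
  obtain ⟨P, hP⟩ : ∃ P, P = ⊤ ⊡ ((C ⊡ ⊤) ⊓ hα.spec (Icc (-κ - d) (-κ + ζ))) := ⟨_, rfl⟩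
  rw [← hP]
  have hPc : IsClosed (P : Set X) := hP ▸ isClosed_pr
  obtain ⟨Z, hZ⟩ : ∃ Z, Z = P ⊹ hα.spec (Ici (-κ)) := ⟨_, rfl⟩
  have hZc : IsClosed (Z : Set X) := hZ ▸ isClosed_sc
  have hPZ : P ≤ Z := hZ ▸ le_sc_left
  have hSZ : hα.spec (Ici (-κ)) ≤ Z := hZ ▸ le_sc_right
  have hCi' := hα.invariant_pr hCi invariant_top
  have hPi : Invariant α (P : Set X) :=
    hP ▸ hα.invariant_pr invariant_top (invariant_inf hCi' (hα.invariant_spec _))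
  have hPT : ∀ T, T ⊡ P ≤ P := fun T => by
    rw [hP, ← pr_assoc]; exact pr_mono le_top le_rfl
  have hsc : ∀ {T : Submodule ℂ X}, IsClosed (Z : Set X) → T ⊡ P ≤ Z → T ⊡ hα.spec (Ici (-κ)) ≤ Z → T ⊡ Z ≤ Z := by
    intro T h1 h2 h3; conv_lhs => rw [hZ]
    exact pr_sc_le h1 h2 h3
  have hA : hα.spec (Ici 0) ≤ lmult Z Z := by
    refine le_lmult (hsc hZc ((hPT _).trans hPZ) (le_trans ?_ hSZ))
    exact (hα.pr_Ici_le _ _).trans (by rw [zero_add])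
  have hCZ : C ≤ lmult Z Z := by
    refine le_lmult (hsc hZc ((hPT _).trans hPZ) fun x hx => ?_)
    have h1 : x ∈ C ⊡ ⊤ := pr_mono le_rfl le_top hx
    obtain ⟨φ, hφ, h2, h3⟩ := hα.exists_split (c := -κ - d) (p := -κ) (q := -κ + ζ) (by linarith)
      (by
        have := (pr_mono hCd le_rfl).trans (hα.pr_Ici_le _ _) hx
        convert this using 3; ring)
    have h4 : tm α φ x ∈ P := hP ▸ le_top_pr ⟨hα.tm_mem isClosed_pr hCi' hφ h1, h2⟩
    simpa using Z.add_mem (hPZ h4) (hSZ h3)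
  have htop : lmult Z Z = ⊤ := (hm.2 _ (isAlg_lmult hZc) hA).resolve_left
    fun h => hCA (hCZ.trans h.le)
  have hZtop : Z = ⊤ := top_le_iff.1 <| by
    refine (hα.le_pr_unit IsCS.top invariant_top hκ le_rfl).trans ?_
    rw [top_inf_eq]
    exact (pr_mono le_rfl ((hα.spec_mono Icc_subset_Ici_self).trans hSZ)).trans
      (pr_le_of_le_lmult hZc htop.ge)
  have h5 := hα.spec_Iic_le_of_sc_eq_top hPc hPi (d := -(κ + 1)) (by linarith) (hZ ▸ hZtop)
  rw [hY.top_Iic (κ + 1) (by linarith)]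
  exact (pr_mono le_rfl h5).trans (hPT _)

lemma not_le_Ici_of_le_Iic (hα : IsCStarDynSys α) (hC : C ≠ ⊥) {c : ℝ} (hc : c < 0)
    (h : C ≤ hα.spec (Iic c)) : ¬ C ≤ hα.spec (Ici 0) :=
  fun h1 => hC (hα.eq_bot_of_le_Ici_of_Iic h1 h hc)

lemma Full.le_window {hα : IsCStarDynSys α} (hm : hα.AnalyticMaximal) (hY : hα.Full Y) {s κ ζ ε : ℝ}
    (hs : s ∈ actSpec α (Y : Set X)) (hε : 0 < ε) (hεs : ε < s) (hκ : 0 < κ) (hζ : 0 < ζ) :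
    Y ≤ (Y ⊓ hα.spec (Icc (-κ - (s + ε)) (-κ + ζ))) ⊡ ⊤ ∧
      Y ≤ ⊤ ⊡ (Y ⊓ hα.spec (Icc (-κ - (s + ε)) (-κ + ζ))) := by
  have hs' := hα.neg_mem_actSpec hY.isId.sst_eq hs
  set C := Y ⊓ hα.spec (Icc (-s - ε) (-s + ε)) with hC
  have h0 : C ≠ ⊥ := hα.mem_actSpec_iff.1 hs' ε hε
  have h2 : Invariant α (C : Set X) := invariant_inf hY.invariant (hα.invariant_spec _)
  have h3 : C ≤ hα.spec (Ici (-(s + ε))) := inf_le_right.trans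
    (hα.spec_mono (Icc_subset_Ici_self.trans (Ici_subset_Ici.2 (by linarith))))
  have h4 := hα.not_le_Ici_of_le_Iic h0 (c := -s + ε) (by linarith)
    (inf_le_right.trans (hα.spec_mono Icc_subset_Iic_self))
  exact ⟨(hY.le_corner_pr hm h2 h3 h4 hκ hζ).trans (pr_mono (inf_le_inf_right _
      ((pr_mono le_rfl inf_le_left).trans hY.isId.pr_le_left)) le_rfl),
    (hY.le_pr_corner hm h2 h3 h4 hκ hζ).trans (pr_mono le_rfl (inf_le_inf_right _
      ((pr_mono inf_le_left le_rfl).trans hY.isId.pr_le_right)))⟩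

lemma Full.hereditary_le {hα : IsCStarDynSys α} (hm : hα.AnalyticMaximal) (hY : hα.Full Y)
    {δ₁ δ₂ κ ζ η : ℝ} (hη : 0 < η) (hηδ : η < δ₁) (hκ : 0 < κ) (hζ : 0 < ζ)
    (hD : D = Y ⊓ hα.spec (Icc (-δ₂) (-δ₁))) (hD1 : Y ≤ D ⊡ ⊤) (hD2 : Y ≤ ⊤ ⊡ D)
    (hB : IsHereditaryIn (Y : Set X) (B : Set X)) (hB0 : B ≠ ⊥) (hBi : Invariant α (B : Set X)) :
    B ≤ (B ⊓ hα.spec (Icc (-κ - δ₂ - 2 * η) (-κ + ζ + η))) ⊡ B ∧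
      B ≤ B ⊡ (B ⊓ hα.spec (Icc (-κ - δ₂ - 2 * η) (-κ + ζ + η))) := by
  have hBCS := hB.isCS
  have hBY : B ≤ Y := hB.1
  have hBB := hB.pr_pr_le hY.isId
  have hDi : Invariant α (D : Set X) := hD ▸ invariant_inf hY.invariant (hα.invariant_spec _)
  have hDs : D ≤ hα.spec (Icc (-δ₂) (-δ₁)) := hD ▸ inf_le_right
  set U := B ⊓ hα.spec (Icc (-η) η) with hU
  have hUi : Invariant α (U : Set X) := invariant_inf hBi (hα.invariant_spec _)
  have hUB : U ≤ B := inf_le_left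
  have hUs : U ≤ hα.spec (Icc (-η) η) := inf_le_right
  have h1 : B ≤ U ⊡ B := hα.le_unit_pr hBCS hBi hη le_rfl
  have h2 : B ≤ B ⊡ U := hα.le_pr_unit hBCS hBi hη le_rfl
  have hU0 : U ≠ ⊥ := fun h => hB0 (eq_bot_mono h1 (by rw [h, bot_pr]))
  set E := B ⊓ hα.spec (Icc (-κ - δ₂ - 2 * η) (-κ + ζ + η)) with hE
  constructor
  · have h3 : D ⊡ U ≠ ⊥ := fun h => hU0 (eq_bot_mono
      ((hY.isId.isCS.le_pr_left (hUB.trans hBY)).trans (pr_mono hD2 le_rfl))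
      (by rw [pr_assoc, h, pr_bot]))
    have h4 := (pr_mono hDs hUs).trans (hα.pr_Icc_le _ _ _ _)
    have h5 := hY.le_corner_pr hm (hα.invariant_pr hDi hUi) (d := δ₂ + η) (κ := κ) (ζ := ζ)
      (h4.trans (hα.spec_mono (Icc_subset_Ici_self.trans (Ici_subset_Ici.2 (by linarith)))))
      (hα.not_le_Ici_of_le_Iic h3 (c := -δ₁ + η) (by linarith)
        (h4.trans (hα.spec_mono Icc_subset_Iic_self))) hκ hζ
    set E' := (⊤ ⊡ (D ⊡ U)) ⊓ hα.spec (Icc (-κ - (δ₂ + η)) (-κ + ζ)) with hE'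
    have h6 : U ⊡ E' ≤ E := by
      refine le_inf ?_ (((pr_mono hUs inf_le_right).trans (hα.pr_Icc_le _ _ _ _)).trans
        (hα.spec_mono (Icc_subset_Icc (by linarith) (by linarith))))
      refine (pr_mono hUB (inf_le_left.trans (top_pr_pr_le.trans (pr_mono le_rfl hUB)))).trans ?_
      rw [← pr_assoc]; exact hBB
    have h7 : B ≤ E ⊡ ⊤ := by
      refine h1.trans ((pr_mono le_rfl (hBY.trans h5)).trans ?_)
      rw [← pr_assoc]; exact pr_mono h6 le_rfl
    refine hBCS.le_pr_self.trans ((pr_mono h7 le_rfl).trans ?_)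
    refine (pr_mono (pr_mono (hBCS.le_pr_right inf_le_left) le_rfl) le_rfl).trans ?_
    rw [pr_assoc, pr_assoc, ← pr_assoc B]
    exact pr_mono le_rfl hBB
  · have h3 : U ⊡ D ≠ ⊥ := fun h => hU0 (eq_bot_mono
      ((hY.isId.isCS.le_pr_right (hUB.trans hBY)).trans (pr_mono le_rfl hD1))
      (by rw [← pr_assoc, h, bot_pr]))
    have h4 := (pr_mono hUs hDs).trans (hα.pr_Icc_le _ _ _ _)
    have h5 := hY.le_pr_corner hm (hα.invariant_pr hUi hDi) (d := δ₂ + η) (κ := κ) (ζ := ζ)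
      (h4.trans (hα.spec_mono (Icc_subset_Ici_self.trans (Ici_subset_Ici.2 (by linarith)))))
      (hα.not_le_Ici_of_le_Iic h3 (c := -δ₁ + η) (by linarith)
        (h4.trans (hα.spec_mono (Icc_subset_Iic_self.trans (Iic_subset_Iic.2 (by linarith)))))) hκ hζ
    set E' := ((U ⊡ D) ⊡ ⊤) ⊓ hα.spec (Icc (-κ - (δ₂ + η)) (-κ + ζ)) with hE'
    have h6 : E' ⊡ U ≤ E := by
      refine le_inf ?_ (((pr_mono inf_le_right hUs).trans (hα.pr_Icc_le _ _ _ _)).trans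
        (hα.spec_mono (Icc_subset_Icc (by linarith) (by linarith))))
      exact (pr_mono (inf_le_left.trans (pr_pr_top_le.trans (pr_mono hUB le_rfl))) hUB).trans hBB
    have h7 : B ≤ ⊤ ⊡ E := by
      refine h2.trans ((pr_mono (hBY.trans h5) le_rfl).trans ?_)
      rw [pr_assoc]; exact pr_mono le_rfl h6
    refine hBCS.le_pr_self.trans ((pr_mono le_rfl h7).trans ?_)
    refine (pr_mono le_rfl (pr_mono le_rfl (hBCS.le_pr_left inf_le_left))).trans ?_
    rw [← pr_assoc, ← pr_assoc]
    exact pr_mono hBB le_rfl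

lemma Full.hereditary_window {hα : IsCStarDynSys α} (hm : hα.AnalyticMaximal) (hY : hα.Full Y)
    {s κ τ : ℝ} (hs : s ∈ actSpec α (Y : Set X)) (hs0 : 0 < s) (hκ : 0 < κ) (hτ : 0 < τ)
    (hB : IsHereditaryIn (Y : Set X) (B : Set X)) (hB0 : B ≠ ⊥) (hBi : Invariant α (B : Set X)) :
    B ≤ (B ⊓ hα.spec (Icc (-κ - s - τ) (-κ + τ))) ⊡ B ∧
      B ≤ B ⊡ (B ⊓ hα.spec (Icc (-κ - s - τ) (-κ + τ))) := by
  have hmin := min_le_left (τ / 4) (s / 2)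
  have hmin' := min_le_right (τ / 4) (s / 2)
  obtain ⟨h1, h2⟩ := hY.le_window hm (κ := τ / 4) (ζ := τ / 8) (ε := min (τ / 4) (s / 2)) hs
    (by positivity) (by linarith) (by positivity) (by positivity)
  obtain ⟨h3, h4⟩ := hY.hereditary_le hm (δ₁ := τ / 8) (δ₂ := τ / 4 + s + min (τ / 4) (s / 2))
    (η := τ / 16) (κ := κ) (ζ := τ / 2) (by positivity) (by linarith) hκ (by positivity)
    (by congr 3 <;> ring) h1 h2 hB hB0 hBi
  have h5 := hα.spec_mono (Icc_subset_Icc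
    (show -κ - s - τ ≤ -κ - (τ / 4 + s + min (τ / 4) (s / 2)) - 2 * (τ / 16) by linarith)
    (show -κ + τ / 2 + τ / 16 ≤ -κ + τ by linarith))
  exact ⟨h3.trans (pr_mono (inf_le_inf_left _ h5) le_rfl), h4.trans (pr_mono le_rfl (inf_le_inf_left _ h5))⟩

lemma Str.mk_neg {hα : IsCStarDynSys α} (hB : sst B = B) {γ : ℝ}
    (h : ∀ ε > 0, B ≤ (B ⊓ hα.spec (Icc (-γ - ε) (-γ + ε))) ⊡ B) : hα.Str B γ := fun ε hε => by
  have := sst_mono (h ε hε)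
  rw [sst_pr, hB, hα.sst_inf_Icc hB] at this
  convert this using 5 <;> ring

lemma Str.add {hα : IsCStarDynSys α} (hB : IsCS B) {a b : ℝ} (ha : hα.Str B a) (hb : hα.Str B b) :
    hα.Str B (a + b) := fun ε hε => by
  refine (hb (ε / 2) (by positivity)).trans ((pr_mono (ha (ε / 2) (by positivity)) le_rfl).trans ?_)
  rw [pr_assoc]
  refine pr_mono le_rfl (le_inf ((pr_mono inf_le_left inf_le_left).trans
    (pr_le hB.closed fun x hx y hy => hB.mul_mem x hx y hy)) ?_)
  refine ((pr_mono inf_le_right inf_le_right).trans (hα.pr_Icc_le _ _ _ _)).trans (hα.spec_mono ?_)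
  exact Icc_subset_Icc (by linarith) (by linarith)

lemma Str.zero (hα : IsCStarDynSys α) (hB : IsCS B) (hBi : Invariant α (B : Set X)) : hα.Str B 0 :=
  fun ε hε => by
    rw [zero_sub, zero_add]
    exact hα.le_pr_unit hB hBi hε le_rfl

lemma Str.zsmul {hα : IsCStarDynSys α} (hB : IsCS B) (hBi : Invariant α (B : Set X)) {d : ℝ}
    (h : hα.Str B d) (h' : hα.Str B (-d)) (n : ℤ) : hα.Str B (n * d) := by
  induction n using Int.induction_on with
  | zero => simpa using Str.zero hα hB hBi
  | succ n ih => have := ih.add hB h; convert this using 1; push_cast; ring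
  | pred n ih => have := ih.add hB h'; convert this using 1; push_cast; ring

/-- Maximality forces the spectrum of `Y` to be the strong Connes spectrum. -/
lemma Full.actSpec_eq {hα : IsCStarDynSys α} (hm : hα.AnalyticMaximal) (hY : hα.Full Y) :
    actSpec α (Y : Set X) = ConnesSpec α (Y : Set X) := by
  have hYs := hY.isId.sst_eq
  refine subset_antisymm (fun γ hγ => hα.mem_connesSpec_iff.2 fun B hB hB0 hBi => ?_)
    fun γ hγ => hα.mem_actSpec_iff.2 fun ε hε h => ?_
  swap
  · have := hα.mem_connesSpec_iff.1 hγ Y (IsHereditaryIn.self hY.isId) hY.ne_bot hY.invariant ε hε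
    rw [h, pr_bot] at this
    exact hY.ne_bot (le_bot_iff.1 this)
  have hBs := hB.isCS.sst_eq
  by_cases hgap : ∃ δ > 0, ∀ s ∈ actSpec α (Y : Set X), 0 < s → δ ≤ s
  · obtain ⟨δ, hδ, hgap⟩ := hgap
    rcases eq_or_ne γ 0 with rfl | hγ0
    · exact Str.zero hα hB.isCS hBi
    obtain ⟨s₀, hs₀, hs₀0⟩ : ∃ s ∈ actSpec α (Y : Set X), 0 < s := by
      rcases lt_or_gt_of_ne hγ0 with h | h
      · exact ⟨-γ, hα.neg_mem_actSpec hYs hγ, by linarith⟩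
      · exact ⟨γ, hγ, h⟩
    have hcl : IsClosed (actSpec α (Y : Set X) ∩ Ici δ) := hα.isClosed_actSpec.inter isClosed_Ici
    have hmin : sInf (actSpec α (Y : Set X) ∩ Ici δ) ∈ actSpec α (Y : Set X) ∩ Ici δ :=
      hcl.csInf_mem ⟨s₀, hs₀, hgap _ hs₀ hs₀0⟩ ⟨δ, fun _ h => h.2⟩
    set d := sInf (actSpec α (Y : Set X) ∩ Ici δ) with hd
    have hd0 : 0 < d := lt_of_lt_of_le hδ hmin.2
    have hdmin : ∀ s ∈ actSpec α (Y : Set X), 0 < s → d ≤ s := fun s hs h =>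
      csInf_le ⟨δ, fun _ h => h.2⟩ ⟨hs, hgap s hs h⟩
    have hwin : ∀ B ≤ Y, ∀ ε > 0, B ⊓ hα.spec (Icc (-(ε / 2) - d - ε / 4) (-(ε / 2) + ε / 4)) ≤
        B ⊓ hα.spec (Icc (-d - ε) (-d + ε)) := fun B hBY ε hε => by
      refine le_inf inf_le_left ((hα.le_spec_inter hα.isClosed_actSpec isClosed_Icc
        (inf_le_left.trans (hBY.trans (hα.le_spec_actSpec hY.isId.closed hY.invariant)))
        inf_le_right).trans (hα.spec_mono fun x hx => ?_))
      obtain ⟨h1, h2, h3⟩ := hx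
      have := hdmin (-x) (hα.neg_mem_actSpec hYs h1) (by linarith)
      exact ⟨by linarith, by linarith⟩
    have hstr : ∀ B : Submodule ℂ X, IsHereditaryIn (Y : Set X) (B : Set X) → B ≠ ⊥ →
        Invariant α (B : Set X) → ∀ n : ℤ, hα.Str B (n * d) := fun B hB hB0 hBi => by
      have hw := fun (ε : ℝ) (hε : 0 < ε) => hY.hereditary_window hm hmin.1 hd0 (κ := ε / 2)
        (τ := ε / 4) (by positivity) (by positivity) hB hB0 hBi
      refine Str.zsmul hB.isCS hBi (Str.mk_neg hB.isCS.sst_eq fun ε hε => ?_) fun ε hε => ?_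
      · exact (hw ε hε).1.trans (pr_mono (hwin B hB.1 ε hε) le_rfl)
      · exact (hw ε hε).2.trans (pr_mono le_rfl (hwin B hB.1 ε hε))
    obtain ⟨n, hn⟩ : ∃ n : ℤ, γ = n * d := by
      refine ⟨⌊γ / d⌋, ?_⟩
      by_contra hne
      have h1 : (⌊γ / d⌋ : ℝ) * d ≤ γ := (le_div_iff₀ hd0).1 (Int.floor_le _)
      have h2 : γ < (⌊γ / d⌋ + 1) * d := (div_lt_iff₀ hd0).1 (Int.lt_floor_add_one _)
      have h1 := lt_of_le_of_ne h1 (Ne.symm hne)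
      set n : ℤ := ⌊γ / d⌋ with hn
      obtain ⟨ε, hε, h3, h4⟩ : ∃ ε > 0, 3 * ε < γ - n * d ∧ 3 * ε < (n + 1) * d - γ := by
        refine ⟨min (γ - n * d) ((n + 1) * d - γ) / 4, ?_, ?_, ?_⟩
        · have : 0 < min (γ - n * d) ((n + 1) * d - γ) := lt_min (by linarith) (by linarith)
          positivity
        · have : 0 < γ - n * d := by linarith
          linarith [min_le_left (γ - n * d) ((n + 1) * d - γ)]
        · have : 0 < (n + 1) * d - γ := by linarith
          linarith [min_le_right (γ - n * d) ((n + 1) * d - γ)]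
      have h5 := hα.sst_Str hYs (hstr Y (IsHereditaryIn.self hY.isId) hY.ne_bot hY.invariant n) hε
      set E := Y ⊓ hα.spec (Icc (-(n * d) - ε) (-(n * d) + ε)) with hE
      have h6 : (Y ⊓ hα.spec (Icc (γ - ε) (γ + ε))) ⊡ E ≠ ⊥ := fun h =>
        hα.mem_actSpec_iff.1 hγ ε hε (eq_bot_mono
          ((hY.isId.isCS.le_pr_right inf_le_left).trans (pr_mono le_rfl h5))
          (by rw [← pr_assoc, h, bot_pr]))
      obtain ⟨s, hs1, hs2⟩ := hα.exists_mem_actSpec hY.isId.closed hY.invariant (isClosed_Icc)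
        (F := Icc (γ - ε + (-(n * d) - ε)) (γ + ε + (-(n * d) + ε))) fun h => h6 (eq_bot_mono (le_inf
          ((pr_mono inf_le_left le_rfl).trans hY.isId.pr_le_right)
          ((pr_mono inf_le_right inf_le_right).trans (hα.pr_Icc_le _ _ _ _))) h)
      have := hdmin s hs2 (by linarith [hs1.1])
      linarith [hs1.2]
    rw [hn]
    exact hstr B hB hB0 hBi n
  · push Not at hgap
    have hw : ∀ κ > 0, ∀ ε > 0, B ≤ (B ⊓ hα.spec (Icc (-κ - ε) (-κ + ε))) ⊡ B ∧
        B ≤ B ⊡ (B ⊓ hα.spec (Icc (-κ - ε) (-κ + ε))) := fun κ hκ ε hε => by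
      obtain ⟨s, hs, hs0, hsε⟩ := hgap (ε / 2) (by positivity)
      obtain ⟨h1, h2⟩ := hY.hereditary_window hm hs hs0 hκ (half_pos hε) hB hB0 hBi
      have h3 := inf_le_inf_left B (hα.spec_mono (Icc_subset_Icc
        (show -κ - ε ≤ -κ - s - ε / 2 by linarith) (show -κ + ε / 2 ≤ -κ + ε by linarith)))
      exact ⟨h1.trans (pr_mono h3 le_rfl), h2.trans (pr_mono le_rfl h3)⟩
    rcases lt_trichotomy γ 0 with h | rfl | h
    · intro ε hε
      have := (hw (-γ) (by linarith) ε hε).2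
      rwa [neg_neg] at this
    · exact Str.zero hα hB.isCS hBi
    · exact Str.mk_neg hBs fun ε hε => (hw γ h ε hε).1

end IsCStarDynSys

end

section

variable {α : ℝ → X → X} {x y : X} {S T V B Y K W C D F : Submodule ℂ X} {G : Set ℝ}

lemma exists_subset_pair_of_three {A : Set ℝ} (hne : A.Nonempty)
    (h : ∀ a ∈ A, ∀ b ∈ A, ∀ c ∈ A, a < b → b < c → False) : ∃ p q : ℝ, p ≤ q ∧ A ⊆ {p, q} := by
  obtain ⟨a, ha⟩ := hne
  by_cases h1 : ∃ b ∈ A, b ≠ a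
  · obtain ⟨b, hb, hba⟩ := h1
    refine ⟨min a b, max a b, min_le_max, fun c hc => ?_⟩
    rw [mem_insert_iff, mem_singleton_iff]
    have h2 := h a ha b hb c hc
    have h3 := h b hb a ha c hc
    have h4 := h a ha c hc b hb
    have h5 := h b hb c hc a ha
    have h6 := h c hc a ha b hb
    have h7 := h c hc b hb a ha
    grind
  · push Not at h1
    exact ⟨a, a, le_rfl, fun c hc => by simp [h1 c hc]⟩

namespace IsCStarDynSys

lemma invariant_of_le_spec_zero (hα : IsCStarDynSys α) (hS : S ≤ hα.spec {0}) :
    Invariant α (S : Set X) := fun t x hx => by rwa [hα.mem_spec_zero_iff.1 (hS hx) t]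

lemma spec_insert_le (hα : IsCStarDynSys α) {a : ℝ} (hG : IsClosed G) (ha : a ∉ G) :
    hα.spec (insert a G) ≤ hα.spec {a} ⊹ hα.spec G := fun x hx => by
  obtain ⟨φ, -, h1, h2⟩ := hα.exists_split_singleton hG ha hx
  simpa using Submodule.add_mem _ (le_sc_left (T := hα.spec G) h1) (le_sc_right (S := hα.spec {a}) h2)

lemma eq_bot_of_le_singleton_of_Ici (hα : IsCStarDynSys α) {a c : ℝ} (h1 : S ≤ hα.spec {a})
    (h2 : S ≤ hα.spec (Ici c)) (hac : a < c) : S = ⊥ :=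
  hα.eq_bot_of_le_Ici_of_Iic h2 (h1.trans (hα.spec_mono (singleton_subset_iff.2 self_mem_Iic))) hac

lemma AnalyticMaximal.topIdl_simple {hα : IsCStarDynSys α} (hm : hα.AnalyticMaximal) {g : ℝ}
    (hg : 0 < g) (hsp : ⊤ ≤ hα.spec {-g, 0, g}) (hKJ : K ≤ hα.topIdl g)
    (h1 : hα.topIdl g ⊡ K ≤ K) (h2 : K ⊡ hα.topIdl g ≤ K) : K = ⊥ ∨ K = hα.topIdl g := by
  have hps := hα.pr_singleton_le
  have hJ : IsCS (hα.topIdl g) := by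
    have := isCS_sst_pr (S := hα.spec {-g}) (by
      rw [hα.sst_spec_singleton, neg_neg]
      refine (pr_mono le_rfl (hps _ _)).trans ((hps _ _).trans (le_of_eq ?_))
      congr 2; ring)
    rwa [hα.sst_spec_singleton, neg_neg] at this
  have hJ0 : hα.topIdl g ≤ hα.spec {0} := (hps _ _).trans (le_of_eq (by rw [add_neg_cancel]))
  have hKi := hα.invariant_of_le_spec_zero (hKJ.trans hJ0)
  have hK0 : K ⊡ hα.spec {0} ≤ K := hJ.pr_le_of_pr_le' hKJ (by
    rw [topIdl, pr_assoc]
    exact pr_mono le_rfl ((hps _ _).trans (le_of_eq (by rw [add_zero])))) h2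
  obtain ⟨V, hV⟩ : ∃ V, V = hα.spec {-g} ⊡ K := ⟨_, rfl⟩
  have hVi : Invariant α (V : Set X) := hV ▸ hα.invariant_pr (hα.invariant_spec _) hKi
  have hVc : IsClosed (V : Set X) := hV ▸ isClosed_pr
  have hVs : V ≤ hα.spec {-g} := by
    rw [hV]
    exact (pr_mono le_rfl (hKJ.trans hJ0)).trans ((hps _ _).trans (le_of_eq (by rw [add_zero])))
  have hA : hα.spec (Ici 0) ≤ hα.spec {0} ⊹ hα.spec {g} := by
    refine (hα.le_spec_inter isClosed_Ici (by simp) le_rfl (le_top.trans hsp)).trans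
      ((hα.spec_mono ?_).trans (hα.spec_insert_le isClosed_singleton (by simpa using hg.ne)))
    rintro x ⟨h3, rfl | h4⟩
    · rw [mem_Ici] at h3; linarith
    · exact h4
  have h0A : hα.spec {0} ≤ hα.spec (Ici 0) := hα.spec_mono (singleton_subset_iff.2 self_mem_Ici)
  have hW : IsAlg (V ⊹ hα.spec (Ici 0)) := by
    rw [sc_comm]
    refine hα.isAlg_Ici.sc ?_ ((pr_mono hA le_rfl).trans (sc_pr_le isClosed_sc ?_ ?_))
      ((pr_mono le_rfl hA).trans (pr_sc_le isClosed_sc ?_ ?_))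
    · have : V ⊡ V = ⊥ := hα.disj_eq_bot (F := {-g + -g}) (G := {-g, 0, g}) (by simp) (by simp) (by
        simp only [disjoint_singleton_left, mem_insert_iff, mem_singleton_iff, not_or]
        refine ⟨?_, ?_, ?_⟩ <;> intro h <;> linarith)
        ((pr_mono hVs hVs).trans (hps _ _)) (le_top.trans hsp)
      rw [this]; exact bot_le
    · refine le_trans ?_ le_sc_right
      rw [hV, ← pr_assoc]
      exact pr_mono ((hps _ _).trans (le_of_eq (by rw [zero_add]))) le_rfl
    · refine le_trans ?_ le_sc_left
      exact ((pr_mono le_rfl hVs).trans (hps _ _)).trans (by rwa [add_neg_cancel])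
    · refine le_trans ?_ le_sc_right
      rw [hV, pr_assoc]
      exact pr_mono le_rfl hK0
    · refine le_trans ?_ le_sc_left
      exact ((pr_mono hVs le_rfl).trans (hps _ _)).trans (by rwa [neg_add_cancel])
  rcases hm.2 _ hW le_sc_right with h | h
  · left
    have hV0 : V = ⊥ := hα.eq_bot_of_le_singleton_of_Ici hVs (le_sc_left.trans h.le) (by linarith)
    refine eq_bot_mono (hJ.le_pr_left hKJ) ?_
    rw [topIdl, pr_assoc, ← hV, hV0, pr_bot]
  · refine Or.inr (le_antisymm hKJ ?_)
    have h3 : hα.spec {-g} ≤ V := (hα.spec_mono (singleton_subset_iff.2 self_mem_Iic)).trans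
      (hα.spec_Iic_le_of_sc_eq_top hVc hVi (neg_lt_zero.2 hg) h)
    conv_lhs => rw [topIdl]
    refine (pr_mono le_rfl h3).trans ?_
    rw [hV, ← pr_assoc]; exact h1

lemma top_le_spec_Iic (hα : IsCStarDynSys α) {c : ℝ} (h : hα.spec (Ici c) = ⊥) :
    ⊤ ≤ hα.spec (Iic c) := by
  refine (hα.le_spec_actSpec isClosed_univ invariant_top).trans (hα.spec_mono fun γ hγ => ?_)
  by_contra hc
  rw [mem_Iic, not_le] at hc
  exact hα.spec_inf_ne_bot_of_mem_actSpec hγ (Ici_mem_nhds hc) (by rw [h, inf_bot_eq])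

lemma AnalyticMaximal.Ici_ne_bot {hα : IsCStarDynSys α} (hm : hα.AnalyticMaximal)
    (hg : ∀ μ > 0, hα.spec (Ici μ) ≠ ⊥ → (⊤ ⊡ hα.spec (Ici μ)) ⊹ hα.spec (Ici 0) = ⊤) :
    ∀ μ > 0, hα.spec (Ici μ) ≠ ⊥ := by
  intro ρ _ hρ
  obtain ⟨ν, hν, hν'⟩ := hm.exists_Ici_ne_bot
  have hmono : ∀ a b : ℝ, a ≤ b → hα.spec (Ici a) = ⊥ → hα.spec (Ici b) = ⊥ := fun a b hab h =>
    eq_bot_mono (hα.spec_mono (Ici_subset_Ici.2 hab)) h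
  have hlb : ν ∈ lowerBounds {a : ℝ | hα.spec (Ici a) = ⊥} := fun a ha =>
    le_of_not_gt fun h => hν' (hmono _ _ h.le ha)
  obtain ⟨m, hm'⟩ : ∃ m, m = sInf {a : ℝ | hα.spec (Ici a) = ⊥} := ⟨_, rfl⟩
  have hνm : ν ≤ m := hm' ▸ le_csInf ⟨ρ, hρ⟩ hlb
  have h1 : hα.spec (Ici (3 / 4 * m)) ≠ ⊥ := fun h => by
    have : m ≤ 3 / 4 * m := hm'.le.trans (csInf_le ⟨ν, hlb⟩ h)
    linarith
  obtain ⟨a, ha, ha'⟩ := exists_lt_of_csInf_lt (b := 5 / 4 * m) ⟨ρ, hρ⟩ (hm'.symm.le.trans_lt (by linarith))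
  refine h1 (hα.eq_bot_of_le_Ici_of_Iic (b := 1 / 2 * m) le_rfl ?_ (by linarith))
  refine (hα.Ici_le_of_sc_eq_top (by linarith) (hg _ (by linarith) h1)).trans
    ((pr_mono le_rfl (hα.top_le_spec_Iic ha)).trans ((hα.pr_Iic_le _ _).trans
    (hα.spec_mono (Iic_subset_Iic.2 (by linarith)))))

/-- A left ideal inside the analytic subalgebra which is carried by the ideal of positive elements. -/
structure AnalyticLeftIdeal (hα : IsCStarDynSys α) (F : Submodule ℂ X) : Prop where
  closed : IsClosed (F : Set X)
  invariant : Invariant α (F : Set X)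
  top_pr : ⊤ ⊡ F ≤ F
  le_Ici : F ≤ hα.spec (Ici 0)
  le_posIdl : F ≤ hα.posIdl
  ne_bot : F ≠ ⊥

namespace AnalyticLeftIdeal

variable {hα : IsCStarDynSys α}

lemma sst_pr_le (hF : hα.AnalyticLeftIdeal F) : sst F ⊡ F ≤ hα.spec {0} := by
  have h1 : sst F ⊡ F ≤ hα.spec (Ici 0) := ((pr_mono le_top le_rfl).trans hF.top_pr).trans hF.le_Ici
  have h2 := sst_mono h1
  rw [sst_pr, sst_sst, hα.sst_spec_Ici, neg_zero] at h2
  exact (hα.le_spec_inter isClosed_Ici isClosed_Iic h1 h2).trans (hα.spec_mono fun x hx =>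
    le_antisymm hx.2 hx.1)

lemma isCS (hF : hα.AnalyticLeftIdeal F) : IsCS (sst F ⊡ F) :=
  isCS_sst_pr ((pr_mono le_top ((pr_mono le_top le_rfl).trans hF.top_pr)).trans hF.top_pr)

lemma pr_sst_pr_le (hF : hα.AnalyticLeftIdeal F) : F ⊡ (sst F ⊡ F) ≤ F := by
  rw [← pr_assoc]
  exact (pr_mono le_top le_rfl).trans hF.top_pr

lemma isId_pr_pr_sst (hF : hα.AnalyticLeftIdeal F) (K : Submodule ℂ X) : IsId (F ⊡ K ⊡ sst F) := by
  refine isId_iff.2 ⟨isClosed_pr, ?_, ?_⟩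
  · rw [← pr_assoc, ← pr_assoc]
    exact pr_mono (pr_mono hF.top_pr le_rfl) le_rfl
  · rw [pr_assoc]
    refine pr_mono le_rfl ?_
    have := sst_mono hF.top_pr
    rwa [sst_pr, sst_top] at this

lemma eq_bot_or_eq_of_ideal (hF : hα.AnalyticLeftIdeal F) (hm : hα.AnalyticMaximal) (hK : K ≤ sst F ⊡ F)
    (h1 : sst F ⊡ F ⊡ K ≤ K) (h2 : K ⊡ (sst F ⊡ F) ≤ K) : K = ⊥ ∨ K = sst F ⊡ F := by
  have hKi := hα.invariant_of_le_spec_zero (hK.trans hF.sst_pr_le)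
  have hIi := hα.invariant_pr (hα.invariant_pr hF.invariant hKi) (hα.invariant_sst hF.invariant)
  have hIY : F ⊡ K ⊡ sst F ≤ hα.posIdl :=
    (pr_mono ((pr_mono hF.le_posIdl le_rfl).trans hα.isId_posIdl.pr_le_right) le_rfl).trans
      hα.isId_posIdl.pr_le_right
  rcases hm.posIdl_simple (hF.isId_pr_pr_sst K) hIY hIi with h | h
  · left
    refine eq_bot_mono ((hF.isCS.le_pr_right hK).trans (pr_mono (hF.isCS.le_pr_left hK) le_rfl)) ?_
    have : sst F ⊡ (F ⊡ K ⊡ sst F) ⊡ F = ⊥ := by rw [h, pr_bot, bot_pr]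
    simpa only [pr_assoc] using this
  · refine Or.inr (le_antisymm hK ?_)
    have h3 : F ≤ F ⊡ K := by
      refine (hα.isId_posIdl.isCS.le_pr_left hF.le_posIdl).trans ?_
      rw [← h, pr_assoc, pr_assoc]
      exact pr_mono le_rfl h2
    refine (pr_mono le_rfl h3).trans ?_
    rw [← pr_assoc]; exact h1

lemma window_pr (hF : hα.AnalyticLeftIdeal F) (a b : ℝ) :
    (F ⊓ hα.spec (Icc a b)) ⊡ (sst F ⊡ F) ≤ F ⊓ hα.spec (Icc a b) := by
  refine le_inf ((pr_mono inf_le_left le_rfl).trans hF.pr_sst_pr_le) ?_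
  refine (pr_mono inf_le_right (hF.sst_pr_le.trans (hα.spec_mono (G := Icc 0 0) (by simp)))).trans ?_
  exact (hα.pr_Icc_le _ _ _ _).trans (by rw [add_zero, add_zero])

lemma sst_window_pr (hF : hα.AnalyticLeftIdeal F) (hm : hα.AnalyticMaximal) {a b : ℝ} (h : F ⊓ hα.spec (Icc a b) ≠ ⊥) :
    sst (F ⊓ hα.spec (Icc a b)) ⊡ (F ⊓ hα.spec (Icc a b)) = sst F ⊡ F := by
  have h1 := hF.window_pr a b
  refine (hF.eq_bot_or_eq_of_ideal hm (pr_mono (sst_mono inf_le_left) inf_le_left) ?_ ?_).resolve_left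
    fun h2 => h (eq_bot_of_sst_pr_self h2)
  · rw [← pr_assoc]
    refine pr_mono ?_ le_rfl
    have := sst_mono h1
    rwa [sst_pr, sst_pr, sst_sst] at this
  · rw [pr_assoc]
    exact pr_mono le_rfl h1

lemma sst_window_pr_Ici (hF : hα.AnalyticLeftIdeal F) {a b c : ℝ} (hbc : b < c) :
    sst (F ⊓ hα.spec (Icc a b)) ⊡ (F ⊓ hα.spec (Ici c)) = ⊥ := by
  refine hα.eq_bot_of_le_singleton_of_Ici ((pr_mono (sst_mono inf_le_left) inf_le_left).trans
    hF.sst_pr_le) (c := -b + c) ?_ (by linarith)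
  refine (pr_mono (sst_mono inf_le_right) inf_le_right).trans ?_
  rw [hα.sst_spec_Icc]
  exact (pr_mono (hα.spec_mono Icc_subset_Ici_self) le_rfl).trans (hα.pr_Ici_le _ _)

lemma window_pr_ne_bot (hF : hα.AnalyticLeftIdeal F) {a b : ℝ} (h : F ⊓ hα.spec (Icc a b) ≠ ⊥) :
    (F ⊓ hα.spec (Icc a b)) ⊡ (sst F ⊡ F) ≠ ⊥ := fun h1 => h <|
  eq_bot_mono (le_pr_of_sst_pr_le hF.isCS (pr_mono (sst_mono inf_le_left) inf_le_left)) h1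

lemma false_of_three (hF : hα.AnalyticLeftIdeal F) (hm : hα.AnalyticMaximal) {s₁ s₂ s₃ : ℝ} (h₁ : s₁ ∈ actSpec α (F : Set X))
    (h₂ : s₂ ∈ actSpec α (F : Set X)) (h₃ : s₃ ∈ actSpec α (F : Set X)) (h12 : s₁ < s₂)
    (h23 : s₂ < s₃) : False := by
  obtain ⟨ε, hε, hε1, hε2⟩ : ∃ ε > 0, 3 * ε < s₂ - s₁ ∧ 3 * ε < s₃ - s₂ := by
    refine ⟨min (s₂ - s₁) (s₃ - s₂) / 4, ?_, ?_, ?_⟩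
    · have : 0 < min (s₂ - s₁) (s₃ - s₂) := lt_min (by linarith) (by linarith)
      positivity
    · linarith [min_le_left (s₂ - s₁) (s₃ - s₂)]
    · linarith [min_le_right (s₂ - s₁) (s₃ - s₂)]
  have w1 := hα.mem_actSpec_iff.1 h₁ ε hε
  have w2 := hα.mem_actSpec_iff.1 h₂ ε hε
  have w3 := hα.mem_actSpec_iff.1 h₃ ε hε
  obtain ⟨N, hN⟩ : ∃ N, N = F ⊓ hα.spec (Ici (s₃ - ε)) := ⟨_, rfl⟩
  have hNc : IsClosed (N : Set X) := hN ▸ hF.closed.inter (hα.isClosed_spec _)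
  have hA : hα.spec (Ici 0) ≤ lmult N N := le_lmult <| by
    rw [hN]
    refine le_inf ((pr_mono le_top inf_le_left).trans hF.top_pr) ?_
    exact (pr_mono le_rfl inf_le_right).trans ((hα.pr_Ici_le _ _).trans (by rw [zero_add]))
  have hNs : N ≤ hα.spec (Ici (s₃ - ε)) := hN ▸ inf_le_right
  have hw3N : F ⊓ hα.spec (Icc (s₃ - ε) (s₃ + ε)) ≤ N :=
    hN ▸ inf_le_inf_left _ (hα.spec_mono Icc_subset_Ici_self)
  rcases hm.2 _ (isAlg_lmult hNc) hA with h | h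
  · have h4 : (F ⊓ hα.spec (Icc (s₁ - ε) (s₁ + ε))) ⊡ sst (F ⊓ hα.spec (Icc (s₂ - ε) (s₂ + ε))) = ⊥ := by
      refine hα.eq_bot_of_le_Ici_of_Iic (a := 0) (b := s₁ + ε + (-(s₂ - ε))) ?_ ?_ (by linarith)
      · rw [← h]
        refine le_lmult ?_
        rw [pr_assoc, hN, hF.sst_window_pr_Ici (by linarith), pr_bot]
        exact bot_le
      · refine (pr_mono inf_le_right (sst_mono inf_le_right)).trans ?_
        rw [hα.sst_spec_Icc]
        exact (hα.pr_Icc_le _ _ _ _).trans (hα.spec_mono Icc_subset_Iic_self)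
    refine hF.window_pr_ne_bot w1 ?_
    rw [← hF.sst_window_pr hm w2, ← pr_assoc, h4, bot_pr]
  · refine hF.window_pr_ne_bot w1 (hα.eq_bot_of_le_Ici_of_Iic (a := s₃ - ε) (b := s₁ + ε) ?_ ?_
      (by linarith))
    · rw [← hF.sst_window_pr hm w3, ← pr_assoc]
      exact ((pr_mono le_top hw3N).trans (pr_le_of_le_lmult hNc h.ge)).trans hNs
    · exact ((hF.window_pr _ _).trans inf_le_right).trans (hα.spec_mono Icc_subset_Iic_self)

lemma exists_posIdl_le (hF : hα.AnalyticLeftIdeal F) (hm : hα.AnalyticMaximal) : ∃ g > 0, hα.posIdl ≤ hα.spec {-g, 0, g} := by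
  have hne : (actSpec α (F : Set X)).Nonempty := by
    obtain ⟨γ, -, hγ⟩ := hα.exists_mem_actSpec hF.closed hF.invariant isClosed_univ
      (by rw [hα.spec_univ, inf_top_eq]; exact hF.ne_bot)
    exact ⟨γ, hγ⟩
  obtain ⟨p, q, hpq, hS⟩ := exists_subset_pair_of_three hne
    fun a ha b hb c hc h1 h2 => hF.false_of_three hm ha hb hc h1 h2
  have hFpq : F ≤ hα.spec {p, q} :=
    (hα.le_spec_actSpec hF.closed hF.invariant).trans (hα.spec_mono hS)
  have hFsc : F ≤ hα.spec {p} ⊹ hα.spec {q} := by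
    rcases hpq.eq_or_lt with rfl | h
    · rw [pair_eq_singleton] at hFpq
      exact hFpq.trans le_sc_left
    · exact hFpq.trans (hα.spec_insert_le isClosed_singleton (by simpa using h.ne))
  have hFsc' : sst F ≤ hα.spec {-p} ⊹ hα.spec {-q} := by
    refine sst_le_iff.2 (hFsc.trans (sc_le (isClosed_sst isClosed_sc) ?_ ?_))
    · rw [← sst_le_iff, hα.sst_spec_singleton]; exact le_sc_left
    · rw [← sst_le_iff, hα.sst_spec_singleton]; exact le_sc_right
  have hI : IsId (F ⊡ sst F) := by
    refine isId_iff.2 ⟨isClosed_pr, ?_, ?_⟩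
    · rw [← pr_assoc]; exact pr_mono hF.top_pr le_rfl
    · rw [pr_assoc]
      refine pr_mono le_rfl ?_
      have := sst_mono hF.top_pr
      rwa [sst_pr, sst_top] at this
  have hIY : F ⊡ sst F = hα.posIdl := by
    refine (hm.posIdl_simple hI ((pr_mono hF.le_posIdl le_rfl).trans hα.isId_posIdl.pr_le_right)
      (hα.invariant_pr hF.invariant (hα.invariant_sst hF.invariant))).resolve_left fun h =>
      hF.ne_bot (sst_eq_bot.1 (eq_bot_of_sst_pr_self ?_))
    rwa [sst_sst]
  have hle : hα.posIdl ≤ hα.spec {-(q - p), 0, q - p} := by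
    have hc := hα.isClosed_spec {-(q - p), 0, q - p}
    have hs : ∀ {a b : ℝ}, a + b ∈ ({-(q - p), 0, q - p} : Set ℝ) →
        hα.spec {a} ⊡ hα.spec {b} ≤ hα.spec {-(q - p), 0, q - p} := fun h =>
      (hα.pr_singleton_le _ _).trans (hα.spec_mono (singleton_subset_iff.2 h))
    rw [← hIY]
    refine (pr_mono hFsc hFsc').trans (sc_pr_le hc (pr_sc_le hc ?_ ?_) (pr_sc_le hc ?_ ?_)) <;>
      refine hs ?_ <;> simp only [mem_insert_iff, mem_singleton_iff]
    · right; left; ring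
    · left; ring
    · right; right; ring
    · right; left; ring
  rcases hpq.eq_or_lt with rfl | h
  · rw [sub_self, neg_zero, pair_eq_singleton, pair_eq_singleton] at hle
    obtain ⟨μ, hμ, hμ'⟩ := hm.exists_Ici_ne_bot
    exact absurd (hα.eq_bot_of_le_singleton_of_Ici ((hα.Ici_le_posIdl hμ).trans hle) le_rfl hμ) hμ'
  · exact ⟨q - p, by linarith, hle⟩

end AnalyticLeftIdeal

lemma AnalyticMaximal.actSpec_eq_of_posIdl_le {hα : IsCStarDynSys α} (hm : hα.AnalyticMaximal) {g : ℝ}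
    (hg : 0 < g) (h : hα.posIdl ≤ hα.spec {-g, 0, g}) :
    actSpec α ((⊤ : Submodule ℂ X) : Set X) = {-g, 0, g} := by
  have hclo : IsClosed ({-g, 0, g} : Set ℝ) := by simp
  have hsub : actSpec α ((⊤ : Submodule ℂ X) : Set X) ⊆ {-g, 0, g} := fun s hs => by
    by_contra hns
    have hs0 : s ≠ 0 := fun h0 => hns (by simp [h0])
    obtain ⟨ε, hε, hε'⟩ := Metric.isOpen_iff.1 hclo.isOpen_compl s hns
    obtain ⟨δ, hδ, hδε, hδs⟩ : ∃ δ > 0, δ < ε ∧ δ < |s| :=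
      ⟨min ε |s| / 2, by positivity, by linarith [min_le_left ε |s|, lt_min hε (abs_pos.2 hs0)],
        by linarith [min_le_right ε |s|, lt_min hε (abs_pos.2 hs0)]⟩
    have h1 : hα.spec (Icc (s - δ) (s + δ)) ≤ hα.posIdl := by
      rcases lt_or_gt_of_ne hs0 with h0 | h0
      · rw [abs_of_neg h0] at hδs
        exact (hα.spec_mono Icc_subset_Iic_self).trans (hα.Iic_le_posIdl (by linarith))
      · rw [abs_of_pos h0] at hδs
        exact (hα.spec_mono Icc_subset_Ici_self).trans (hα.Ici_le_posIdl (by linarith))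
    refine hα.mem_actSpec_iff.1 hs δ hδ (hα.disj_eq_bot isClosed_Icc hclo ?_ inf_le_right
      (inf_le_right.trans (h1.trans h)))
    refine disjoint_left.2 fun x hx hx' => hε' ?_ hx'
    rw [Metric.mem_ball, Real.dist_eq, abs_lt]
    constructor <;> linarith [hx.1, hx.2]
  have hg' : g ∈ actSpec α ((⊤ : Submodule ℂ X) : Set X) := by
    obtain ⟨μ, hμ, hμ'⟩ := hm.exists_Ici_ne_bot
    obtain ⟨γ, h1, h2⟩ := hα.exists_mem_actSpec (S := ⊤) isClosed_univ invariant_top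
      (isClosed_Ici (a := μ)) (by rwa [top_inf_eq])
    rw [mem_Ici] at h1
    rcases hsub h2 with rfl | rfl | rfl
    · linarith
    · linarith
    · exact h2
  refine hsub.antisymm ?_
  rintro _ (rfl | rfl | rfl)
  · exact hα.neg_mem_actSpec sst_top hg'
  · refine hα.mem_actSpec_iff.2 fun ε hε h1 => hm.posIdl_ne_bot (eq_bot_mono le_top ?_)
    have := hα.le_unit_pr IsCS.top invariant_top hε le_rfl
    rw [zero_sub, zero_add] at h1
    rwa [h1, bot_pr, le_bot_iff] at this
  · exact hg'

/-- Maximality of the analytic subalgebra implies the structural condition. -/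
theorem AnalyticMaximal.condition43 {hα : IsCStarDynSys α} (hm : hα.AnalyticMaximal) :
    Condition43 α := by
  by_cases hg : ∀ μ > 0, hα.spec (Ici μ) ≠ ⊥ → (⊤ ⊡ hα.spec (Ici μ)) ⊹ hα.spec (Ici 0) = ⊤
  · have hY := hm.full fun μ hμ => hg μ hμ (hm.Ici_ne_bot hg μ hμ)
    refine Or.inr ⟨hα.posIdl, isClosedTwoSidedIdealIn_univ_iff.2 hY.isId, hY.invariant,
      (alphaSimple_iff hY.isId).2 fun K h1 h2 h3 => hm.posIdl_simple h1 h2 h3, ?_, hY.actSpec_eq hm, ?_⟩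
    · rw [hα.specO_Ioi hY.isId.closed hY.invariant, hα.pos_posIdl]
      exact (hα.specO_Ioi (S := ⊤) isClosed_univ invariant_top).symm
    · rw [hα.specC_eq isClosed_Ici, ← coe_sc, hm.posIdl_sc]; rfl
  · push Not at hg
    obtain ⟨μ, hμ, h0, h1⟩ := hg
    have hAR : hα.spec (Ici μ) ⊡ hα.spec (Ici 0) ≤ hα.spec (Ici μ) :=
      (hα.pr_Ici_le _ _).trans (by rw [add_zero])
    have h2 := (hm.2 _ (hα.isAlg_Ici.top_pr_sc hAR) le_sc_right).resolve_right h1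
    have hF : hα.AnalyticLeftIdeal (⊤ ⊡ hα.spec (Ici μ)) :=
      ⟨isClosed_pr, hα.invariant_pr invariant_top (hα.invariant_spec _), top_pr_pr_le,
        le_sc_left.trans h2.le, (pr_mono le_rfl (hα.Ici_le_posIdl hμ)).trans hα.isId_posIdl.pr_le_left,
        fun h => h0 (eq_bot_mono le_top_pr h)⟩
    obtain ⟨g, hg, hle⟩ := hF.exists_posIdl_le hm
    have hsp := hm.actSpec_eq_of_posIdl_le hg hle
    have htop := hα.le_spec_actSpec (S := ⊤) isClosed_univ invariant_top
    rw [hsp] at htop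
    refine Or.inl ⟨g, hg, hsp, ?_, ?_⟩
    · rw [coe_topIdl hα]; exact hα.isClosedTwoSidedIdealIn_topIdl g
    · rw [coe_topIdl hα]
      exact (hα.topIdl_simple_iff g).2 fun K _ h3 h4 h5 => hm.topIdl_simple hg htop h3 h4 h5

end IsCStarDynSys

end

/-- **Theorem 4.18.** For a nontrivial one-parameter C*-dynamical system `(X, ℝ, α)`,
the analytic subalgebra `X^α([0,∞))` is a maximal norm-closed subalgebra of `X`
if and only if Condition 4.3 holds. -/
theorem maximality_iff_condition43 (α : ℝ → X → X) (hα : IsCStarDynSys α)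
    (hnontrivial : actSpec α (univ : Set X) ≠ ({0} : Set ℝ)) :
    IsMaximalClosedSubalgebra (specC α (Ici (0 : ℝ))) ↔ Condition43 α := by
  refine ⟨fun h => ?_, hα.isMaximal_of_condition43 hnontrivial⟩
  rw [hα.specC_eq isClosed_Ici, isMaximalClosedSubalgebra_iff] at h
  exact IsCStarDynSys.AnalyticMaximal.condition43 (hα := hα) h.2

end PeligradMax
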